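/- arXiv:2012.14014 — 6 statements merged into one kernel-verified Lean document; each statement's English description precedes it below -/
import Mathlib

section
/- Permutation rule for the 2-contraction: Let {R,F} be a compatible pair of R-matrices on V = ℂ^N with F strict skew invertible and R skew invertible of BMW type. Then for every N×N matrix N belonging to the space P(R,F) over the quantum matrix algebra M(R,F), one has N·g = g·(G^{−1}·N·G), where g multiplies the matrix entries (on the right, respectively on the left), and G ∈ End(V) is the invertible numeric matrix defined by G_1 := Tr_(2,3)(K_2 F_1^{−1} F_2^{−1}). -/
open scoped BigOperators
open Matrix

noncomputable section

namespace QMA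

/-- The space of operators on `V^{⊗ n}` (matrices indexed by multi-indices),
    with entries in `A`, where `V = ℂ^N`. -/
abbrev MatV (N n : ℕ) (A : Type*) := Matrix (Fin n → Fin N) (Fin n → Fin N) A

variable {N : ℕ} [NeZero N] {A : Type*}

/-- The `j`-th component of a multi-index (junk value if out of range). -/
def idx {n : ℕ} (a : Fin n → Fin N) (j : ℕ) : Fin N :=
  if h : j < n then a ⟨j, h⟩ else ⟨0, Nat.pos_of_ne_zero (NeZero.ne N)⟩

/-- Place a two-factor operator `X` on the (0-indexed) tensor factors `p, p+1`
    of `V^{⊗ n}`, acting as the identity elsewhere. -/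
def lift2 [Semiring A] {n : ℕ} (p : ℕ) (X : MatV N 2 A) : MatV N n A :=
  fun a b =>
    if ∀ m : Fin n, (m : ℕ) = p ∨ (m : ℕ) = p + 1 ∨ a m = b m then
      X ![idx a p, idx a (p + 1)] ![idx b p, idx b (p + 1)]
    else 0

/-- Place a one-factor operator `X` on the (0-indexed) tensor factor `p`
    of `V^{⊗ n}`, acting as the identity elsewhere. -/
def lift1 [Semiring A] {n : ℕ} (p : ℕ) (X : Matrix (Fin N) (Fin N) A) : MatV N n A :=
  fun a b =>
    if ∀ m : Fin n, (m : ℕ) = p ∨ a m = b m then X (idx a p) (idx b p) else 0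

/-- Extend an operator on `V^{⊗ n}` to `V^{⊗ (n+1)}` by the identity on the last factor. -/
def ext1 [Semiring A] {n : ℕ} (X : MatV N n A) : MatV N (n + 1) A :=
  fun a b =>
    if a (Fin.last n) = b (Fin.last n) then X (fun t => a t.castSucc) (fun t => b t.castSucc)
    else 0

/-- The partial trace over the last tensor factor, weighted by the matrix `D`. -/
def ptrace [NonUnitalNonAssocSemiring A] {n : ℕ} (D : Matrix (Fin N) (Fin N) A)
    (X : MatV N (n + 1) A) : MatV N n A :=
  fun a b => ∑ m : Fin N, ∑ c : Fin N, D m c * X (Fin.snoc a c) (Fin.snoc b m)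

/-- The full `D`-weighted trace over all `n` tensor factors. -/
def trAll [NonUnitalNonAssocSemiring A] (D : Matrix (Fin N) (Fin N) A) :
    (n : ℕ) → MatV N n A → A
  | 0, X => X (fun i => i.elim0) (fun i => i.elim0)
  | n + 1, X => trAll D n (ptrace D X)

/-- The `D`-weighted trace over all tensor factors except the first. -/
def trTail [NonUnitalNonAssocSemiring A] (D : Matrix (Fin N) (Fin N) A) :
    (j : ℕ) → MatV N (j + 1) A → MatV N 1 A
  | 0, X => X
  | j + 1, X => trTail D j (ptrace D X)

/-- Identify operators on `V^{⊗1}` with `N × N` matrices. -/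
def toN (X : MatV N 1 A) : Matrix (Fin N) (Fin N) A := fun i j => X (fun _ => i) (fun _ => j)

/-- Entrywise embedding of complex matrices into matrices over a `ℂ`-algebra. -/
def cmap [Ring A] [Algebra ℂ A] {m : Type*} (X : Matrix m m ℂ) : Matrix m m A :=
  X.map (algebraMap ℂ A)

/-- Multiply all entries of a matrix by `c` on the right. -/
def rmulE [Mul A] {m : Type*} (X : Matrix m m A) (c : A) : Matrix m m A := fun a b => X a b * c

/-- Multiply all entries of a matrix by `c` on the left. -/
def lmulE [Mul A] {m : Type*} (c : A) (X : Matrix m m A) : Matrix m m A := fun a b => c * X a b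

/-- The operator `D` associated with a skew inverse `Ψ`: `D_1 = Tr_(2) Ψ₁₂`. -/
def Dof (Ψ : MatV N 2 ℂ) : Matrix (Fin N) (Fin N) ℂ :=
  fun i j => ∑ m : Fin N, Ψ ![i, m] ![j, m]

/-- `Ψ` is a skew inverse of the R-matrix `R`:
    `Tr_(2)(R₁₂ Ψ₂₃) = Tr_(2)(Ψ₁₂ R₂₃) = P₁₃`. -/
def SkewPair (R Ψ : MatV N 2 ℂ) : Prop :=
  (∀ a1 a3 b1 b3 : Fin N,
      (∑ m : Fin N, ∑ c : Fin N, R ![a1, m] ![b1, c] * Ψ ![c, a3] ![m, b3]) =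
        if a1 = b3 ∧ a3 = b1 then 1 else 0) ∧
  (∀ a1 a3 b1 b3 : Fin N,
      (∑ m : Fin N, ∑ c : Fin N, Ψ ![a1, m] ![b1, c] * R ![c, a3] ![m, b3]) =
        if a1 = b3 ∧ a3 = b1 then 1 else 0)

/-- The `q`-number `j_q = (q^j - q^{-j})/(q - q^{-1})`. -/
def nq (q : ℂ) (j : ℕ) : ℂ := (q ^ (j : ℤ) - q ^ (-(j : ℤ))) / (q - q⁻¹)

/-- The rank-one projector `K = μ⁻¹ (q-q⁻¹)⁻¹ (qI - R)(q⁻¹I + R)` of a BMW-type R-matrix. -/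
def bmwK (q μ : ℂ) (R : MatV N 2 ℂ) : MatV N 2 ℂ :=
  (μ⁻¹ * (q - q⁻¹)⁻¹) • ((q • (1 : MatV N 2 ℂ) - R) * (q⁻¹ • (1 : MatV N 2 ℂ) + R))

/-- The braid relation `R₁ R₂ R₁ = R₂ R₁ R₂`. -/
def IsBraid (R : MatV N 2 ℂ) : Prop :=
  lift2 (n := 3) 0 R * lift2 1 R * lift2 0 R = lift2 1 R * lift2 0 R * lift2 1 R

/-- `R` is an R-matrix of BMW type with eigenvalues `q, -q⁻¹, μ`. -/
def IsBMW (q μ : ℂ) (R : MatV N 2 ℂ) : Prop :=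
  (q • (1 : MatV N 2 ℂ) - R) * (q⁻¹ • (1 : MatV N 2 ℂ) + R) * (μ • (1 : MatV N 2 ℂ) - R) = 0 ∧
  lift2 (n := 3) 1 (bmwK q μ R) * lift2 0 (bmwK q μ R) =
      lift2 1 (bmwK q μ R) * lift2 0 R * lift2 1 R ∧
  lift2 (n := 3) 1 (bmwK q μ R) * lift2 0 (bmwK q μ R) =
      lift2 1 (bmwK q μ R) * lift2 0 R⁻¹ * lift2 1 R⁻¹ ∧
  lift2 (n := 3) 0 (bmwK q μ R) * lift2 1 (bmwK q μ R) * lift2 0 (bmwK q μ R) =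
      lift2 0 (bmwK q μ R)

/-- `{R, F}` is a compatible pair of R-matrices (twist relations). -/
def Compatible (R F : MatV N 2 ℂ) : Prop :=
  lift2 (n := 3) 0 R * lift2 1 F * lift2 0 F = lift2 1 F * lift2 0 F * lift2 1 R ∧
  lift2 (n := 3) 1 R * lift2 0 F * lift2 1 F = lift2 0 F * lift2 1 F * lift2 0 R

/-- The antisymmetrizers `A^{(i)} ∈ End(V^{⊗i})` of a BMW-type R-matrix. -/
def asym (q μ : ℂ) (R : MatV N 2 ℂ) : (i : ℕ) → MatV N i ℂ
  | 0 => 1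
  | 1 => 1
  | i + 2 =>
      (q ^ (i + 1) / nq q (i + 2)) •
        (ext1 (asym q μ R (i + 1)) *
          ((1 : MatV N (i + 2) ℂ) +
              ((q ^ (-(2 * ((i : ℤ) + 1))) - 1) / (q - q⁻¹)) • lift2 i R +
              (μ * (q ^ (-(2 * ((i : ℤ) + 1))) - 1) / (μ + q ^ (1 - 2 * ((i : ℤ) + 1)))) •
                lift2 i (bmwK q μ R)) *
          ext1 (asym q μ R (i + 1)))

/-- The height-`k` cutting condition
    `A^{(k)} σ⁻_k(q^{-2k}) A^{(k)} = 0` in `End(V^{⊗(k+1)})`. -/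
def HeightCut (q μ : ℂ) (R : MatV N 2 ℂ) (k : ℕ) : Prop :=
  ext1 (asym q μ R k) *
      ((1 : MatV N (k + 1) ℂ) +
          ((q ^ (-(2 * (k : ℤ))) - 1) / (q - q⁻¹)) • lift2 (k - 1) R +
          (μ * (q ^ (-(2 * (k : ℤ))) - 1) / (μ + q ^ (1 - 2 * (k : ℤ)))) •
            lift2 (k - 1) (bmwK q μ R)) *
      ext1 (asym q μ R k) = 0

/-- `R` is an R-matrix of height `k`. -/
def HasHeight (q μ : ℂ) (R : MatV N 2 ℂ) (k : ℕ) : Prop :=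
  2 ≤ k ∧ (∀ i, 2 ≤ i → i ≤ k → asym q μ R i ≠ 0) ∧ HeightCut q μ R k

section AlgebraSide

variable [Ring A] [Algebra ℂ A]

/-- The copies `M_{(i+1)}` of the quantum matrix inside `V^{⊗n}`:
    `M_{(1)} = M₁`, `M_{(i+1)} = F_i M_{(i)} F_i⁻¹`. -/
def Mcopy {n : ℕ} (F : MatV N 2 ℂ) (M : Matrix (Fin N) (Fin N) A) : ℕ → MatV N n A
  | 0 => lift1 0 M
  | j + 1 => cmap (lift2 j F) * Mcopy F M j * cmap (lift2 j F⁻¹)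

/-- The product `M_{(1)} M_{(2)} ⋯ M_{(j)}`. -/
def Mprod {n : ℕ} (F : MatV N 2 ℂ) (M : Matrix (Fin N) (Fin N) A) : ℕ → MatV N n A
  | 0 => 1
  | j + 1 => Mprod F M j * Mcopy F M j

/-- The product `M_{(2)} M_{(3)} ⋯ M_{(j+1)}`. -/
def MprodFrom2 {n : ℕ} (F : MatV N 2 ℂ) (M : Matrix (Fin N) (Fin N) A) : ℕ → MatV N n A
  | 0 => 1
  | j + 1 => MprodFrom2 F M j * Mcopy F M (j + 1)

/-- The defining relation `R₁ M_{(1)} M_{(2)} = M_{(1)} M_{(2)} R₁` of the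
    quantum matrix algebra `M(R,F)`. -/
def QMArel (R F : MatV N 2 ℂ) (M : Matrix (Fin N) (Fin N) A) : Prop :=
  cmap (lift2 (n := 2) 0 R) * Mcopy F M 0 * Mcopy F M 1 =
    Mcopy F M 0 * Mcopy F M 1 * cmap (lift2 (n := 2) 0 R)

/-- The 2-contraction `g` of the quantum matrix `M`. -/
def gElt (q μ : ℂ) (R F ΨR : MatV N 2 ℂ) (M : Matrix (Fin N) (Fin N) A) : A :=
  (μ * (q - q⁻¹) / ((q - μ) * (q⁻¹ + μ))) •
    trAll (cmap (Dof ΨR)) 2 (Mprod F M 2 * cmap (lift2 0 (bmwK q μ R)))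

/-- The elementary symmetric functions `a_i` of the quantum matrix `M`. -/
def aElt (q μ : ℂ) (R F ΨR : MatV N 2 ℂ) (M : Matrix (Fin N) (Fin N) A) : ℕ → A
  | 0 => 1
  | i + 1 => trAll (cmap (Dof ΨR)) (i + 1) (Mprod F M (i + 1) * cmap (asym q μ R (i + 1)))

/-- The map `φ(X)₁ = Tr_{R(2)}(F₁ X₁ F₁⁻¹ R₁)`. -/
def phi (R F ΨR : MatV N 2 ℂ) (X : Matrix (Fin N) (Fin N) A) : Matrix (Fin N) (Fin N) A :=
  toN (ptrace (cmap (Dof ΨR))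
    (cmap (lift2 (n := 2) 0 F) * lift1 0 X * cmap (lift2 (n := 2) 0 F⁻¹) *
      cmap (lift2 (n := 2) 0 R)))

/-- The map `ξ(X)₁ = Tr_{R(2)}(F₁ X₁ F₁⁻¹ K₁)`. -/
def xi (q μ : ℂ) (R F ΨR : MatV N 2 ℂ) (X : Matrix (Fin N) (Fin N) A) :
    Matrix (Fin N) (Fin N) A :=
  toN (ptrace (cmap (Dof ΨR))
    (cmap (lift2 (n := 2) 0 F) * lift1 0 X * cmap (lift2 (n := 2) 0 F⁻¹) *
      cmap (lift2 (n := 2) 0 (bmwK q μ R))))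

/-- The map `φ⁻¹(X)₁ = μ⁻² Tr_{R_f(2)}(F₁⁻¹ X₁ R₁⁻¹ F₁)`,
    where the `R_f`-trace has weight `D_{F⁻¹} (D_{R⁻¹})⁻¹ D_F`. -/
def phiInv (μ : ℂ) (R F ΨF ΨFinv ΨRinv : MatV N 2 ℂ) (X : Matrix (Fin N) (Fin N) A) :
    Matrix (Fin N) (Fin N) A :=
  (μ⁻¹) ^ 2 •
    toN (ptrace (cmap (Dof ΨFinv * (Dof ΨRinv)⁻¹ * Dof ΨF))
      (cmap (lift2 (n := 2) 0 F⁻¹) * lift1 0 X * cmap (lift2 (n := 2) 0 R⁻¹) *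
        cmap (lift2 (n := 2) 0 F)))

/-- Star-multiplication by `M`: `L(X) = M ⋆ X = M · φ(X)`. -/
def Lmap (R F ΨR : MatV N 2 ℂ) (M X : Matrix (Fin N) (Fin N) A) : Matrix (Fin N) (Fin N) A :=
  M * phi R F ΨR X

/-- The star-powers `M^{[n]}` of the quantum matrix. -/
def starPow (R F ΨR : MatV N 2 ℂ) (M : Matrix (Fin N) (Fin N) A) : ℕ → Matrix (Fin N) (Fin N) A
  | 0 => 1
  | n + 1 => M * phi R F ΨR (starPow R F ΨR M n)

/-- The wedge powers `M^{a^{(i)}} = Tr_{R(2,…,i)}(M_{(1)} ⋯ M_{(i)} A^{(i)})`. -/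
def Mwedge (q μ : ℂ) (R F ΨR : MatV N 2 ℂ) (M : Matrix (Fin N) (Fin N) A) :
    ℕ → Matrix (Fin N) (Fin N) A
  | 0 => 1
  | i + 1 => toN (trTail (cmap (Dof ΨR)) i (Mprod F M (i + 1) * cmap (asym q μ R (i + 1))))

/-- The descendants `A^{(m,i)} = i_q · M^{[m]} ⋆ M^{a^{(i)}}` (here `m ≥ 0`). -/
def Ad (q μ : ℂ) (R F ΨR : MatV N 2 ℂ) (M : Matrix (Fin N) (Fin N) A) (m i : ℕ) :
    Matrix (Fin N) (Fin N) A :=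
  nq q i • (Lmap R F ΨR M)^[m] (Mwedge q μ R F ΨR M i)

/-- The descendants `B^{(m,i)}`, including the boundary value
    `B^{(0,i)} = i_q φ⁻¹(ξ(M^{a^{(i)}}))`. -/
def Bd (q μ : ℂ) (R F ΨR ΨF ΨFinv ΨRinv : MatV N 2 ℂ) (M : Matrix (Fin N) (Fin N) A) :
    ℕ → ℕ → Matrix (Fin N) (Fin N) A
  | 0, i => nq q i • phiInv μ R F ΨF ΨFinv ΨRinv (xi q μ R F ΨR (Mwedge q μ R F ΨR M i))
  | m + 1, i => nq q i • (Lmap R F ΨR M)^[m] (M * xi q μ R F ΨR (Mwedge q μ R F ΨR M i))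

/-- The boundary descendant
    `A^{(-1,i)} = i_q φ⁻¹(Tr_{R(2,…,i)}(M_{(2)} ⋯ M_{(i)} A^{(i)}))`. -/
def Aneg1 (q μ : ℂ) (R F ΨR ΨF ΨFinv ΨRinv : MatV N 2 ℂ) (M : Matrix (Fin N) (Fin N) A) :
    ℕ → Matrix (Fin N) (Fin N) A
  | 0 => 0
  | i + 1 =>
      nq q (i + 1) •
        phiInv μ R F ΨF ΨFinv ΨRinv
          (toN (trTail (cmap (Dof ΨR)) i (MprodFrom2 F M i * cmap (asym q μ R (i + 1)))))

/-- The shifted family `AdS m i = A^{(m-1,i)}` (so that `AdS 0 i = A^{(-1,i)}`). -/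
def AdS (q μ : ℂ) (R F ΨR ΨF ΨFinv ΨRinv : MatV N 2 ℂ) (M : Matrix (Fin N) (Fin N) A) :
    ℕ → ℕ → Matrix (Fin N) (Fin N) A
  | 0, i => Aneg1 q μ R F ΨR ΨF ΨFinv ΨRinv M i
  | m + 1, i => Ad q μ R F ΨR M m i

/-- The coefficients `ε_i` of the symplectic Cayley-Hamilton identity. -/
def eps (q μ : ℂ) (R F ΨR : MatV N 2 ℂ) (M : Matrix (Fin N) (Fin N) A) (k i : ℕ) : A :=
  if i ≤ k then
    ∑ j ∈ Finset.range (i / 2 + 1), aElt q μ R F ΨR M (i - 2 * j) * gElt q μ R F ΨR M ^ j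
  else
    (∑ j ∈ Finset.range ((2 * k - i) / 2 + 1),
        aElt q μ R F ΨR M (2 * k - i - 2 * j) * gElt q μ R F ΨR M ^ j) *
      gElt q μ R F ΨR M ^ (i - k)

/-- The map `π(X)₁ = Tr_{R(2)}(R₁ X₁ K₁)`. -/
def piMap (q μ : ℂ) (R ΨR : MatV N 2 ℂ) (X : Matrix (Fin N) (Fin N) A) :
    Matrix (Fin N) (Fin N) A :=
  toN (ptrace (cmap (Dof ΨR))
    (cmap (lift2 (n := 2) 0 R) * lift1 0 X * cmap (lift2 (n := 2) 0 (bmwK q μ R))))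

end AlgebraSide

/-- The matrix `G₁ = Tr_(2,3)(K₂ F₁⁻¹ F₂⁻¹)`. -/
def Gmat (q μ : ℂ) (R F : MatV N 2 ℂ) : Matrix (Fin N) (Fin N) ℂ :=
  toN (trTail (1 : Matrix (Fin N) (Fin N) ℂ) 2
    (lift2 (n := 3) 1 (bmwK q μ R) * lift2 0 F⁻¹ * lift2 1 F⁻¹))

end QMA

end

noncomputable section

namespace QMA

variable {N : ℕ} [NeZero N] {A : Type*} [Ring A] [Algebra ℂ A]

/-- The representation `ρ_R` of braid words: a word is a list of pairs
`(i, b)` standing for `σ_{i+1}` if `b = true` and `σ_{i+1}⁻¹` if `b = false`. -/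
def rhoWord {n : ℕ} (R : MatV N 2 ℂ) : List (ℕ × Bool) → MatV N n ℂ
  | [] => 1
  | (i, b) :: w => (if b then lift2 i R else lift2 i R⁻¹) * rhoWord R w

/-- A braid word for the braid group `B_n` only uses the generators `σ_1, …, σ_{n-1}`. -/
def WordOK (n : ℕ) (w : List (ℕ × Bool)) : Prop := ∀ p ∈ w, p.1 + 2 ≤ n

/-- The element `ch(α) = Tr_{R(1,…,n)}(M_{(1)} ⋯ M_{(n)} ρ_R(α))` of `M(R,F)`. -/
def chA (R F ΨR : MatV N 2 ℂ) (M : Matrix (Fin N) (Fin N) A) (n : ℕ)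
    (w : List (ℕ × Bool)) : A :=
  trAll (cmap (Dof ΨR)) n (Mprod F M n * cmap (rhoWord R w))

/-- The matrix `(M^α)₁ = Tr_{R(2,…,n)}(M_{(1)} ⋯ M_{(n)} ρ_R(α))` for `α ∈ B_{m+1}`. -/
def MalA (R F ΨR : MatV N 2 ℂ) (M : Matrix (Fin N) (Fin N) A) (m : ℕ)
    (w : List (ℕ × Bool)) : Matrix (Fin N) (Fin N) A :=
  toN (trTail (cmap (Dof ΨR)) m (Mprod F M (m + 1) * cmap (rhoWord R w)))

/-- The spanning set of the space `P(R,F)`: the matrices `I·ch(α)` and `M^α`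
over all braid words `α`. -/
def Pset (R F ΨR : MatV N 2 ℂ) (M : Matrix (Fin N) (Fin N) A) :
    Set (Matrix (Fin N) (Fin N) A) :=
  {X | (∃ n w, WordOK n w ∧ X = chA R F ΨR M n w • (1 : Matrix (Fin N) (Fin N) A)) ∨
       (∃ m w, WordOK (m + 1) w ∧ X = MalA R F ΨR M m w)}

end QMA

end

namespace QMA

section Cross

variable {B : Type*} [Ring B] {S : B →+* B} {u v ω ζ : B}

theorem cross_ket {b : B} (hvω : v * ω = 1)
    (h : b * S b * (u * v) = S (u * v) * (b * S b)) :
    b * S b * u = S u * (S v * b * S b * ω) :=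
  calc b * S b * u = b * S b * (u * v) * ω := by simp only [mul_assoc, hvω, mul_one]
    _ = S u * (S v * b * S b * ω) := by rw [h, map_mul]; simp only [mul_assoc]

theorem cross_bra {b : B} (hvω : v * ω = 1) (hζu : ζ * u = 1)
    (h : b * S b * (u * v) = S (u * v) * (b * S b)) :
    S v * b * S b = S v * b * S b * ω * v :=
  calc S v * b * S b = S (ζ * u) * (S v * b * S b) := by rw [hζu, map_one, one_mul]
    _ = S ζ * (S (u * v) * (b * S b)) := by simp only [map_mul, mul_assoc]
    _ = S ζ * (b * S b * u * v) := by rw [← h]; simp only [mul_assoc]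
    _ = S (ζ * u) * (S v * b * S b * ω * v) := by
      rw [cross_ket hvω h]; simp only [map_mul, mul_assoc]
    _ = _ := by rw [hζu, map_one, one_mul]

theorem cross_local {b : B} (hv : ∀ x, v * S (S x) = x * v) (hω : ∀ x, ω * x = S (S x) * ω)
    (hb : ∀ x, b * S (S x) = S (S x) * b) (x : B) :
    S v * b * S b * ω * S x = S x * (S v * b * S b * ω) := by
  have hb' : S b * S (S (S x)) = S (S (S x)) * S b := by rw [← map_mul, hb, map_mul]
  have hv' : S v * S (S (S x)) = S x * S v := by rw [← map_mul, hv, map_mul]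
  calc S v * b * S b * ω * S x = S v * b * S b * (ω * S x) := by simp only [mul_assoc]
    _ = S v * b * (S b * S (S (S x))) * ω := by rw [hω]; simp only [mul_assoc]
    _ = S v * (b * S (S (S x))) * S b * ω := by rw [hb']; simp only [mul_assoc]
    _ = (S v * S (S (S x))) * b * S b * ω := by rw [hb]; simp only [mul_assoc]
    _ = _ := by rw [hv']; simp only [mul_assoc]

theorem comm_cross_pair {b x z : B} (hu : ∀ y, u * y = S (S y) * u) (hζu : ζ * u = 1)
    (hb : ∀ y, b * S (S y) = S (S y) * b) (hx : ∀ y, x * S (S y) = S (S y) * x)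
    (hbx : x * S b * b = S b * b * S x)
    (hz : b * S b * u = S u * z) (hzl : ∀ y, z * S y = S y * z) :
    x * (z * S z) = z * S z * x := by
  have hcomm : S (S b) * b = b * S (S b) := (hb b).symm
  have hbx' : S x * S (S b) * S b = S (S b) * S b * S (S x) := by
    simpa only [map_mul] using congrArg S hbx
  have hz' : S b * S (S b) * S u = S (S u) * S z := by
    simpa only [map_mul] using congrArg S hz
  have key : S b * S (S b) * (b * S b) * u = S (S u) * (z * S z) :=
    calc S b * S (S b) * (b * S b) * u = S b * S (S b) * (b * S b * u) := by
          simp only [mul_assoc]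
      _ = S b * S (S b) * S u * z := by rw [hz]; simp only [mul_assoc]
      _ = S (S u) * (S z * z) := by rw [hz']; simp only [mul_assoc]
      _ = _ := by rw [hzl]
  have hmove : S b * S (S b) * (b * S b) * S (S x) = x * (S b * S (S b) * (b * S b)) :=
    calc S b * S (S b) * (b * S b) * S (S x)
        = S b * (S (S b) * b) * (S b * S (S x)) := by simp only [mul_assoc]
      _ = S b * b * (S (S b) * S b * S (S x)) := by rw [hcomm]; simp only [mul_assoc]
      _ = S b * b * S x * S (S b) * S b := by rw [← hbx']; simp only [mul_assoc]
      _ = x * S b * (b * S (S b)) * S b := by rw [← hbx]; simp only [mul_assoc]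
      _ = _ := by rw [← hcomm]; simp only [mul_assoc]
  have h1 : S (S u) * (z * S z * x) = S (S u) * (x * (z * S z)) :=
    calc S (S u) * (z * S z * x) = S b * S (S b) * (b * S b) * u * x := by
          rw [key]; simp only [mul_assoc]
      _ = S b * S (S b) * (b * S b) * S (S x) * u := by rw [mul_assoc _ u, hu, ← mul_assoc]
      _ = x * (S (S u) * (z * S z)) := by rw [hmove, mul_assoc, key]
      _ = x * S (S u) * (z * S z) := by rw [mul_assoc]
      _ = _ := by rw [hx, mul_assoc]
  have h2 := congrArg (fun y => S (S ζ) * y) h1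
  simp only [← mul_assoc, ← map_mul, hζu, map_one, one_mul] at h2
  simpa only [mul_assoc, map_mul] using h2.symm

theorem cross_zigzag {b z : B} (hu : ∀ y, u * y = S (S y) * u)
    (hb : ∀ y, b * S (S y) = S (S y) * b)
    (hz : b * S b * u = S u * z) (hzv : S v * b * S b = z * v) :
    b * S z * (S v * u) = S (S v * u) * z * b := by
  have hzv' : S (S v) * S b * S (S b) = S z * S v := by
    simpa only [map_mul] using congrArg S hzv
  calc b * S z * (S v * u) = b * (S z * S v) * u := by simp only [mul_assoc]
    _ = (b * S (S v)) * S b * S (S b) * u := by rw [← hzv']; simp only [mul_assoc]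
    _ = S (S v) * b * S b * (S (S b) * u) := by rw [hb]; simp only [mul_assoc]
    _ = S (S v) * (b * S b * u) * b := by rw [← hu]; simp only [mul_assoc]
    _ = _ := by rw [hz]; simp only [map_mul, mul_assoc]

theorem cross_double {b y z : B} (hu : ∀ x, u * x = S (S x) * u) (hζu : ζ * u = 1)
    (hb : ∀ x, b * S (S x) = S (S x) * b) (hbraid : b * S b * b = S b * b * S b)
    (hz : b * S b * u = S u * z) (hy : S b * b * S u = u * y)
    (hzl : ∀ x, z * S x = S x * z) {z' : B} (hz' : z' * z = 1) :
    b * (y * z) = S (y * z) * b := by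
  have hcomm : S (S b) * b = b * S (S b) := (hb b).symm
  have hbraid' : S b * S (S b) * S b = S (S b) * S b * S (S b) := by
    simpa only [map_mul] using congrArg S hbraid
  have hJ : S b * b * (b * S b * u) = u * (y * z) := by
    rw [hz, ← mul_assoc, hy, mul_assoc]
  have hJ' : S (S b) * S b * (S b * S (S b) * S u) = S u * S (y * z) := by
    simpa only [map_mul] using congrArg S hJ
  have hL : b * S b * S (S b) * u = S u * z * b := by
    rw [mul_assoc, ← hu, ← mul_assoc, hz]
  have hshift0 : b * S b * S (S b) * b = S b * (b * S b * S (S b)) :=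
    calc b * S b * S (S b) * b = b * S b * (S (S b) * b) := by simp only [mul_assoc]
      _ = (b * S b * b) * S (S b) := by rw [hcomm]; simp only [mul_assoc]
      _ = _ := by rw [hbraid]; simp only [mul_assoc]
  have hshift1 : b * S b * S (S b) * S b = S (S b) * (b * S b * S (S b)) :=
    calc b * S b * S (S b) * S b = b * (S b * S (S b) * S b) := by simp only [mul_assoc]
      _ = (b * S (S b)) * S b * S (S b) := by rw [hbraid']; simp only [mul_assoc]
      _ = _ := by rw [← hcomm]; simp only [mul_assoc]
  have h1 : S u * (z * (b * (y * z))) = S u * (z * (S (y * z) * b)) :=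
    calc S u * (z * (b * (y * z))) = b * S b * S (S b) * (u * (y * z)) := by
          rw [← mul_assoc _ u, hL]; simp only [mul_assoc]
      _ = b * S b * S (S b) * S b * (b * b * S b * u) := by
          rw [← hJ]; simp only [mul_assoc]
      _ = S (S b) * (b * S b * S (S b) * b) * (b * S b * u) := by
          rw [hshift1]; simp only [mul_assoc]
      _ = S (S b) * (S b * (b * S b * S (S b))) * (b * S b * u) := by rw [hshift0]
      _ = S (S b) * S b * (b * S b * S (S b) * b) * (S b * u) := by simp only [mul_assoc]
      _ = S (S b) * S b * S b * (b * S b * S (S b) * S b) * u := by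
          rw [hshift0]; simp only [mul_assoc]
      _ = S (S b) * S b * S b * S (S b) * (b * S b * S (S b) * u) := by
          rw [hshift1]; simp only [mul_assoc]
      _ = S (S b) * S b * (S b * S (S b) * S u) * (z * b) := by
          rw [hL]; simp only [mul_assoc]
      _ = S u * (S (y * z) * z) * b := by rw [hJ']; simp only [mul_assoc]
      _ = _ := by rw [← hzl]; simp only [mul_assoc]
  have h2 := congrArg (fun x => z' * (S ζ * x)) h1
  simpa only [← mul_assoc, ← map_mul, hζu, map_one, one_mul, hz'] using h2

theorem local_inv {y y' : B} (hyy' : y * y' = 1) (hy'y : y' * y = 1)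
    (hyl : ∀ x, y * S x = S x * y) (x : B) : y' * S x = S x * y' :=
  calc y' * S x = y' * (S x * y) * y' := by rw [mul_assoc, mul_assoc, hyy', mul_one]
    _ = S x * y' := by rw [← hyl, ← mul_assoc, hy'y, one_mul]

theorem pair_mul {y z : B} (hzl : ∀ x, z * S x = S x * z) :
    y * z * S (y * z) = y * S y * (z * S z) := by
  rw [map_mul, mul_assoc y z, ← mul_assoc z, hzl]
  simp only [mul_assoc]

theorem comm_mul_pair {b y z : B} (hzl : ∀ x, z * S x = S x * z)
    (hby : b * (y * S y) = y * S y * b) (hbz : b * (z * S z) = z * S z * b) :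
    b * (y * z * S (y * z)) = y * z * S (y * z) * b := by
  rw [pair_mul hzl, ← mul_assoc, hby, mul_assoc, hbz]
  simp only [mul_assoc]

theorem comm_zigzag_pair {b b' y y' z z' w : B} (hbb' : b * b' = 1) (hb'b : b' * b = 1)
    (hyy' : y * y' = 1) (hy'y : y' * y = 1) (hzz' : z * z' = 1) (hz'z : z' * z = 1)
    (hyl : ∀ x, y * S x = S x * y) (hzl : ∀ x, z * S x = S x * z)
    (hwl : ∀ x, w * S x = S x * w)
    (hby : b * (y * S y) = y * S y * b) (hbz : b * (z * S z) = z * S z * b)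
    (hzw : b * S z * w = S w * z * b) (hyw : b' * S y' * w = S w * y' * b')
    (hyz : b * (y * z) = S (y * z) * b) :
    b * (w * S w) = w * S w * b := by
  have Syy' : S y * S y' = 1 := by rw [← map_mul, hyy', map_one]
  have Sy'y : S y' * S y = 1 := by rw [← map_mul, hy'y, map_one]
  have Szz' : S z * S z' = 1 := by rw [← map_mul, hzz', map_one]
  have Sz'z : S z' * S z = 1 := by rw [← map_mul, hz'z, map_one]
  have hy'l := local_inv hyy' hy'y hyl
  have hz'l := local_inv hzz' hz'z hzl
  have hE0 : b * S w * y' = S y' * w * b :=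
    calc b * S w * y' = b * (S w * y' * b') * b := by simp only [mul_assoc, hb'b, mul_one]
      _ = (b * b') * (S y' * w * b) := by rw [← hyw]; simp only [mul_assoc]
      _ = _ := by rw [hbb', one_mul]
  have hE : b * S (y * w) = y * w * b :=
    calc b * S (y * w) = b * (S y * y * y') * S w := by
          rw [map_mul, mul_assoc (S y), hyy', mul_one, mul_assoc]
      _ = b * (y * S y) * (y' * S w) := by rw [hyl]; simp only [mul_assoc]
      _ = y * S y * (b * S w * y') := by rw [hby, hy'l]; simp only [mul_assoc]
      _ = y * (S y * S y') * (w * b) := by rw [hE0]; simp only [mul_assoc]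
      _ = _ := by rw [Syy', mul_one, mul_assoc]
  have hQ : b * S (y * z) = y * z * b :=
    calc b * S (y * z) = S z' * S y' * (S (y * z) * b) * S (y * z) := by
          rw [map_mul, ← mul_assoc (S z' * S y'), mul_assoc (S z'), ← mul_assoc (S y'), Sy'y,
            one_mul, Sz'z, one_mul]
      _ = S z' * S y' * (b * (y * z * S (y * z))) := by rw [← hyz]; simp only [mul_assoc]
      _ = S z' * S y' * (y * z * S (y * z)) * b := by
          rw [comm_mul_pair hzl hby hbz, ← mul_assoc]
      _ = S z' * S y' * (y * S (y * z)) * z * b := by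
          rw [mul_assoc y, hzl]; simp only [mul_assoc]
      _ = S z' * (S y' * S y) * S z * y * z * b := by
          rw [hyl, map_mul]; simp only [mul_assoc]
      _ = _ := by rw [Sy'y, mul_one, Sz'z, one_mul]
  have hSH : b * S (z' * w) = z' * w * b :=
    calc b * S (z' * w) = z' * y' * (y * z * b) * (S z' * S w) := by
          simp only [← mul_assoc, map_mul]
          rw [mul_assoc z', hy'y, mul_one, hz'z, one_mul]
      _ = z' * y' * (b * (S y * (S z * S z')) * S w) := by
          rw [← hQ, map_mul]; simp only [mul_assoc]
      _ = z' * y' * (b * S (y * w)) := by rw [Szz', mul_one, map_mul]; simp only [mul_assoc]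
      _ = z' * (y' * y) * w * b := by rw [hE]; simp only [mul_assoc]
      _ = _ := by rw [hy'y, mul_one]
  have hH : b * (z' * w) = S (z' * w) * b :=
    calc b * (z' * w) = z' * S z' * (S z * z) * b * z' * w := by
          rw [mul_assoc z', ← mul_assoc (S z'), Sz'z, one_mul, hz'z, one_mul, mul_assoc]
      _ = z' * S z' * (b * (S z * z)) * z' * w := by
          rw [← hzl, hbz]; simp only [mul_assoc]
      _ = z' * S z' * (b * S z * (z * z') * w) := by simp only [mul_assoc]
      _ = z' * S (z' * w) * z * b := by
          rw [hzz', mul_one, hzw, map_mul]; simp only [mul_assoc]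
      _ = _ := by rw [hz'l, mul_assoc (S (z' * w)), hz'z, mul_one]
  have hHl : ∀ x, z' * w * S x = S x * (z' * w) := fun x => by
    rw [mul_assoc, hwl, ← mul_assoc, hz'l, mul_assoc]
  have hHp : b * (z' * w * S (z' * w)) = z' * w * S (z' * w) * b := by
    rw [← mul_assoc, hH, mul_assoc, hSH, ← mul_assoc, ← hHl]
  have := comm_mul_pair hHl hbz hHp
  rwa [← mul_assoc z, hzz', one_mul] at this

end Cross

section BMW

variable {B : Type*} [Ring B] [Algebra ℂ B] {μ : ℂ} {r s r' s' k l : B}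

theorem bmw_sandwich_lower (hμ : μ ≠ 0) (hkr : k * r = μ • k)
    (hlk : l * k = l * r * s) (hshift : l * r * s = r * s * k) (hklk : k * l * k = k) :
    k * s * k = μ⁻¹ • k := by
  have h : k = μ • (k * s * k) :=
    calc k = k * (l * k) := by rw [← mul_assoc, hklk]
      _ = k * r * s * k := by rw [hlk, hshift]; simp only [mul_assoc]
      _ = μ • (k * s * k) := by rw [hkr]; simp only [smul_mul_assoc]
  conv_rhs => rw [h]
  rw [smul_smul, inv_mul_cancel₀ hμ, one_smul]

theorem bmw_sandwich (hμ : μ ≠ 0) (hrr' : r * r' = 1) (hr'r : r' * r = 1) (hss' : s * s' = 1)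
    (hbraid : r * s * r = s * r * s) (hkr : k * r = μ • k) (hrk : r * k = μ • k)
    (hlk : l * k = l * r * s) (hshift : l * r * s = r * s * k) (hklk : k * l * k = k) :
    l * r * l = μ⁻¹ • l := by
  have hr'k : r' * k = μ⁻¹ • k := by
    have : k = μ • (r' * k) := by rw [← mul_smul_comm, ← hrk, ← mul_assoc, hr'r, one_mul]
    conv_rhs => rw [this]
    rw [smul_smul, inv_mul_cancel₀ hμ, one_smul]
  have hconj : r * (r * s) = r * s * (r * s * r') :=
    calc r * (r * s) = r * (r * s * r) * r' := by simp only [mul_assoc, hrr', mul_one]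
      _ = _ := by rw [hbraid]; simp only [mul_assoc]
  have h : l * r * l * (r * s) = μ⁻¹ • l * (r * s) :=
    calc l * r * l * (r * s) = l * (r * (r * s)) * k := by
          rw [mul_assoc, ← mul_assoc l r s, hshift]; simp only [mul_assoc]
      _ = (l * r * s) * r * s * (r' * k) := by rw [hconj]; simp only [mul_assoc]
      _ = r * s * (k * r) * s * (r' * k) := by rw [hshift]; simp only [mul_assoc]
      _ = r * s * (k * s * k) := by
          rw [hkr, hr'k]
          simp only [mul_smul_comm, smul_mul_assoc, smul_smul, inv_mul_cancel₀ hμ, one_smul,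
            mul_assoc]
      _ = μ⁻¹ • l * (r * s) := by
          rw [bmw_sandwich_lower hμ hkr hlk hshift hklk, mul_smul_comm, ← hshift, smul_mul_assoc,
            mul_assoc]
  have h2 := congrArg (fun x => x * s' * r') h
  simpa only [mul_assoc, ← mul_assoc s, hss', one_mul, hrr', mul_one] using h2

theorem bmw_upper (hμ : μ ≠ 0) (hrr' : r * r' = 1) (hr'r : r' * r = 1) (hss' : s * s' = 1)
    (hbraid : r * s * r = s * r * s) (hkr : k * r = μ • k) (hrk : r * k = μ • k)
    (hsl : s * l = μ • l)
    (hlk : l * k = l * r * s) (hshift : l * r * s = r * s * k) (hklk : k * l * k = k) :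
    l * k * l = l := by
  rw [hlk, mul_assoc, hsl, mul_smul_comm,
    bmw_sandwich hμ hrr' hr'r hss' hbraid hkr hrk hlk hshift hklk, smul_smul,
    mul_inv_cancel₀ hμ, one_smul]

end BMW

end QMA

noncomputable section

namespace QMA

/-- A `ℂ`-algebra containing `A` together with isometries `e a` and co-isometries `f a` that
commute with `A` and identify the regular module with its own `N`-fold power. Operators on all
tensor powers of `V` live in such an algebra at once. -/
structure Leavitt (N : ℕ) (A B : Type*) [Ring A] [Algebra ℂ A] [Ring B] [Algebra ℂ B] where
  ι : A →ₐ[ℂ] B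
  e : Fin N → B
  f : Fin N → B
  f_mul_e : ∀ a b, f a * e b = if a = b then 1 else 0
  sum_e_mul_f : ∑ a, e a * f a = 1
  ι_mul_e : ∀ x a, ι x * e a = e a * ι x
  ι_mul_f : ∀ x a, ι x * f a = f a * ι x

namespace Leavitt

variable {N : ℕ} {A B : Type*} [Ring A] [Algebra ℂ A] [Ring B] [Algebra ℂ B]
  (L : Leavitt N A B)

/-- The endomorphism `x ↦ ∑ e a * x * f a`, which moves operators one tensor factor to the
right. -/
def S : B →+* B where
  toFun x := ∑ a, L.e a * x * L.f a
  map_one' := by simp [L.sum_e_mul_f]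
  map_zero' := by simp
  map_add' x y := by simp [mul_add, add_mul, Finset.sum_add_distrib]
  map_mul' x y := by
    simp_rw [Finset.sum_mul, Finset.mul_sum]
    refine Finset.sum_congr rfl fun a _ => ?_
    have h : ∀ b, L.e a * x * L.f a * (L.e b * y * L.f b) =
        L.e a * x * (L.f a * L.e b) * y * L.f b := fun b => by simp only [mul_assoc]
    simp_rw [h, L.f_mul_e]
    simp [mul_assoc]

theorem S_apply (x : B) : L.S x = ∑ a, L.e a * x * L.f a := rfl

theorem f_mul_S (a : Fin N) (x : B) : L.f a * L.S x = x * L.f a := by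
  simp_rw [S_apply, Finset.mul_sum, ← mul_assoc, L.f_mul_e]
  simp

theorem S_mul_e (a : Fin N) (x : B) : L.S x * L.e a = L.e a * x := by
  simp_rw [S_apply, Finset.sum_mul, mul_assoc, L.f_mul_e]
  simp

/-- The ordered product `e (a 0) * e (a 1) * ⋯`. -/
def E {n : ℕ} (a : Fin n → Fin N) : B := (List.ofFn fun i => L.e (a i)).prod

/-- The reversed product `⋯ * f (a 1) * f (a 0)`. -/
def E' {n : ℕ} (a : Fin n → Fin N) : B := (List.ofFn fun i => L.f (a i)).reverse.prod

theorem E_succ {n : ℕ} (a : Fin (n + 1) → Fin N) : L.E a = L.e (a 0) * L.E (Fin.tail a) := by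
  simp [E, List.ofFn_succ, Fin.tail]

theorem E'_succ {n : ℕ} (a : Fin (n + 1) → Fin N) :
    L.E' a = L.E' (Fin.tail a) * L.f (a 0) := by
  simp [E', List.ofFn_succ, Fin.tail]

theorem E'_mul_E {n : ℕ} (a b : Fin n → Fin N) : L.E' a * L.E b = if a = b then 1 else 0 := by
  induction n with
  | zero => simp [E, E', Subsingleton.elim a b]
  | succ n ih =>
    rw [E_succ, E'_succ, mul_assoc, ← mul_assoc (L.f _), f_mul_e]
    have : a = b ↔ a 0 = b 0 ∧ Fin.tail a = Fin.tail b := by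
      constructor
      · rintro rfl; simp
      · rintro ⟨h0, h1⟩
        rw [← Fin.cons_self_tail a, ← Fin.cons_self_tail b, h0, h1]
    by_cases h0 : a 0 = b 0 <;> simp [this, h0, ih]

theorem sum_E_mul_E' (n : ℕ) : ∑ a : Fin n → Fin N, L.E a * L.E' a = 1 := by
  induction n with
  | zero => simp [E, E']
  | succ n ih =>
    rw [← (Fin.consEquiv fun _ => Fin N).sum_comp, Fintype.sum_prod_type]
    have h : ∀ (x : Fin N) (y : Fin n → Fin N),
        L.E (Fin.consEquiv (fun _ => Fin N) (x, y)) * L.E' (Fin.consEquiv (fun _ => Fin N) (x, y)) =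
        L.e x * (L.E y * L.E' y) * L.f x := fun x y => by
      rw [E_succ, E'_succ]; simp only [mul_assoc]; rfl
    simp_rw [h, ← Finset.sum_mul, ← Finset.mul_sum, ih, mul_one, L.sum_e_mul_f]

theorem ι_mul_E {n : ℕ} (x : A) (a : Fin n → Fin N) : L.ι x * L.E a = L.E a * L.ι x := by
  induction n with
  | zero => simp [E]
  | succ n ih => rw [E_succ, ← mul_assoc, L.ι_mul_e, mul_assoc, ih, mul_assoc]

theorem ι_mul_E' {n : ℕ} (x : A) (a : Fin n → Fin N) : L.ι x * L.E' a = L.E' a * L.ι x := by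
  induction n with
  | zero => simp [E']
  | succ n ih => rw [E'_succ, ← mul_assoc, ih, mul_assoc, L.ι_mul_f, mul_assoc]

theorem eq_of_coeff (n : ℕ) {x y : B}
    (h : ∀ a b : Fin n → Fin N, L.E' a * x * L.E b = L.E' a * y * L.E b) : x = y := by
  have key : ∀ z : B, z = ∑ a : Fin n → Fin N, ∑ b : Fin n → Fin N,
      L.E a * (L.E' a * z * L.E b) * L.E' b := fun z => by
    have h : ∀ a b : Fin n → Fin N, L.E a * (L.E' a * z * L.E b) * L.E' b =
        (L.E a * L.E' a) * z * (L.E b * L.E' b) := fun a b => by simp only [mul_assoc]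
    simp_rw [h, ← Finset.mul_sum, sum_E_mul_E', mul_one, ← Finset.sum_mul, sum_E_mul_E', one_mul]
  rw [key x, key y]
  simp_rw [h]

/-- The operator on the first `n` tensor factors given by a matrix with entries in `A`. -/
def rho {n : ℕ} (X : MatV N n A) : B := ∑ a, ∑ b, L.E a * L.ι (X a b) * L.E' b

theorem coeff_rho {n : ℕ} (X : MatV N n A) (a b : Fin n → Fin N) :
    L.E' a * L.rho X * L.E b = L.ι (X a b) := by
  simp_rw [rho, Finset.mul_sum, Finset.sum_mul]
  have h : ∀ c d : Fin n → Fin N, L.E' a * (L.E c * L.ι (X c d) * L.E' d) * L.E b =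
      (L.E' a * L.E c) * L.ι (X c d) * (L.E' d * L.E b) := fun c d => by simp only [mul_assoc]
  simp [h, E'_mul_E]

theorem eq_rho {n : ℕ} {x : B} {X : MatV N n A}
    (h : ∀ a b : Fin n → Fin N, L.E' a * x * L.E b = L.ι (X a b)) : x = L.rho X :=
  L.eq_of_coeff n fun a b => by rw [h, coeff_rho]

theorem coeff_mul {n : ℕ} (x y : B) (a b : Fin n → Fin N) :
    L.E' a * (x * y) * L.E b =
      ∑ c : Fin n → Fin N, (L.E' a * x * L.E c) * (L.E' c * y * L.E b) := by
  have h : ∀ c : Fin n → Fin N, (L.E' a * x * L.E c) * (L.E' c * y * L.E b) =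
      L.E' a * x * (L.E c * L.E' c) * (y * L.E b) := fun c => by simp only [mul_assoc]
  simp_rw [h, ← Finset.sum_mul, ← Finset.mul_sum, sum_E_mul_E', mul_one, mul_assoc]

/-- `rho` as a ring homomorphism. -/
def rhoHom (n : ℕ) : MatV N n A →+* B where
  toFun := L.rho
  map_one' := (L.eq_rho fun a b => by
    rw [mul_one, E'_mul_E, Matrix.one_apply]; split_ifs <;> simp).symm
  map_mul' X Y := (L.eq_rho fun a b => by
    simp_rw [coeff_mul, coeff_rho, Matrix.mul_apply, map_sum, map_mul]).symm
  map_zero' := by simp [rho]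
  map_add' X Y := by simp [rho, mul_add, add_mul, Finset.sum_add_distrib]

theorem rho_mul {n : ℕ} (X Y : MatV N n A) : L.rho (X * Y) = L.rho X * L.rho Y :=
  map_mul (L.rhoHom n) X Y

theorem rho_injective {n : ℕ} (hι : Function.Injective L.ι) :
    Function.Injective (L.rho (n := n)) := fun X Y h => by
  ext a b
  exact hι (by rw [← coeff_rho, h, coeff_rho])

theorem E_two (a : Fin 2 → Fin N) : L.E a = L.e (a 0) * L.e (a 1) := by
  simp [E, List.ofFn_succ]

theorem E'_two (a : Fin 2 → Fin N) : L.E' a = L.f (a 1) * L.f (a 0) := by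
  simp [E', List.ofFn_succ]

end Leavitt

end QMA

end

noncomputable section

namespace QMA

namespace Leavitt

/-- The Leavitt structure on the linear endomorphisms of the space of `A`-valued functions of
infinite sequences in `Fin N`. -/
def model (N : ℕ) (A : Type*) [Ring A] [Algebra ℂ A] :
    Leavitt N A (Module.End ℂ ((ℕ → Fin N) → A)) where
  ι := (Algebra.lmul ℂ ((ℕ → Fin N) → A)).comp (AlgHom.pi fun _ => AlgHom.id ℂ A)
  e a :=
    { toFun := fun g s => if s 0 = a then g fun n => s (n + 1) else 0
      map_add' := fun g h => by ext s; simp only [Pi.add_apply]; split_ifs <;> simp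
      map_smul' := fun c g => by ext s; simp }
  f a := LinearMap.funLeft ℂ A fun s n => Nat.casesOn n a s
  f_mul_e a b := by
    refine LinearMap.ext fun g => funext fun s => ?_
    by_cases h : a = b <;> simp [LinearMap.funLeft_apply, h]
  sum_e_mul_f := by
    refine LinearMap.ext fun g => funext fun s => ?_
    have h : ∀ n, (Nat.casesOn n (s 0) (fun m => s (m + 1)) : Fin N) = s n := fun n => by
      cases n <;> rfl
    simp [LinearMap.sum_apply, LinearMap.funLeft_apply, h]
  ι_mul_e x a := by
    refine LinearMap.ext fun g => funext fun s => ?_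
    simp
  ι_mul_f x a := rfl

theorem model_ι_injective (N : ℕ) [NeZero N] (A : Type*) [Ring A] [Algebra ℂ A] :
    Function.Injective (model N A).ι := fun x y h => by
  have := congrFun (congrArg (fun l => l 1) h) 0
  simpa [model] using this

end Leavitt

end QMA

end

namespace QMA

section Twist

variable {B : Type*} [Ring B] {S : B →+* B} {u v ω ζ : B}

theorem conj_swap {b b' c d : B} (hbb' : b * b' = 1) (hb'b : b' * b = 1) (h : b * c = d * b) :
    b' * d = c * b' :=
  calc b' * d = b' * (d * b) * b' := by simp only [mul_assoc, hbb', mul_one]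
    _ = c * b' := by rw [← h, ← mul_assoc, hb'b, one_mul]

theorem exists_cross {b b' : B} (hbb' : b * b' = 1) (hb'b : b' * b = 1)
    (hvω : v * ω = 1) (hζu : ζ * u = 1) (h : b * S b * (u * v) = S (u * v) * (b * S b)) :
    b * S b * u = S u * (S v * b * S b * ω) ∧ S v * b * S b = S v * b * S b * ω * v ∧
      S b' * b' * S u = u * (v * (S b' * b') * S ω) ∧
      S v * b * S b * ω * (v * (S b' * b') * S ω) = 1 ∧
      v * (S b' * b') * S ω * (S v * b * S b * ω) = 1 := by
  have h1 := cross_ket hvω h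
  have hBB' : b * S b * (S b' * b') = 1 := by
    rw [mul_assoc, ← mul_assoc (S b), ← map_mul, hbb', map_one, one_mul, hbb']
  have hB'B : S b' * b' * (b * S b) = 1 := by
    rw [mul_assoc, ← mul_assoc b', hb'b, one_mul, ← map_mul, hb'b, map_one]
  have h2 : S b' * b' * S (u * v) = u * v * (S b' * b') := conj_swap hBB' hB'B h
  have h3 : S b' * b' * S u = u * (v * (S b' * b') * S ω) :=
    calc S b' * b' * S u = S b' * b' * S (u * v) * S ω := by
          simp only [map_mul, mul_assoc]; rw [← map_mul S v, hvω, map_one, mul_one]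
      _ = _ := by rw [h2]; simp only [mul_assoc]
  refine ⟨h1, cross_bra hvω hζu h, h3, ?_, ?_⟩
  · generalize S v * b * S b * ω = z at *
    generalize v * (S b' * b') * S ω = z' at *
    calc z * z' = S ζ * (S u * z) * z' := by rw [← mul_assoc, ← map_mul, hζu, map_one, one_mul]
      _ = S ζ * (b * S b * (u * z')) := by rw [← h1]; simp only [mul_assoc]
      _ = S ζ * (b * S b * (S b' * b') * S u) := by rw [← h3]; simp only [mul_assoc]
      _ = 1 := by rw [hBB', one_mul, ← map_mul, hζu, map_one]
  · generalize S v * b * S b * ω = z at *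
    generalize v * (S b' * b') * S ω = z' at *
    calc z' * z = ζ * (u * z') * z := by rw [← mul_assoc, hζu, one_mul]
      _ = ζ * (S b' * b' * (S u * z)) := by rw [← h3]; simp only [mul_assoc]
      _ = ζ * (S b' * b' * (b * S b) * u) := by rw [← h1]; simp only [mul_assoc]
      _ = 1 := by rw [hB'B, one_mul, hζu]

theorem zigzag_inv (hvω : v * ω = 1) (hζu : ζ * u = 1)
    (hk : u * v * S (u * v) * (u * v) = u * v) : v * S u * (S v * u) = 1 :=
  calc v * S u * (S v * u) = ζ * u * (v * S u * (S v * u)) * (v * ω) := by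
        rw [hζu, hvω, one_mul, mul_one]
    _ = ζ * (u * v * S (u * v) * (u * v)) * ω := by simp only [map_mul, mul_assoc]
    _ = ζ * u * (v * ω) := by rw [hk]; simp only [mul_assoc]
    _ = 1 := by rw [hζu, hvω, one_mul]

theorem zigzag_inv' (hvω : v * ω = 1) (hζu : ζ * u = 1)
    (hk : S (u * v) * (u * v) * S (u * v) = S (u * v)) : S v * u * (v * S u) = 1 :=
  calc S v * u * (v * S u) = S (ζ * u) * (S v * u * (v * S u)) * S (v * ω) := by
        rw [hζu, hvω, map_one, one_mul, mul_one]
    _ = S ζ * (S (u * v) * (u * v) * S (u * v)) * S ω := by simp only [map_mul, mul_assoc]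
    _ = S (ζ * u) * S (v * ω) := by rw [hk]; simp only [map_mul, mul_assoc]
    _ = 1 := by rw [hζu, hvω, map_one, one_mul]

theorem zigzag_local (hu : ∀ y, u * y = S (S y) * u) (hv : ∀ x, v * S (S x) = x * v) (x : B) :
    S v * u * S x = S x * (S v * u) := by
  rw [mul_assoc, hu, ← mul_assoc, ← map_mul, hv, map_mul, mul_assoc]

theorem comm_pair_inv {b y y' : B} (hyy' : y * y' = 1) (hy'y : y' * y = 1)
    (hyl : ∀ x, y * S x = S x * y) (h : b * (y' * S y') = y' * S y' * b) :
    b * (y * S y) = y * S y * b := by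
  have h1 : y' * S y' * (y * S y) = 1 := by
    rw [hyl, mul_assoc, ← mul_assoc (S y'), ← map_mul, hy'y, map_one, one_mul, hy'y]
  have h2 : y * S y * (y' * S y') = 1 := by
    rw [hyl, mul_assoc, ← mul_assoc y, hyy', one_mul, ← map_mul, hyy', map_one]
  exact (conj_swap h1 h2 h.symm).symm

/-- Partial-transpose-free form of the twisting of the rank-one operator `u * v` by a compatible
pair: the twist `y` exists, and the operator `S v * u * y` commutes in pairs with both members of
the compatible pair. -/
theorem exists_twist {F F' r : B} (hu : ∀ y, u * y = S (S y) * u)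
    (hv : ∀ x, v * S (S x) = x * v) (hω : ∀ x, ω * x = S (S x) * ω)
    (hF : ∀ x, F * S (S x) = S (S x) * F) (hF' : ∀ x, F' * S (S x) = S (S x) * F')
    (hr : ∀ x, r * S (S x) = S (S x) * r)
    (hvω : v * ω = 1) (hζu : ζ * u = 1) (hFF' : F * F' = 1) (hF'F : F' * F = 1)
    (hbraid : F * S F * F = S F * F * S F) (hrbraid : r * S r * r = S r * r * S r)
    (hrF : S r * F * S F = F * S F * r)
    (hkF : S (u * v) * F * S F = F * S F * (u * v))
    (hFk : u * v * S F * F = S F * F * S (u * v))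
    (hrk : S (u * v) * (u * v) = r * S r * (u * v)) :
    ∃ y y' z z' : B, y = v * (S F * F) * S ω ∧ z' = v * (S F' * F') * S ω ∧
      F * S F * u = S u * z ∧ z * z' = 1 ∧ S F' * F' * S u = u * z' ∧ y * y' = 1 ∧ y' * y = 1 ∧
      S v * F' * S F' = y' * v ∧ v * (S F * F) = y * S v ∧
      (∀ x, S v * u * y * S x = S x * (S v * u * y)) ∧
      F * (S v * u * y * S (S v * u * y)) = S v * u * y * S (S v * u * y) * F ∧
      r * (S v * u * y * S (S v * u * y)) = S v * u * y * S (S v * u * y) * r := by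
  have SFF' : S F * S F' = 1 := by rw [← map_mul, hFF', map_one]
  have SF'F : S F' * S F = 1 := by rw [← map_mul, hF'F, map_one]
  have i1 : F * S F * (S F' * F') = 1 := by
    rw [mul_assoc, ← mul_assoc (S F), SFF', one_mul, hFF']
  have i2 : S F' * F' * (F * S F) = 1 := by
    rw [mul_assoc, ← mul_assoc F', hF'F, one_mul, SF'F]
  have i3 : S F * F * (F' * S F') = 1 := by
    rw [mul_assoc, ← mul_assoc F, hFF', one_mul, SFF']
  have i4 : F' * S F' * (S F * F) = 1 := by
    rw [mul_assoc, ← mul_assoc (S F'), SF'F, one_mul, hF'F]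
  have h : F * S F * (u * v) = S (u * v) * (F * S F) := by rw [← hkF, mul_assoc]
  have h' : F' * S F' * (u * v) = S (u * v) * (F' * S F') :=
    conj_swap i3 i4 (by rw [← hFk, mul_assoc])
  obtain ⟨hz, hzv, hz'u, hzz', hz'z⟩ := exists_cross hFF' hF'F hvω hζu h
  obtain ⟨hy', hy'v, hyu, hy'y, hyy'⟩ := exists_cross hF'F hFF' hvω hζu h'
  have hzl := cross_local hv hω hF
  have hy'l := cross_local hv hω hF'
  refine ⟨_, S v * F' * S F' * ω, _, _, rfl, rfl, hz, hzz', hz'u, ?_⟩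
  generalize S v * F * S F * ω = z at *
  generalize v * (S F' * F') * S ω = z' at *
  generalize S v * F' * S F' * ω = y' at *
  generalize v * (S F * F) * S ω = y at *
  have hyl := local_inv hy'y hyy' hy'l
  have hwl : ∀ x, S v * u * S x = S x * (S v * u) := zigzag_local hu hv
  have hr0 : r * S r * u = S u * (S v * u) :=
    calc r * S r * u = r * S r * (u * v) * ω := by simp only [mul_assoc, hvω, mul_one]
      _ = _ := by rw [← hrk, map_mul]; simp only [mul_assoc, hvω, mul_one]
  have hbr' : F * S F' * F' = S F' * F' * S F := by
    rw [mul_assoc]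
    exact (conj_swap i1 i2 (by rw [hbraid]; simp only [mul_assoc])).symm
  have hrF' : r * S F' * F' = S F' * F' * S r := by
    rw [mul_assoc]
    exact (conj_swap i1 i2 (by rw [← hrF, mul_assoc])).symm
  have c1 := comm_cross_pair hu hζu hF hF hbraid hz hzl
  have c2 := comm_pair_inv hyy' hy'y hyl (comm_cross_pair hu hζu hF' hF hbr' hy' hy'l)
  have c3 := comm_pair_inv hyy' hy'y hyl (comm_cross_pair hu hζu hF' hr hrF' hy' hy'l)
  have c4 := comm_cross_pair hu hζu hr hr hrbraid hr0 hwl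
  have c5 := cross_zigzag hu hF hz hzv
  have c6 := cross_zigzag hu hF' hy' hy'v
  have c7 := cross_double hu hζu hF hbraid hz hyu hzl hz'z
  have c8 := comm_zigzag_pair hFF' hF'F hyy' hy'y hzz' hz'z hyl hzl hwl c2 c1 c5 c6 c7
  refine ⟨hyy', hy'y, hy'v, ?_, fun x => ?_, comm_mul_pair hyl c8 c2,
    comm_mul_pair hyl c4 c3⟩
  · calc v * (S F * F) = y * (y' * v) * (S F * F) := by rw [← mul_assoc y, hyy', one_mul]
      _ = y * S v * (F' * S F' * (S F * F)) := by rw [← hy'v]; simp only [mul_assoc]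
      _ = y * S v := by rw [i4, mul_one]
  · rw [mul_assoc, hyl, ← mul_assoc, hwl, mul_assoc]

/-- The contraction `g` of two copies of `m` with the rank-one operator `u * v` moves through `m`
at the cost of conjugation by the twist. -/
theorem contraction_comm {F F' m g z z' y y' : B} (hFF' : F * F' = 1) (hF'F : F' * F = 1)
    (hbraid : F * S F * F = S F * F * S F)
    (hmF : m * S F = S F * m) (hmu : m * S u = S u * m) (hmv : m * S v = S v * m)
    (hgu : g * (S v * u) = S v * u * g)
    (hgz' : g * z' = z' * g) (hm : m * (F * m * F') * u = u * g)
    (hm' : v * (m * (F * m * F')) = g * v)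
    (hmF' : m * S F' = S F' * m)
    (hz : F * S F * u = S u * z) (hzz' : z * z' = 1) (hz' : S F' * F' * S u = u * z')
    (hy'y : y' * y = 1) (hy'v : S v * F' * S F' = y' * v) (hyv : v * (S F * F) = y * S v)
    (hW : v * S u * (S v * u) = 1) (hW' : S v * u * (v * S u) = 1) :
    m * (g * (S v * u * y)) = g * (S v * u * y) * m := by
  have SFF' : S F * S F' = 1 := by rw [← map_mul, hFF', map_one]
  have SF'F : S F' * S F = 1 := by rw [← map_mul, hF'F, map_one]
  have e1 : S F * F * S F' = F' * S F * F :=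
    calc S F * F * S F' = F' * (F * S F * F) * S F' := by
          simp only [← mul_assoc, hF'F, one_mul]
      _ = _ := by rw [hbraid]; simp only [mul_assoc, SFF', mul_one]
  have e2 : F' * S F' * F' = S F' * F' * S F' :=
    calc F' * S F' * F' = F' * S F' * F' * (S F * F * S F) * (S F' * F' * S F') := by
          simp only [mul_assoc]
          rw [← mul_assoc (S F) (S F'), SFF', one_mul, ← mul_assoc F F', hFF', one_mul, SFF',
            mul_one]
      _ = F' * (S F' * ((F' * F) * S F)) * F * (S F' * F' * S F') := by
          rw [← hbraid]; simp only [mul_assoc]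
      _ = _ := by rw [hF'F, one_mul, SF'F, mul_one, hF'F, one_mul]
  have h1 : F * m * F' * (S F * F * m * F' * S F') = F * S F * (m * (F * m * F')) * S F' * F' :=
    calc F * m * F' * (S F * F * m * F' * S F')
        = F * m * (F' * S F * F) * m * F' * S F' := by simp only [mul_assoc]
      _ = F * m * S F * F * (m * S F') * F' * S F' := by
          rw [← e1, hmF']; simp only [mul_assoc]
      _ = F * m * S F * F * m * (F' * S F' * F') := by rw [e2]; simp only [mul_assoc]
      _ = F * (m * S F) * (F * m * F') * S F' * F' := by simp only [mul_assoc]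
      _ = _ := by rw [hmF]; simp only [mul_assoc]
  have h2 : F * m * F' * (S F * F * m * F' * S F') * S u = S u * g :=
    calc F * m * F' * (S F * F * m * F' * S F') * S u
        = F * S F * (m * (F * m * F')) * (S F' * F' * S u) := by
          rw [h1]; simp only [mul_assoc]
      _ = F * S F * (m * (F * m * F') * u) * z' := by rw [hz']; simp only [mul_assoc]
      _ = (F * S F * u) * (g * z') := by rw [hm]; simp only [mul_assoc]
      _ = S u * (z * z') * g := by rw [hz, hgz']; simp only [mul_assoc]
      _ = _ := by rw [hzz', mul_one]
  have h3 : v * S u * m * g = g * y * m * y' * (v * S u) :=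
    calc v * S u * m * g = v * m * (S u * g) := by
          rw [mul_assoc v, ← hmu]; simp only [mul_assoc]
      _ = v * (m * (F * m * F')) * (S F * F * m * F' * S F' * S u) := by
          rw [← h2]; simp only [mul_assoc]
      _ = g * (v * (S F * F)) * m * F' * S F' * S u := by rw [hm']; simp only [mul_assoc]
      _ = g * y * (m * S v) * F' * S F' * S u := by rw [hyv, hmv]; simp only [mul_assoc]
      _ = g * y * m * (S v * F' * S F') * S u := by simp only [mul_assoc]
      _ = _ := by rw [hy'v]; simp only [mul_assoc]
  have h4 : m * g = g * (S v * u * y) * m * (y' * (v * S u)) :=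
    calc m * g = S v * u * (v * S u) * m * g := by rw [hW', one_mul]
      _ = S v * u * (v * S u * m * g) := by simp only [mul_assoc]
      _ = (S v * u * g) * y * m * y' * (v * S u) := by rw [h3]; simp only [mul_assoc]
      _ = _ := by rw [← hgu]; simp only [mul_assoc]
  calc m * (g * (S v * u * y)) = m * g * (S v * u * y) := by simp only [mul_assoc]
    _ = g * (S v * u * y) * m * (y' * (v * S u * (S v * u)) * y) := by
        rw [h4]; simp only [mul_assoc]
    _ = _ := by rw [hW, mul_one, hy'y, mul_one]

end Twist

end QMA

noncomputable section

namespace QMA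

namespace Leavitt

variable {N : ℕ} {A B : Type*} [Ring A] [Algebra ℂ A] [Ring B] [Algebra ℂ B]
  (L : Leavitt N A B)

theorem S_smul (c : ℂ) (x : B) : L.S (c • x) = c • L.S x := by
  simp [S_apply, Finset.smul_sum]

/-- The elements commuting with the image of `A`. -/
def scal : Subalgebra ℂ B := Subalgebra.centralizer ℂ (Set.range L.ι)

theorem mem_scal {x : B} : x ∈ L.scal ↔ ∀ y, L.ι y * x = x * L.ι y := by
  simp [scal, Subalgebra.mem_centralizer_iff]

theorem e_mem_scal (a : Fin N) : L.e a ∈ L.scal := L.mem_scal.2 fun y => L.ι_mul_e y a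

theorem f_mem_scal (a : Fin N) : L.f a ∈ L.scal := L.mem_scal.2 fun y => L.ι_mul_f y a

theorem S_mem_scal {x : B} (hx : x ∈ L.scal) : L.S x ∈ L.scal := by
  rw [S_apply]
  exact Subalgebra.sum_mem _ fun a _ =>
    Subalgebra.mul_mem _ (Subalgebra.mul_mem _ (L.e_mem_scal a) hx) (L.f_mem_scal a)

theorem E_mem_scal {n : ℕ} (a : Fin n → Fin N) : L.E a ∈ L.scal :=
  L.mem_scal.2 fun y => L.ι_mul_E y a

theorem E'_mem_scal {n : ℕ} (a : Fin n → Fin N) : L.E' a ∈ L.scal :=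
  L.mem_scal.2 fun y => L.ι_mul_E' y a

theorem rho_cmap {n : ℕ} (X : MatV N n ℂ) :
    L.rho (cmap X) = ∑ a, ∑ b, X a b • (L.E a * L.E' b) := by
  simp [rho, cmap, Algebra.algebraMap_eq_smul_one]

theorem rho_cmap_mem_scal {n : ℕ} (X : MatV N n ℂ) : L.rho (cmap X) ∈ L.scal := by
  rw [rho_cmap]
  exact Subalgebra.sum_mem _ fun a _ => Subalgebra.sum_mem _ fun b _ =>
    Subalgebra.smul_mem _ (Subalgebra.mul_mem _ (L.E_mem_scal a) (L.E'_mem_scal b)) _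

/-- The vector `∑ u a b e_a ⊗ e_b`, creating two tensor factors on the left. -/
def ket (u : (Fin 2 → Fin N) → ℂ) : B := ∑ a, u a • L.E a

/-- The covector contracting the first two tensor factors with `v`. -/
def bra (v : (Fin 2 → Fin N) → ℂ) : B := ∑ a, v a • L.E' a

theorem ket_mem_scal (u : (Fin 2 → Fin N) → ℂ) : L.ket u ∈ L.scal :=
  Subalgebra.sum_mem _ fun a _ => Subalgebra.smul_mem _ (L.E_mem_scal a) _

theorem bra_mem_scal (v : (Fin 2 → Fin N) → ℂ) : L.bra v ∈ L.scal :=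
  Subalgebra.sum_mem _ fun a _ => Subalgebra.smul_mem _ (L.E'_mem_scal a) _

theorem E_two_mul (a : Fin 2 → Fin N) (x : B) : L.E a * x = L.S (L.S x) * L.E a := by
  rw [E_two, ← mul_assoc, S_mul_e, mul_assoc (L.e _) (L.S x), S_mul_e, mul_assoc]

theorem E'_two_mul (a : Fin 2 → Fin N) (x : B) : L.E' a * L.S (L.S x) = x * L.E' a := by
  rw [E'_two, mul_assoc, f_mul_S, ← mul_assoc, f_mul_S, mul_assoc]

theorem ket_mul (u : (Fin 2 → Fin N) → ℂ) (x : B) : L.ket u * x = L.S (L.S x) * L.ket u := by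
  simp only [ket, Finset.sum_mul, Finset.mul_sum, smul_mul_assoc, mul_smul_comm, E_two_mul]

theorem bra_mul (v : (Fin 2 → Fin N) → ℂ) (x : B) : L.bra v * L.S (L.S x) = x * L.bra v := by
  simp only [bra, Finset.sum_mul, Finset.mul_sum, smul_mul_assoc, mul_smul_comm, E'_two_mul]

theorem rho_cmap_mul (X : MatV N 2 ℂ) (x : B) :
    L.rho (cmap X) * L.S (L.S x) = L.S (L.S x) * L.rho (cmap X) := by
  simp only [rho_cmap, Finset.sum_mul, Finset.mul_sum, smul_mul_assoc, mul_smul_comm]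
  refine Finset.sum_congr rfl fun a _ => Finset.sum_congr rfl fun b _ => ?_
  rw [mul_assoc, E'_two_mul, ← mul_assoc, E_two_mul, mul_assoc]

theorem E'_mul_ket (u : (Fin 2 → Fin N) → ℂ) (a : Fin 2 → Fin N) :
    L.E' a * L.ket u = u a • 1 := by
  simp [ket, Finset.mul_sum, E'_mul_E]

theorem bra_mul_E (v : (Fin 2 → Fin N) → ℂ) (b : Fin 2 → Fin N) :
    L.bra v * L.E b = v b • 1 := by
  simp [bra, Finset.sum_mul, E'_mul_E]

theorem ket_mul_bra (u v : (Fin 2 → Fin N) → ℂ) :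
    L.ket u * L.bra v = L.rho (cmap (Matrix.vecMulVec u v)) := by
  simp [ket, bra, rho_cmap, Finset.sum_mul_sum, Matrix.vecMulVec_apply, smul_smul, mul_comm]

/-- The operator on the first tensor factor given by an `N × N` matrix. -/
def op (X : Matrix (Fin N) (Fin N) A) : B := ∑ a, ∑ b, L.e a * L.ι (X a b) * L.f b

theorem coeff_op (X : Matrix (Fin N) (Fin N) A) (a b : Fin N) :
    L.f a * L.op X * L.e b = L.ι (X a b) := by
  simp_rw [op, Finset.mul_sum, Finset.sum_mul]
  have h : ∀ c d : Fin N, L.f a * (L.e c * L.ι (X c d) * L.f d) * L.e b =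
      (L.f a * L.e c) * L.ι (X c d) * (L.f d * L.e b) := fun c d => by simp only [mul_assoc]
  simp_rw [h, f_mul_e]
  simp

theorem eq_of_coeff_one {x y : B} (h : ∀ a b, L.f a * x * L.e b = L.f a * y * L.e b) : x = y :=
  L.eq_of_coeff 1 fun a b => by simpa [E, E', List.ofFn_succ] using h (a 0) (b 0)

theorem coeff_one_mul (x y : B) (a b : Fin N) :
    L.f a * (x * y) * L.e b = ∑ c, (L.f a * x * L.e c) * (L.f c * y * L.e b) := by
  have h : ∀ c, (L.f a * x * L.e c) * (L.f c * y * L.e b) =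
      L.f a * x * (L.e c * L.f c) * (y * L.e b) := fun c => by simp only [mul_assoc]
  simp_rw [h, ← Finset.sum_mul, ← Finset.mul_sum, L.sum_e_mul_f, mul_one, mul_assoc]

theorem op_mul (X Y : Matrix (Fin N) (Fin N) A) : L.op (X * Y) = L.op X * L.op Y :=
  L.eq_of_coeff_one fun a b => by
    simp_rw [coeff_one_mul, coeff_op, Matrix.mul_apply, map_sum, map_mul]

theorem op_one : L.op (1 : Matrix (Fin N) (Fin N) A) = 1 :=
  L.eq_of_coeff_one fun a b => by
    rw [coeff_op, mul_one, f_mul_e, Matrix.one_apply]; split_ifs <;> simp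

theorem op_mul_S (X : Matrix (Fin N) (Fin N) A) {x : B} (hx : x ∈ L.scal) :
    L.op X * L.S x = L.S x * L.op X := by
  simp only [op, Finset.sum_mul, Finset.mul_sum, mul_assoc, f_mul_S]
  simp only [← mul_assoc, S_mul_e]
  refine Finset.sum_congr rfl fun a _ => Finset.sum_congr rfl fun b _ => ?_
  rw [mul_assoc (L.e a), L.mem_scal.1 hx, ← mul_assoc]

section Lifts

variable [NeZero N]

theorem rho_lift2_zero {n : ℕ} (X : MatV N 2 A) :
    L.rho (lift2 (n := n + 2) 0 X) = L.rho X := by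
  refine (L.eq_rho fun a b => ?_).symm
  have h := L.coeff_rho X ![a 0, a 1] ![b 0, b 1]
  rw [E_two, E'_two] at h
  simp only [Matrix.cons_val_zero, Matrix.cons_val_one] at h
  have h2 : L.E' a * L.rho X * L.E b =
      L.E' (Fin.tail (Fin.tail a)) * L.ι (X ![a 0, a 1] ![b 0, b 1]) *
        L.E (Fin.tail (Fin.tail b)) := by
    rw [← h, E_succ, E_succ, E'_succ, E'_succ]; simp only [mul_assoc]; rfl
  rw [h2, ← L.ι_mul_E', mul_assoc, E'_mul_E]
  have h3 : (∀ m : Fin (n + 2), (m : ℕ) = 0 ∨ (m : ℕ) = 0 + 1 ∨ a m = b m) ↔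
      Fin.tail (Fin.tail a) = Fin.tail (Fin.tail b) := by
    rw [funext_iff]
    simp [Fin.forall_fin_succ, Fin.tail]
  simp only [lift2, if_congr h3 rfl rfl]
  split_ifs <;> simp [idx]

theorem idx_tail {n : ℕ} (a : Fin (n + 1) → Fin N) (p : ℕ) :
    idx (Fin.tail a) p = idx a (p + 1) := by
  simp only [idx, Nat.add_lt_add_iff_right]
  rfl

theorem rho_lift2_succ {n : ℕ} (p : ℕ) (X : MatV N 2 A) :
    L.rho (lift2 (n := n + 1) (p + 1) X) = L.S (L.rho (lift2 (n := n) p X)) := by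
  refine (L.eq_rho fun a b => ?_).symm
  have h2 : L.E' a * L.S (L.rho (lift2 (n := n) p X)) * L.E b =
      L.E' (Fin.tail a) * (L.f (a 0) * L.S (L.rho (lift2 (n := n) p X)) * L.e (b 0)) *
        L.E (Fin.tail b) := by
    rw [E_succ, E'_succ]; simp only [mul_assoc]
  rw [h2, f_mul_S, mul_assoc (L.rho _), f_mul_e]
  have h3 : (∀ m : Fin (n + 1), (m : ℕ) = p + 1 ∨ (m : ℕ) = p + 1 + 1 ∨ a m = b m) ↔
      a 0 = b 0 ∧
        ∀ m : Fin n, (m : ℕ) = p ∨ (m : ℕ) = p + 1 ∨ Fin.tail a m = Fin.tail b m := by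
    rw [Fin.forall_fin_succ]
    simp [Fin.tail]
  simp only [lift2, if_congr h3 rfl rfl]
  by_cases h0 : a 0 = b 0
  · rw [if_pos h0, mul_one, coeff_rho]
    simp only [h0, true_and, lift2, idx_tail]
  · simp [h0]

theorem rho_lift1_zero {n : ℕ} (X : Matrix (Fin N) (Fin N) A) :
    L.rho (lift1 (n := n + 1) 0 X) = L.op X := by
  refine (L.eq_rho fun a b => ?_).symm
  have h2 : L.E' a * L.op X * L.E b =
      L.E' (Fin.tail a) * L.ι (X (a 0) (b 0)) * L.E (Fin.tail b) := by
    rw [← coeff_op, E_succ, E'_succ]; simp only [mul_assoc]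
  rw [h2, ← L.ι_mul_E', mul_assoc, E'_mul_E]
  have h3 : (∀ m : Fin (n + 1), (m : ℕ) = 0 ∨ a m = b m) ↔ Fin.tail a = Fin.tail b := by
    rw [funext_iff]
    simp [Fin.forall_fin_succ, Fin.tail]
  simp only [lift1, if_congr h3 rfl rfl]
  split_ifs <;> simp [idx]

end Lifts

end Leavitt

section Cmap

variable {N : ℕ} {A : Type*} [Ring A] [Algebra ℂ A] {m : Type*}

theorem cmap_mul [Fintype m] (X Y : Matrix m m ℂ) :
    (cmap (X * Y) : Matrix m m A) = cmap X * cmap Y := Matrix.map_mul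

theorem cmap_one [DecidableEq m] : (cmap (1 : Matrix m m ℂ) : Matrix m m A) = 1 :=
  Matrix.map_one _ (map_zero _) (map_one _)

theorem cmap_lift2 [NeZero N] {n : ℕ} (p : ℕ) (X : MatV N 2 ℂ) :
    (cmap (lift2 (n := n) p X) : MatV N n A) = lift2 p (cmap X) := by
  ext a b
  simp only [cmap, Matrix.map_apply, lift2]
  split_ifs <;> simp

end Cmap

end QMA

end

noncomputable section

namespace QMA

section Numeric

variable {N : ℕ} {q μ : ℂ} {R : MatV N 2 ℂ}

theorem bmwK_mul_self
    (h : (q • (1 : MatV N 2 ℂ) - R) * (q⁻¹ • (1 : MatV N 2 ℂ) + R) *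
      (μ • (1 : MatV N 2 ℂ) - R) = 0) : bmwK q μ R * R = μ • bmwK q μ R := by
  rw [mul_sub, sub_eq_zero, mul_smul_comm, mul_one] at h
  rw [bmwK, smul_mul_assoc, ← h, smul_comm]

theorem self_mul_bmwK (q μ : ℂ) (R : MatV N 2 ℂ) : R * bmwK q μ R = bmwK q μ R * R := by
  have h : Commute R ((q • (1 : MatV N 2 ℂ) - R) * (q⁻¹ • (1 : MatV N 2 ℂ) + R)) :=
    (((Commute.one_right R).smul_right q).sub_right (Commute.refl R)).mul_right
      (((Commute.one_right R).smul_right q⁻¹).add_right (Commute.refl R))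
  exact h.smul_right _

end Numeric

namespace Leavitt

variable {N : ℕ} {A B : Type*} [Ring A] [Algebra ℂ A] [Ring B] [Algebra ℂ B]
  (L : Leavitt N A B)

/-- The algebra homomorphism sending a complex operator on `n` tensor factors to `B`. -/
def rhoC (n : ℕ) : MatV N n ℂ →ₐ[ℂ] B where
  toRingHom := (L.rhoHom n).comp (algebraMap ℂ A).mapMatrix
  commutes' c := by
    change L.rho (cmap (algebraMap ℂ (MatV N n ℂ) c)) = _
    rw [rho_cmap, Algebra.algebraMap_eq_smul_one, Algebra.algebraMap_eq_smul_one,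
      ← L.sum_E_mul_E' n, Finset.smul_sum]
    simp [Matrix.one_apply]

theorem rhoC_apply {n : ℕ} (X : MatV N n ℂ) : L.rhoC n X = L.rho (cmap X) := rfl

theorem rhoC_mul_inv {n : ℕ} {F : MatV N n ℂ} (h : IsUnit F.det) :
    L.rhoC n F * L.rhoC n F⁻¹ = 1 := by
  rw [← map_mul, Matrix.mul_nonsing_inv _ h, map_one]

theorem rhoC_inv_mul {n : ℕ} {F : MatV N n ℂ} (h : IsUnit F.det) :
    L.rhoC n F⁻¹ * L.rhoC n F = 1 := by
  rw [← map_mul, Matrix.nonsing_inv_mul _ h, map_one]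

theorem E'_mul_rhoC_mul_E {n : ℕ} (X : MatV N n ℂ) (a b : Fin n → Fin N) :
    L.E' a * L.rhoC n X * L.E b = X a b • 1 := by
  rw [rhoC_apply, coeff_rho, cmap, Matrix.map_apply, AlgHom.commutes,
    Algebra.algebraMap_eq_smul_one]

theorem E'_mul_rhoC_mul_e (X : MatV N 2 ℂ) (a : Fin 2 → Fin N) (y : Fin N) :
    L.E' a * L.rhoC 2 X * L.e y = ∑ z, X a ![y, z] • L.f z :=
  calc L.E' a * L.rhoC 2 X * L.e y
      = ∑ z, (L.E' a * L.rhoC 2 X * L.E ![y, z]) * L.f z := by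
        simp only [E_two, Matrix.cons_val_zero, Matrix.cons_val_one]
        rw [← mul_one (L.E' a * L.rhoC 2 X * L.e y), ← L.sum_e_mul_f, Finset.mul_sum]
        simp only [mul_assoc]
    _ = _ := by simp only [E'_mul_rhoC_mul_E, smul_mul_assoc, one_mul]

theorem f_mul_rhoC_mul_E (X : MatV N 2 ℂ) (x : Fin N) (b : Fin 2 → Fin N) :
    L.f x * L.rhoC 2 X * L.E b = ∑ z, X ![x, z] b • L.e z :=
  calc L.f x * L.rhoC 2 X * L.E b
      = ∑ z, L.e z * (L.E' ![x, z] * L.rhoC 2 X * L.E b) := by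
        simp only [E'_two, Matrix.cons_val_zero, Matrix.cons_val_one]
        rw [← one_mul (L.f x * L.rhoC 2 X * L.E b), ← L.sum_e_mul_f, Finset.sum_mul]
        simp only [mul_assoc]
    _ = _ := by simp only [E'_mul_rhoC_mul_E, mul_smul_comm, mul_one]

theorem f_mul_rhoC_mul_e (X : MatV N 2 ℂ) (a b : Fin N) :
    L.f a * L.rhoC 2 X * L.e b = ∑ m, ∑ c, X ![a, m] ![b, c] • (L.e m * L.f c) := by
  refine L.eq_of_coeff_one fun m c => ?_
  have h := L.coeff_rho (cmap X) ![a, m] ![b, c]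
  rw [E_two, E'_two] at h
  simp only [Matrix.cons_val_zero, Matrix.cons_val_one] at h
  have h1 : L.f m * (L.f a * L.rhoC 2 X * L.e b) * L.e c = L.ι (cmap X ![a, m] ![b, c]) := by
    rw [← h, rhoC_apply]; simp only [mul_assoc]
  have h2 : ∀ m' c', L.f m * (L.e m' * L.f c') * L.e c =
      (L.f m * L.e m') * (L.f c' * L.e c) := fun _ _ => by simp only [mul_assoc]
  rw [h1]
  simp [Finset.mul_sum, Finset.sum_mul, h2, f_mul_e, cmap, Algebra.algebraMap_eq_smul_one]

theorem rhoC_bmwK (q μ : ℂ) (R : MatV N 2 ℂ) : L.rhoC 2 (bmwK q μ R) =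
    (μ⁻¹ * (q - q⁻¹)⁻¹) • ((q • 1 - L.rhoC 2 R) * (q⁻¹ • 1 + L.rhoC 2 R)) := by
  simp only [bmwK, map_smul, map_mul, map_sub, map_add, map_one]

theorem S_rhoC_bmwK (q μ : ℂ) (R : MatV N 2 ℂ) : L.S (L.rhoC 2 (bmwK q μ R)) =
    (μ⁻¹ * (q - q⁻¹)⁻¹) • ((q • 1 - L.S (L.rhoC 2 R)) * (q⁻¹ • 1 + L.S (L.rhoC 2 R))) := by
  simp only [rhoC_bmwK, S_smul, map_mul, map_sub, map_add, map_one]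

theorem intertwine_quadratic {x y t : B} (h : x * t = t * y) (c q q' : ℂ) :
    c • ((q • 1 - x) * (q' • 1 + x)) * t = t * c • ((q • 1 - y) * (q' • 1 + y)) := by
  rw [smul_mul_assoc, mul_smul_comm, mul_assoc]
  have h1 : (q' • 1 + x) * t = t * (q' • 1 + y) := by simp [add_mul, mul_add, h]
  have h2 : (q • 1 - x) * t = t * (q • 1 - y) := by simp [sub_mul, mul_sub, h]
  rw [h1, ← mul_assoc, h2, mul_assoc]

variable [NeZero N]

theorem rhoC_lift2_zero {n : ℕ} (X : MatV N 2 ℂ) :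
    L.rhoC (n + 2) (lift2 0 X) = L.rhoC 2 X := by
  rw [rhoC_apply, cmap_lift2, rho_lift2_zero, rhoC_apply]

theorem rhoC_lift2_succ {n : ℕ} (p : ℕ) (X : MatV N 2 ℂ) :
    L.rhoC (n + 1) (lift2 (p + 1) X) = L.S (L.rhoC n (lift2 p X)) := by
  rw [rhoC_apply, cmap_lift2, rho_lift2_succ, ← cmap_lift2, rhoC_apply]

theorem rhoC_lift2_one {n : ℕ} (X : MatV N 2 ℂ) :
    L.rhoC (n + 3) (lift2 1 X) = L.S (L.rhoC 2 X) := by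
  rw [rhoC_lift2_succ, rhoC_lift2_zero]

theorem rhoC_braid {F : MatV N 2 ℂ} (h : IsBraid F) :
    L.rhoC 2 F * L.S (L.rhoC 2 F) * L.rhoC 2 F =
      L.S (L.rhoC 2 F) * L.rhoC 2 F * L.S (L.rhoC 2 F) := by
  simpa only [map_mul, rhoC_lift2_zero, rhoC_lift2_one] using congrArg (L.rhoC 3) h

theorem rhoC_compatible_left {R F : MatV N 2 ℂ} (h : Compatible R F) :
    L.rhoC 2 R * (L.S (L.rhoC 2 F) * L.rhoC 2 F) =
      L.S (L.rhoC 2 F) * L.rhoC 2 F * L.S (L.rhoC 2 R) := by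
  simpa only [map_mul, rhoC_lift2_zero, rhoC_lift2_one, mul_assoc] using congrArg (L.rhoC 3) h.1

theorem rhoC_compatible_right {R F : MatV N 2 ℂ} (h : Compatible R F) :
    L.S (L.rhoC 2 R) * (L.rhoC 2 F * L.S (L.rhoC 2 F)) =
      L.rhoC 2 F * L.S (L.rhoC 2 F) * L.rhoC 2 R := by
  simpa only [map_mul, rhoC_lift2_zero, rhoC_lift2_one, mul_assoc] using congrArg (L.rhoC 3) h.2

variable {q μ : ℂ} {R : MatV N 2 ℂ}

theorem bmwK_mul_lower (h : IsBMW q μ R) :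
    L.rhoC 2 (bmwK q μ R) * L.rhoC 2 R = μ • L.rhoC 2 (bmwK q μ R) := by
  rw [← map_mul, bmwK_mul_self h.1, map_smul]

theorem lower_mul_bmwK (h : IsBMW q μ R) :
    L.rhoC 2 R * L.rhoC 2 (bmwK q μ R) = μ • L.rhoC 2 (bmwK q μ R) := by
  rw [← map_mul, self_mul_bmwK, bmwK_mul_self h.1, map_smul]

theorem bmwK_shift (hR : IsBraid R) (q μ : ℂ) :
    L.S (L.rhoC 2 (bmwK q μ R)) * (L.rhoC 2 R * L.S (L.rhoC 2 R)) =
      L.rhoC 2 R * L.S (L.rhoC 2 R) * L.rhoC 2 (bmwK q μ R) := by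
  rw [S_rhoC_bmwK, rhoC_bmwK]
  exact intertwine_quadratic (by rw [← mul_assoc, ← L.rhoC_braid hR]) _ _ _

theorem bmwK_upper_mul_lower (h : IsBMW q μ R) :
    L.S (L.rhoC 2 (bmwK q μ R)) * L.rhoC 2 (bmwK q μ R) =
      L.S (L.rhoC 2 (bmwK q μ R)) * L.rhoC 2 R * L.S (L.rhoC 2 R) := by
  simpa only [map_mul, rhoC_lift2_zero, rhoC_lift2_one] using congrArg (L.rhoC 3) h.2.1

theorem bmwK_lower_sandwich (h : IsBMW q μ R) :
    L.rhoC 2 (bmwK q μ R) * L.S (L.rhoC 2 (bmwK q μ R)) * L.rhoC 2 (bmwK q μ R) =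
      L.rhoC 2 (bmwK q μ R) := by
  simpa only [map_mul, rhoC_lift2_zero, rhoC_lift2_one] using congrArg (L.rhoC 3) h.2.2.2

theorem bmwK_upper_sandwich (hμ : μ ≠ 0) (hR : IsBraid R) (hdet : IsUnit R.det)
    (h : IsBMW q μ R) :
    L.S (L.rhoC 2 (bmwK q μ R)) * L.rhoC 2 (bmwK q μ R) * L.S (L.rhoC 2 (bmwK q μ R)) =
      L.S (L.rhoC 2 (bmwK q μ R)) :=
  bmw_upper hμ (L.rhoC_mul_inv hdet) (L.rhoC_inv_mul hdet)
    (by rw [← map_mul, L.rhoC_mul_inv hdet, map_one]) (L.rhoC_braid hR) (L.bmwK_mul_lower h)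
    (L.lower_mul_bmwK h) (by rw [← map_mul, L.lower_mul_bmwK h, S_smul])
    (L.bmwK_upper_mul_lower h) (by rw [mul_assoc, L.bmwK_shift hR]) (L.bmwK_lower_sandwich h)

theorem bmwK_upper_mul_mul_upper (hμ : μ ≠ 0) (hR : IsBraid R) (hdet : IsUnit R.det)
    (h : IsBMW q μ R) :
    L.S (L.rhoC 2 (bmwK q μ R)) * L.rhoC 2 R * L.S (L.rhoC 2 (bmwK q μ R)) =
      μ⁻¹ • L.S (L.rhoC 2 (bmwK q μ R)) :=
  bmw_sandwich hμ (L.rhoC_mul_inv hdet) (L.rhoC_inv_mul hdet)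
    (by rw [← map_mul, L.rhoC_mul_inv hdet, map_one]) (L.rhoC_braid hR) (L.bmwK_mul_lower h)
    (L.lower_mul_bmwK h)
    (L.bmwK_upper_mul_lower h) (by rw [mul_assoc, L.bmwK_shift hR]) (L.bmwK_lower_sandwich h)

theorem bmwK_mul_e_f_mul {Ψ : MatV N 2 ℂ} (hΨ : SkewPair R Ψ) (hμ : μ ≠ 0) (hR : IsBraid R)
    (hdet : IsUnit R.det) (h : IsBMW q μ R) (a b : Fin N) :
    L.rhoC 2 (bmwK q μ R) * (L.e b * L.f a) * L.rhoC 2 (bmwK q μ R) =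
      (μ⁻¹ * Dof Ψ a b) • L.rhoC 2 (bmwK q μ R) := by
  have h1 : ∀ c m, L.rhoC 2 (bmwK q μ R) * (L.f c * L.rhoC 2 R * L.e m) *
      L.rhoC 2 (bmwK q μ R) = if c = m then μ⁻¹ • L.rhoC 2 (bmwK q μ R) else 0 := fun c m => by
    have := congrArg (fun x => L.f c * x * L.e m) (L.bmwK_upper_mul_mul_upper hμ hR hdet h)
    simp only [mul_smul_comm, smul_mul_assoc, ← mul_assoc, f_mul_S] at this
    simp only [mul_assoc, S_mul_e, f_mul_e] at this ⊢
    rw [this]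
    split_ifs <;> simp
  have h2 : L.e b * L.f a =
      ∑ m, ∑ c, Ψ ![a, m] ![b, c] • (L.f c * L.rhoC 2 R * L.e m) := by
    simp only [f_mul_rhoC_mul_e, Finset.smul_sum, smul_smul]
    have h3 : ∀ x y, ∑ m, ∑ c, (Ψ ![a, m] ![b, c] * R ![c, x] ![m, y]) • (L.e x * L.f y) =
        if a = y ∧ x = b then L.e x * L.f y else 0 := fun x y => by
      simp only [← Finset.sum_smul, hΨ.2 a x b y]
      split_ifs <;> simp
    calc L.e b * L.f a = ∑ x, ∑ y, if a = y ∧ x = b then L.e x * L.f y else 0 := by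
          simp [ite_and]
      _ = ∑ x, ∑ y, ∑ m, ∑ c, (Ψ ![a, m] ![b, c] * R ![c, x] ![m, y]) • (L.e x * L.f y) := by
          simp only [h3]
      _ = ∑ x, ∑ m, ∑ c, ∑ y, (Ψ ![a, m] ![b, c] * R ![c, x] ![m, y]) • (L.e x * L.f y) := by
          refine Finset.sum_congr rfl fun x _ => ?_
          rw [Finset.sum_comm]
          exact Finset.sum_congr rfl fun m _ => Finset.sum_comm
      _ = _ := by
          rw [Finset.sum_comm]
          exact Finset.sum_congr rfl fun m _ => Finset.sum_comm
  rw [h2]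
  simp only [Finset.mul_sum, Finset.sum_mul, mul_smul_comm, smul_mul_assoc, h1, Dof]
  simp [Finset.sum_smul, smul_smul, mul_comm]

end Leavitt

section RankOne

variable {N : ℕ} [NeZero N] {q μ : ℂ} {R Ψ : MatV N 2 ℂ}

theorem bmwK_contract (hΨ : SkewPair R Ψ) (hμ : μ ≠ 0) (hR : IsBraid R)
    (hdet : IsUnit R.det) (h : IsBMW q μ R) (a b : Fin 2 → Fin N) (x y : Fin N) :
    ∑ z, bmwK q μ R a ![y, z] * bmwK q μ R ![x, z] b =
      μ⁻¹ * Dof Ψ x y * bmwK q μ R a b := by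
  have := congrArg (fun t => (Leavitt.model N ℂ).E' a * t * (Leavitt.model N ℂ).E b)
    ((Leavitt.model N ℂ).bmwK_mul_e_f_mul hΨ hμ hR hdet h x y)
  generalize Leavitt.model N ℂ = L at this
  have h1 : L.E' a * (L.rhoC 2 (bmwK q μ R) * (L.e y * L.f x) * L.rhoC 2 (bmwK q μ R)) * L.E b =
      (L.E' a * L.rhoC 2 (bmwK q μ R) * L.e y) * (L.f x * L.rhoC 2 (bmwK q μ R) * L.E b) := by
    simp only [mul_assoc]
  simp only [h1, mul_smul_comm, smul_mul_assoc, L.E'_mul_rhoC_mul_E, L.E'_mul_rhoC_mul_e,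
    L.f_mul_rhoC_mul_E, Finset.sum_mul, Finset.mul_sum, L.f_mul_e, smul_smul] at this
  have h2 : (1 : Module.End ℂ ((ℕ → Fin N) → ℂ)) ≠ 0 := one_ne_zero
  refine smul_left_injective ℂ h2 ?_
  simp only [Finset.sum_smul]
  simpa [smul_smul, mul_comm] using this

/-- The operator `K` of a strict skew invertible R-matrix of BMW type has rank at most one. -/
theorem bmwK_rank_one (hΨ : SkewPair R Ψ) (hD : IsUnit (Dof Ψ).det) (hμ : μ ≠ 0)
    (hR : IsBraid R) (hdet : IsUnit R.det) (h : IsBMW q μ R) {a₀ b₀ : Fin 2 → Fin N}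
    (h₀ : bmwK q μ R a₀ b₀ ≠ 0) (a b : Fin 2 → Fin N) :
    bmwK q μ R a₀ b₀ * bmwK q μ R a b = bmwK q μ R a b₀ * bmwK q μ R a₀ b := by
  set K := bmwK q μ R with hK
  let T : (Fin 2 → Fin N) → Matrix (Fin N) (Fin N) ℂ := fun a y z => K a ![y, z]
  let Q : Matrix (Fin N) (Fin N) ℂ := fun z x => K ![x, z] b₀
  have hT : ∀ a, T a * Q = (μ⁻¹ * K a b₀) • (Dof Ψ)ᵀ := fun a => by
    ext y x
    rw [Matrix.mul_apply, Matrix.smul_apply, Matrix.transpose_apply, smul_eq_mul, mul_right_comm]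
    exact bmwK_contract hΨ hμ hR hdet h a b₀ x y
  have hQ : IsUnit Q.det := by
    have h1 : IsUnit ((T a₀ * Q).det) := by
      rw [hT, Matrix.det_smul, Matrix.det_transpose]
      exact ((IsUnit.mk0 _ (mul_ne_zero (inv_ne_zero hμ) h₀)).pow _).mul hD
    rw [Matrix.det_mul] at h1
    exact isUnit_of_mul_isUnit_right h1
  have h2 : K a₀ b₀ • T a = K a b₀ • T a₀ := by
    have h3 : (K a₀ b₀ • T a) * Q = (K a b₀ • T a₀) * Q := by
      rw [smul_mul_assoc, smul_mul_assoc, hT, hT, smul_smul, smul_smul]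
      congr 1; ring
    rw [← Matrix.mul_nonsing_inv_cancel_right Q (K a₀ b₀ • T a) hQ, h3,
      Matrix.mul_nonsing_inv_cancel_right Q _ hQ]
  have h4 := congrFun (congrFun h2 (b 0)) (b 1)
  have h5 : ![b 0, b 1] = b := by ext i; fin_cases i <;> rfl
  change K a₀ b₀ * K a ![b 0, b 1] = K a b₀ * K a₀ ![b 0, b 1] at h4
  rwa [h5] at h4

end RankOne

end QMA

end

noncomputable section

namespace QMA

namespace Leavitt

variable {N : ℕ} {A B : Type*} [Ring A] [Algebra ℂ A] [Ring B] [Algebra ℂ B]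
  (L : Leavitt N A B)

theorem ket_eq_sum_sum (u : (Fin 2 → Fin N) → ℂ) :
    L.ket u = ∑ c, ∑ d, u ![c, d] • (L.e c * L.e d) := by
  rw [ket, ← (finTwoArrowEquiv (Fin N)).symm.sum_comp, Fintype.sum_prod_type]
  simp [E_two]

theorem E_snoc {n : ℕ} (a : Fin n → Fin N) (c : Fin N) :
    L.E (Fin.snoc a c : Fin (n + 1) → Fin N) = L.E a * L.e c := by
  rw [E, E, List.ofFn_succ_last]
  simp only [Fin.snoc_castSucc, Fin.snoc_last, List.prod_append, List.prod_singleton]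

theorem E'_snoc {n : ℕ} (a : Fin n → Fin N) (c : Fin N) :
    L.E' (Fin.snoc a c : Fin (n + 1) → Fin N) = L.f c * L.E' a := by
  rw [E', E', List.ofFn_succ_last]
  simp only [Fin.snoc_castSucc, Fin.snoc_last, List.reverse_append, List.reverse_singleton,
    List.prod_append, List.prod_singleton]

theorem rho_lmulE {n : ℕ} (γ : A) (X : MatV N n A) : L.rho (lmulE γ X) = L.ι γ * L.rho X := by
  refine (L.eq_rho fun a b => ?_).symm
  rw [← mul_assoc, ← L.ι_mul_E', mul_assoc (L.ι γ), mul_assoc (L.ι γ), coeff_rho, ← map_mul, lmulE]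

variable [NeZero N]

/-- The matrix `G` is the twist of the zigzag of the vector `u` and the covector `v`. -/
theorem op_Gmat {q μ : ℂ} {R F : MatV N 2 ℂ} {u v : (Fin 2 → Fin N) → ℂ} {y' : B}
    (h : L.S (L.rhoC 2 (bmwK q μ R)) * L.rhoC 2 F⁻¹ * L.S (L.rhoC 2 F⁻¹) =
      L.S (L.ket u) * (y' * L.bra v)) :
    L.op (cmap (Gmat q μ R F)) = y' * (L.bra v * L.S (L.ket u)) := by
  refine L.eq_of_coeff_one fun a b => ?_
  set X : MatV N 3 ℂ := lift2 1 (bmwK q μ R) * lift2 0 F⁻¹ * lift2 1 F⁻¹ with hX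
  have hG : Gmat q μ R F a b = ∑ c, ∑ d, X (Fin.snoc (Fin.snoc (fun _ => a) c) d)
      (Fin.snoc (Fin.snoc (fun _ => b) c) d) := by
    simp [Gmat, toN, trTail, ptrace, Matrix.one_apply, hX]
  have hρ : L.rhoC 3 X = L.S (L.ket u) * (y' * L.bra v) := by
    rw [hX, map_mul, map_mul, rhoC_lift2_one, rhoC_lift2_one, rhoC_lift2_zero, h]
  have hE : ∀ a : Fin N, L.E (fun _ : Fin 1 => a) = L.e a := fun a => by simp [E]
  have hE' : ∀ a : Fin N, L.E' (fun _ : Fin 1 => a) = L.f a := fun a => by simp [E']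
  have hc : ∀ c d, X (Fin.snoc (Fin.snoc (fun _ => a) c) d)
      (Fin.snoc (Fin.snoc (fun _ => b) c) d) • (1 : B) =
        (u ![c, d] * v ![b, c]) • (L.f a * y' * L.e d) := fun c d => by
    rw [← L.E'_mul_rhoC_mul_E, hρ, E'_snoc, E'_snoc, E_snoc, E_snoc, hE, hE']
    have h1 := L.E'_mul_ket u ![c, d]
    have h2 := L.bra_mul_E v ![b, c]
    rw [E'_two] at h1
    rw [E_two] at h2
    simp only [Matrix.cons_val_zero, Matrix.cons_val_one] at h1 h2
    calc L.f d * (L.f c * L.f a) * (L.S (L.ket u) * (y' * L.bra v)) * (L.e b * L.e c * L.e d)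
        = L.f d * L.f c * (L.f a * L.S (L.ket u)) * y' * (L.bra v * (L.e b * L.e c)) * L.e d := by
          simp only [mul_assoc]
      _ = (L.f d * L.f c * L.ket u) * (L.f a * y') * (L.bra v * (L.e b * L.e c)) * L.e d := by
          rw [f_mul_S]; simp only [mul_assoc]
      _ = _ := by
          rw [h1, h2]
          simp [smul_smul, mul_comm]
  have hv : ∀ c d, L.bra v * (L.e b * (L.e c * L.e d)) = v ![b, c] • L.e d := fun c d => by
    have h2 := L.bra_mul_E v ![b, c]
    rw [E_two] at h2
    simp only [Matrix.cons_val_zero, Matrix.cons_val_one] at h2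
    rw [← mul_assoc (L.e b), ← mul_assoc, h2, smul_mul_assoc, one_mul]
  rw [coeff_op, cmap, Matrix.map_apply, AlgHom.commutes, Algebra.algebraMap_eq_smul_one, hG]
  simp only [Finset.sum_smul, hc]
  rw [mul_assoc, mul_assoc, mul_assoc, S_mul_e, ket_eq_sum_sum]
  simp only [Finset.mul_sum, mul_smul_comm, hv, smul_smul, mul_assoc]

theorem rho_Mcopy_zero_mul_Mcopy_one (F : MatV N 2 ℂ) (M : Matrix (Fin N) (Fin N) A) :
    L.rho (Mcopy (n := 2) F M 0 * Mcopy F M 1) =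
      L.op M * (L.rhoC 2 F * L.op M * L.rhoC 2 F⁻¹) := by
  have h : ∀ X : MatV N 2 ℂ, L.rho (cmap (lift2 (n := 2) 0 X)) = L.rhoC 2 X :=
    fun X => L.rhoC_lift2_zero (n := 0) X
  simp only [Mcopy, rho_mul, rho_lift1_zero, h]

/-- The matrix `G⁻¹` and the contraction of two copies of the quantum matrix with `K`. -/
theorem exists_contraction {q μ : ℂ} {R F : MatV N 2 ℂ} {u v : (Fin 2 → Fin N) → ℂ}
    {a₀ b₀ : Fin 2 → Fin N} (hu : u a₀ ≠ 0) (hv : v b₀ = 1)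
    (hK : bmwK q μ R = Matrix.vecMulVec u v) (hμ : μ ≠ 0)
    (hRbraid : IsBraid R) (hRdet : IsUnit R.det) (hFbraid : IsBraid F) (hFdet : IsUnit F.det)
    (hcomp : Compatible R F) (hbmw : IsBMW q μ R) (hGdet : IsUnit (Gmat q μ R F).det)
    {M : Matrix (Fin N) (Fin N) A} (hM : QMArel R F M) :
    ∃ γ : A,
      L.rho (Mcopy (n := 2) F M 0 * Mcopy F M 1) * L.rhoC 2 (bmwK q μ R) =
        L.ι γ * L.rhoC 2 (bmwK q μ R) ∧
      Commute (L.op M) (L.ι γ * L.op (cmap (Gmat q μ R F)⁻¹)) ∧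
      Commute (L.rhoC 2 F)
        (L.op (cmap (Gmat q μ R F)⁻¹) * L.S (L.op (cmap (Gmat q μ R F)⁻¹))) ∧
      Commute (L.rhoC 2 R)
        (L.op (cmap (Gmat q μ R F)⁻¹) * L.S (L.op (cmap (Gmat q μ R F)⁻¹))) := by
  have hk : L.rhoC 2 (bmwK q μ R) = L.ket u * L.bra v := by
    rw [hK, rhoC_apply, ket_mul_bra]
  have hvω : L.bra v * L.E b₀ = 1 := by rw [bra_mul_E, hv, one_smul]
  have hζu : (u a₀)⁻¹ • L.E' a₀ * L.ket u = 1 := by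
    rw [smul_mul_assoc, E'_mul_ket, smul_smul, inv_mul_cancel₀ hu, one_smul]
  have hFF' := L.rhoC_mul_inv hFdet
  have hF'F := L.rhoC_inv_mul hFdet
  have h1 := L.bmwK_lower_sandwich hbmw
  have h2 := L.bmwK_upper_sandwich hμ hRbraid hRdet hbmw
  have hshift := L.bmwK_shift hRbraid q μ
  have hrF := L.rhoC_compatible_right hcomp
  have hFr := L.rhoC_compatible_left hcomp
  have hkF : L.S (L.rhoC 2 (bmwK q μ R)) * (L.rhoC 2 F * L.S (L.rhoC 2 F)) =
      L.rhoC 2 F * L.S (L.rhoC 2 F) * L.rhoC 2 (bmwK q μ R) := by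
    rw [S_rhoC_bmwK, rhoC_bmwK]
    exact intertwine_quadratic hrF _ _ _
  have hFk : L.rhoC 2 (bmwK q μ R) * (L.S (L.rhoC 2 F) * L.rhoC 2 F) =
      L.S (L.rhoC 2 F) * L.rhoC 2 F * L.S (L.rhoC 2 (bmwK q μ R)) := by
    rw [S_rhoC_bmwK, rhoC_bmwK]
    exact intertwine_quadratic hFr _ _ _
  have hrk := L.bmwK_upper_mul_lower hbmw
  rw [mul_assoc, hshift] at hrk
  have hMM : L.rhoC 2 (bmwK q μ R) * (L.op M * (L.rhoC 2 F * L.op M * L.rhoC 2 F⁻¹)) =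
      L.op M * (L.rhoC 2 F * L.op M * L.rhoC 2 F⁻¹) * L.rhoC 2 (bmwK q μ R) := by
    rw [rhoC_bmwK]
    refine intertwine_quadratic ?_ _ _ _
    have h := congrArg L.rho hM
    rwa [mul_assoc, rho_mul, rho_mul _ (Mcopy F M 0 * Mcopy F M 1),
      rho_Mcopy_zero_mul_Mcopy_one, ← rhoC_apply, L.rhoC_lift2_zero (n := 0)] at h
  obtain ⟨γ, hγ⟩ : ∃ γ : A,
      L.bra v * (L.op M * (L.rhoC 2 F * L.op M * L.rhoC 2 F⁻¹)) * L.E b₀ = L.ι γ := by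
    refine ⟨∑ a, v a • (Mcopy F M 0 * Mcopy F M 1 : MatV N 2 A) a b₀, ?_⟩
    rw [← rho_Mcopy_zero_mul_Mcopy_one]
    simp only [bra, Finset.sum_mul, smul_mul_assoc, coeff_rho, map_sum, map_smul]
  refine ⟨γ, ?_⟩
  rw [rho_Mcopy_zero_mul_Mcopy_one, ← hγ]
  have hs : ∀ x ∈ L.scal, L.bra v * (L.op M * (L.rhoC 2 F * L.op M * L.rhoC 2 F⁻¹)) * L.E b₀ * x =
      x * (L.bra v * (L.op M * (L.rhoC 2 F * L.op M * L.rhoC 2 F⁻¹)) * L.E b₀) := fun x hx => by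
    rw [hγ]; exact L.mem_scal.1 hx _
  have hFs : L.rhoC 2 F ∈ L.scal := L.rho_cmap_mem_scal F
  have hFs' : L.rhoC 2 F⁻¹ ∈ L.scal := L.rho_cmap_mem_scal F⁻¹
  have hus := L.ket_mem_scal u
  have hvs := L.bra_mem_scal v
  have hMk : L.op M * (L.rhoC 2 F * L.op M * L.rhoC 2 F⁻¹) * L.ket u = L.ket u *
      (L.bra v * (L.op M * (L.rhoC 2 F * L.op M * L.rhoC 2 F⁻¹)) * L.E b₀) := by
    calc _ = L.op M * (L.rhoC 2 F * L.op M * L.rhoC 2 F⁻¹) * (L.ket u * L.bra v) * L.E b₀ := by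
          simp only [mul_assoc, hvω, mul_one]
      _ = _ := by rw [← hk, ← hMM, hk]; simp only [mul_assoc]
  rw [hk] at h1 h2 hkF hFk hrk hMM
  obtain ⟨y, y', z, z', -, hz'd, hz, hzz', hz', hyy', hy'y, hy'v, hyv, -, hFh, hRh⟩ :=
    exists_twist (S := L.S) (F := L.rhoC 2 F) (F' := L.rhoC 2 F⁻¹) (r := L.rhoC 2 R)
      (L.ket_mul u) (L.bra_mul v) (L.E_two_mul b₀)
      (L.rho_cmap_mul F) (L.rho_cmap_mul F⁻¹) (L.rho_cmap_mul R) hvω hζu hFF' hF'F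
      (L.rhoC_braid hFbraid) (L.rhoC_braid hRbraid) (by rw [mul_assoc, hrF])
      (by rw [mul_assoc, hkF]) (by rw [mul_assoc, hFk]) hrk
  have hW := zigzag_inv (S := L.S) hvω hζu h1
  have hW' := zigzag_inv' (S := L.S) hvω hζu h2
  have hh : L.op (cmap (Gmat q μ R F)⁻¹) = L.S (L.bra v) * L.ket u * y := by
    have hG := L.op_Gmat (q := q) (μ := μ) (R := R) (F := F) (u := u) (v := v) (y' := y') (by
      rw [hk, map_mul, ← hy'v]; simp only [mul_assoc])
    have hGG : L.op (cmap (Gmat q μ R F)) * L.op (cmap (Gmat q μ R F)⁻¹) = 1 := by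
      rw [← op_mul, ← cmap_mul, Matrix.mul_nonsing_inv _ hGdet, cmap_one, op_one]
    have hyG : L.S (L.bra v) * L.ket u * y * L.op (cmap (Gmat q μ R F)) = 1 := by
      rw [hG, mul_assoc, ← mul_assoc y, hyy', one_mul, hW']
    rw [← one_mul (L.op (cmap (Gmat q μ R F)⁻¹)), ← hyG, mul_assoc, hGG, mul_one]
  rw [hh]
  refine ⟨?_, ?_, hFh, hRh⟩
  · rw [hk, ← mul_assoc, hMk, ← hs _ hus, mul_assoc]
  · refine contraction_comm (z := z) (z' := z') hFF' hF'F (L.rhoC_braid hFbraid)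
      (L.op_mul_S M hFs) (L.op_mul_S M hus) (L.op_mul_S M hvs) ?_ ?_ hMk ?_ (L.op_mul_S M hFs')
      hz hzz' hz' hy'y hy'v hyv hW hW'
    · exact hs _ (Subalgebra.mul_mem _ (L.S_mem_scal hvs) hus)
    · refine hs _ ?_
      rw [hz'd]
      exact Subalgebra.mul_mem _ (Subalgebra.mul_mem _ hvs
        (Subalgebra.mul_mem _ (L.S_mem_scal hFs') hFs')) (L.S_mem_scal (L.E_mem_scal b₀))
    · calc _ = (u a₀)⁻¹ • L.E' a₀ * L.ket u * (L.bra v *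
            (L.op M * (L.rhoC 2 F * L.op M * L.rhoC 2 F⁻¹))) := by rw [hζu, one_mul]
        _ = (u a₀)⁻¹ • L.E' a₀ * (L.op M * (L.rhoC 2 F * L.op M * L.rhoC 2 F⁻¹) * L.ket u) *
            L.bra v := by
          rw [mul_assoc, ← mul_assoc (L.ket u), hMM]; simp only [mul_assoc]
        _ = _ := by
          rw [hMk, ← mul_assoc, hζu, one_mul]

end Leavitt

end QMA

end

noncomputable section

namespace QMA

variable {N : ℕ} {A : Type*} [Ring A]

/-- The block of an operator on `V^{⊗ (n+1)}` at a given position of the last tensor factor. -/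
def slice {n : ℕ} (Z : MatV N (n + 1) A) (c d : Fin N) : MatV N n A :=
  fun a b => Z (Fin.snoc a c) (Fin.snoc b d)

theorem slice_mul {n : ℕ} (Z W : MatV N (n + 1) A) (c d : Fin N) :
    slice (Z * W) c d = ∑ k, slice Z c k * slice W k d := by
  ext a b
  rw [Matrix.sum_apply]
  simp only [slice, Matrix.mul_apply]
  rw [← (Fin.snocEquiv fun _ => Fin N).sum_comp, Fintype.sum_prod_type]
  rfl

theorem toN_mul (Z W : MatV N 1 A) : toN (Z * W) = toN Z * toN W := by
  ext i j
  simp only [toN, Matrix.mul_apply]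
  exact Fintype.sum_equiv (Equiv.funUnique (Fin 1) (Fin N)) _ _ fun c => by
    rw [show c = fun _ => c 0 from funext fun i => by rw [Subsingleton.elim i 0]]; rfl

theorem lmulE_mul {m : Type*} [Fintype m] (γ : A) (Z W : Matrix m m A) :
    lmulE γ Z * W = lmulE γ (Z * W) := by
  ext i j
  simp [lmulE, Matrix.mul_apply, Finset.mul_sum, mul_assoc]

variable [Algebra ℂ A]

/-- The tensor power `X ⊗ ⋯ ⊗ X`. -/
def powT (X : Matrix (Fin N) (Fin N) ℂ) (n : ℕ) : MatV N n ℂ := fun a b => ∏ i, X (a i) (b i)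

theorem powT_snoc (X : Matrix (Fin N) (Fin N) ℂ) {n : ℕ} (a b : Fin n → Fin N) (c d : Fin N) :
    powT X (n + 1) (Fin.snoc a c) (Fin.snoc b d) = powT X n a b * X c d := by
  simp [powT, Fin.prod_univ_castSucc]

theorem slice_lmulE_powT (γ : A) (X : Matrix (Fin N) (Fin N) ℂ) {n : ℕ} (c d : Fin N) :
    slice (lmulE γ (cmap (powT X (n + 1)))) c d = X c d • lmulE γ (cmap (powT X n)) := by
  ext a b
  simp [slice, lmulE, cmap, powT_snoc, Algebra.algebraMap_eq_smul_one, smul_smul, mul_comm]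

theorem ptrace_eq_sum_slice {n : ℕ} (D : Matrix (Fin N) (Fin N) ℂ) (Z : MatV N (n + 1) A) :
    ptrace (cmap D) Z = ∑ m, ∑ c, D m c • slice Z c m := by
  ext a b
  simp only [Matrix.sum_apply]
  exact Finset.sum_congr rfl fun m _ => Finset.sum_congr rfl fun c _ =>
    (Algebra.smul_def _ _).symm

/-- Moving a tensor power across a partial trace conjugates the weight of the trace. -/
theorem ptrace_mul_powT {γ : A} {X Y : Matrix (Fin N) (Fin N) ℂ} (hXY : X * Y = 1)
    (D : Matrix (Fin N) (Fin N) ℂ) {n : ℕ} {Z : MatV N (n + 1) A}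
    (h : Commute Z (lmulE γ (cmap (powT X (n + 1))))) :
    ptrace (cmap D) Z * lmulE γ (cmap (powT X n)) =
      lmulE γ (cmap (powT X n)) * ptrace (cmap (Y * D * X)) Z := by
  set C : MatV N n A := lmulE γ (cmap (powT X n)) with hC
  have h1 : ∀ c d, ∑ k, X k d • (slice Z c k * C) = ∑ k, X c k • (C * slice Z k d) := fun c d => by
    have h2 := congrArg (fun W => slice W c d) h.eq
    simpa only [slice_mul, slice_lmulE_powT, ← hC, mul_smul_comm, smul_mul_assoc] using h2
  have h3 : ∀ c m, slice Z c m * C = ∑ d, ∑ k, (Y d m * X c k) • (C * slice Z k d) := fun c m => by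
    have h4 : ∀ d, ∑ k, (Y d m * X c k) • (C * slice Z k d) =
        ∑ k, (X k d * Y d m) • (slice Z c k * C) := fun d => by
      simp only [mul_smul, ← Finset.smul_sum, ← h1]
      simp only [Finset.smul_sum, smul_smul, mul_comm]
    simp only [h4]
    rw [Finset.sum_comm]
    simp only [← Finset.sum_smul, ← Matrix.mul_apply, hXY, Matrix.one_apply]
    simp
  rw [ptrace_eq_sum_slice, ptrace_eq_sum_slice]
  simp only [Finset.sum_mul, Finset.mul_sum, smul_mul_assoc, mul_smul_comm, h3, Finset.smul_sum,
    Matrix.mul_apply, Finset.sum_smul, smul_smul]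
  have e : ∀ f g : Fin N → Fin N → Fin N → Fin N → MatV N n A,
      (∀ m c d k, f m c d k = g d k c m) →
      ∑ m, ∑ c, ∑ d, ∑ k, f m c d k = ∑ d, ∑ k, ∑ c, ∑ m, g d k c m := fun f g hfg => by
    simp only [hfg, ← Fintype.sum_prod_type']
    refine Fintype.sum_equiv ⟨fun t => (t.2.2.1, t.2.2.2, t.2.1, t.1),
      fun t => (t.2.2.2, t.2.2.1, t.1, t.2.1), fun _ => rfl, fun _ => rfl⟩ _ _ fun _ => rfl
  refine e _ _ fun m c d k => ?_
  congr 1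
  ring

variable {X Y D : Matrix (Fin N) (Fin N) ℂ} {γ : A}

theorem commute_ptrace (hXY : X * Y = 1) (hD : Y * D * X = D) {n : ℕ} {Z : MatV N (n + 1) A}
    (h : Commute Z (lmulE γ (cmap (powT X (n + 1))))) :
    Commute (ptrace (cmap D) Z) (lmulE γ (cmap (powT X n))) := by
  have := ptrace_mul_powT hXY D h
  rwa [hD] at this

theorem commute_trAll (hXY : X * Y = 1) (hD : Y * D * X = D) :
    ∀ {n : ℕ} {Z : MatV N n A}, Commute Z (lmulE γ (cmap (powT X n))) →
      Commute (trAll (cmap D) n Z) γ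
  | 0, Z, h => by
    rw [trAll, Subsingleton.elim (fun i : Fin 0 => i.elim0 : Fin 0 → Fin N) default]
    have := congrFun (congrFun h.eq fun i => i.elim0) fun i => i.elim0
    simp only [Matrix.mul_apply, lmulE, cmap, Matrix.map_apply, powT] at this
    simp only [Finset.univ_eq_empty, Finset.prod_empty, map_one, mul_one,
      Finset.univ_unique, Finset.sum_singleton] at this
    exact this
  | n + 1, Z, h => commute_trAll hXY hD (n := n) (commute_ptrace hXY hD h)

theorem commute_trTail (hXY : X * Y = 1) (hD : Y * D * X = D) :
    ∀ {j : ℕ} {Z : MatV N (j + 1) A}, Commute Z (lmulE γ (cmap (powT X (j + 1)))) →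
      Commute (trTail (cmap D) j Z) (lmulE γ (cmap (powT X 1)))
  | 0, _, h => h
  | j + 1, _, h => commute_trTail hXY hD (j := j) (commute_ptrace hXY hD h)

theorem toN_lmulE_powT (γ : A) (X : Matrix (Fin N) (Fin N) ℂ) :
    toN (lmulE γ (cmap (powT X 1))) = lmulE γ (cmap X) := by
  ext i j
  simp [toN, lmulE, cmap, powT]

theorem mul_lmulE_cmap {m : Type*} [Fintype m] (γ : A) (Z : Matrix m m A) (W : Matrix m m ℂ) :
    Z * lmulE γ (cmap W) = rmulE Z γ * cmap W := by
  ext i j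
  simp [lmulE, rmulE, cmap, Matrix.mul_apply, mul_assoc]

theorem rmulE_eq_of_commute (hXY : X * Y = 1) {Z : MatV N 1 A}
    (h : Commute Z (lmulE γ (cmap (powT X 1)))) :
    rmulE (toN Z) γ = lmulE γ (cmap X * toN Z * cmap Y) := by
  have h1 := congrArg toN h.eq
  rw [toN_mul, toN_mul, toN_lmulE_powT, mul_lmulE_cmap, lmulE_mul] at h1
  rw [← lmulE_mul, ← h1, mul_assoc, ← cmap_mul, hXY, cmap_one, mul_one]

theorem ptrace_lmulE (D : Matrix (Fin N) (Fin N) ℂ) {n : ℕ} (W : MatV N (n + 1) ℂ) :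
    ptrace (cmap D) (lmulE γ (cmap W)) = lmulE γ (cmap (ptrace D W)) := by
  ext a b
  simp only [ptrace, lmulE, cmap, Matrix.map_apply, map_sum, map_mul, Finset.mul_sum]
  simp only [Algebra.left_comm]

theorem trAll_lmulE (D : Matrix (Fin N) (Fin N) ℂ) :
    ∀ {n : ℕ} (W : MatV N n ℂ),
      trAll (cmap D) n (lmulE γ (cmap W)) = γ * algebraMap ℂ A (trAll D n W)
  | 0, _ => rfl
  | n + 1, W => by rw [trAll, ptrace_lmulE, trAll_lmulE D, trAll]

theorem cmap_self {m : Type*} (W : Matrix m m ℂ) : cmap W = W := rfl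

theorem ptrace_Dof {R Ψ : MatV N 2 ℂ} (h : SkewPair R Ψ) : ptrace (n := 1) (Dof Ψ) R = 1 := by
  ext a b
  have h1 : ∀ (a : Fin 1 → Fin N) c, (Fin.snoc a c : Fin 2 → Fin N) = ![a 0, c] := fun a c => by
    ext i; fin_cases i <;> rfl
  have h2 : ∑ j, ∑ m, ∑ c, R ![a 0, m] ![b 0, c] * Ψ ![c, j] ![m, j] = if a = b then 1 else 0 := by
    simp only [h.1]
    have : a = b ↔ a 0 = b 0 := by
      constructor
      · rintro rfl; rfl
      · intro h; ext i; rw [Subsingleton.elim i 0, h]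
    simp [this, ite_and]
  rw [Matrix.one_apply, ← h2]
  simp only [ptrace, Dof, h1, Finset.sum_mul]
  simp only [← Fintype.sum_prod_type']
  exact Fintype.sum_equiv ⟨fun t => (t.2.2, t.2.1, t.1), fun t => (t.2.2, t.2.1, t.1),
    fun _ => rfl, fun _ => rfl⟩ _ _ fun _ => mul_comm _ _

theorem eq_Dof_of_ptrace_eq_one {R Ψ : MatV N 2 ℂ} (h : SkewPair R Ψ)
    (hD : ptrace (n := 1) D R = 1) : D = Dof Ψ := by
  ext i j
  have h1 : ∀ (a : Fin 1 → Fin N) c, (Fin.snoc a c : Fin 2 → Fin N) = ![a 0, c] := fun a c => by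
    ext i; fin_cases i <;> rfl
  have h2 : ∀ c m : Fin N, ∑ x, ∑ y, D x y * R ![c, y] ![m, x] = if c = m then 1 else 0 :=
    fun c m => by
      have := congrFun (congrFun hD fun _ => c) fun _ => m
      simpa [ptrace, h1, Matrix.one_apply, funext_iff] using this
  have h3 : ∑ x, ∑ y, D x y * ∑ m, ∑ c, Ψ ![i, m] ![j, c] * R ![c, y] ![m, x] = D i j := by
    simp [h.2, ite_and]
  have h4 : ∑ m, ∑ c, Ψ ![i, m] ![j, c] * ∑ x, ∑ y, D x y * R ![c, y] ![m, x] = Dof Ψ i j := by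
    simp [h2, Dof]
  rw [← h3, ← h4]
  simp only [Finset.mul_sum, ← Fintype.sum_prod_type']
  refine Fintype.sum_equiv ⟨fun t => (t.2.2.1, t.2.2.2, t.1, t.2.1),
    fun t => (t.2.2.1, t.2.2.2, t.1, t.2.1), fun _ => rfl, fun _ => rfl⟩ _ _ fun _ => ?_
  simp only [Equiv.coe_fn_mk]
  ring

theorem conj_Dof {R Ψ : MatV N 2 ℂ} (hΨ : SkewPair R Ψ) (hXY : X * Y = 1)
    (h : Commute R (powT X 2)) : Y * Dof Ψ * X = Dof Ψ := by
  refine eq_Dof_of_ptrace_eq_one hΨ ?_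
  have e : ∀ n, lmulE (1 : ℂ) (cmap (powT X n)) = powT X n := fun n => by
    ext; simp [lmulE, cmap]
  have h1 := ptrace_mul_powT (n := 1) (γ := (1 : ℂ)) hXY (Dof Ψ) (Z := R) (by rwa [e])
  rw [e, cmap_self, cmap_self, ptrace_Dof hΨ, one_mul] at h1
  have h2 : powT Y 1 * powT X 1 = 1 := by
    have hYX : Y * X = 1 := mul_eq_one_comm.1 hXY
    ext a b
    have h3 : ∀ a b : Fin 1 → Fin N,
        (1 : MatV N 1 ℂ) a b = (1 : Matrix (Fin N) (Fin N) ℂ) (a 0) (b 0) :=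
      fun a b => by simp [Matrix.one_apply, funext_iff]
    rw [h3, ← hYX, Matrix.mul_apply, Matrix.mul_apply]
    exact Fintype.sum_equiv (Equiv.funUnique (Fin 1) (Fin N)) _ _ fun c => by simp [powT]
  rw [← one_mul (ptrace _ _), ← h2, mul_assoc, ← h1, h2]

end QMA

end

noncomputable section

namespace QMA

namespace Leavitt

section

variable {N : ℕ} {A B : Type*} [Ring A] [Algebra ℂ A] [Ring B] [Algebra ℂ B]
  (L : Leavitt N A B) (X : Matrix (Fin N) (Fin N) ℂ)

theorem rhoC_powT_succ (n : ℕ) :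
    L.rhoC (n + 1) (powT X (n + 1)) = L.op (cmap X) * L.S (L.rhoC n (powT X n)) := by
  refine (L.eq_rho fun a b => ?_).symm
  calc L.E' a * (L.op (cmap X) * L.S (L.rhoC n (powT X n))) * L.E b
      = L.E' (Fin.tail a) * (L.f (a 0) * L.op (cmap X) * (L.S (L.rhoC n (powT X n)) * L.e (b 0))) *
          L.E (Fin.tail b) := by rw [E_succ, E'_succ]; simp only [mul_assoc]
    _ = L.E' (Fin.tail a) * (L.f (a 0) * L.op (cmap X) * L.e (b 0)) *
          (L.rhoC n (powT X n) * L.E (Fin.tail b)) := by rw [S_mul_e]; simp only [mul_assoc]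
    _ = L.ι (cmap X (a 0) (b 0)) * (L.E' (Fin.tail a) * L.rho (cmap (powT X n)) *
          L.E (Fin.tail b)) := by
      rw [coeff_op, ← ι_mul_E', rhoC_apply]; simp only [mul_assoc]
    _ = _ := by
      rw [coeff_rho, ← map_mul]
      simp [cmap, powT, Fin.prod_univ_succ, Fin.tail]

variable {X}

variable [NeZero N]

theorem commute_rhoC_powT {W : MatV N 2 ℂ}
    (h : Commute (L.rhoC 2 W) (L.op (cmap X) * L.S (L.op (cmap X)))) :
    ∀ {p n : ℕ}, p + 2 ≤ n → Commute (L.rhoC n (lift2 p W)) (L.rhoC n (powT X n))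
  | 0, n, hn => by
    obtain ⟨k, rfl⟩ := Nat.exists_eq_add_of_le' hn
    rw [rhoC_lift2_zero, rhoC_powT_succ, rhoC_powT_succ, map_mul, ← mul_assoc]
    exact h.mul_right (L.rho_cmap_mul W _)
  | p + 1, n, hn => by
    obtain ⟨k, rfl⟩ := Nat.exists_eq_add_of_le' (le_of_add_le_right hn)
    rw [show k + 2 = k + 1 + 1 from rfl, rhoC_lift2_succ, rhoC_powT_succ]
    exact Commute.mul_right (L.op_mul_S _ (L.rho_cmap_mem_scal _)).symm
      ((commute_rhoC_powT h (by omega)).map L.S)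

theorem commute_lift2 (hι : Function.Injective L.ι) {W : MatV N 2 ℂ}
    (h : Commute (L.rhoC 2 W) (L.op (cmap X) * L.S (L.op (cmap X)))) (γ : A) {p n : ℕ}
    (hn : p + 2 ≤ n) :
    Commute (cmap (lift2 (n := n) p W)) (lmulE γ (cmap (powT X n))) := by
  refine L.rho_injective hι ?_
  rw [rho_mul, rho_mul, rho_lmulE]
  exact Commute.mul_right (L.mem_scal.1 (L.rho_cmap_mem_scal _) γ).symm (L.commute_rhoC_powT h hn)

theorem commute_lift1 (hι : Function.Injective L.ι) {M : Matrix (Fin N) (Fin N) A} {γ : A}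
    (h : Commute (L.op M) (L.ι γ * L.op (cmap X))) {n : ℕ} (hn : 0 < n) :
    Commute (lift1 (n := n) 0 M) (lmulE γ (cmap (powT X n))) := by
  obtain ⟨k, rfl⟩ := Nat.exists_eq_add_of_le' hn
  refine L.rho_injective hι ?_
  rw [rho_mul, rho_mul, rho_lmulE, rho_lift1_zero, ← rhoC_apply, rhoC_powT_succ,
    ← mul_assoc (L.ι γ)]
  exact h.mul_right (L.op_mul_S M (L.rho_cmap_mem_scal _))

end

end Leavitt

variable {N : ℕ} [NeZero N] {A : Type*} [Ring A] [Algebra ℂ A] {F R ΨR : MatV N 2 ℂ}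
  {M : Matrix (Fin N) (Fin N) A} {n : ℕ} {C : MatV N n A}

theorem commute_Mcopy (hM : 0 < n → Commute (lift1 0 M) C)
    (hF : ∀ p, p + 2 ≤ n → Commute (cmap (lift2 p F)) C)
    (hF' : ∀ p, p + 2 ≤ n → Commute (cmap (lift2 p F⁻¹)) C) :
    ∀ {j : ℕ}, j < n → Commute (Mcopy F M j) C
  | 0, hj => hM hj
  | j + 1, hj => ((hF j hj).mul_left (commute_Mcopy hM hF hF' (by omega))).mul_left (hF' j hj)

theorem commute_Mprod (h : ∀ j, j < n → Commute (Mcopy F M j) C) :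
    ∀ {j : ℕ}, j ≤ n → Commute (Mprod F M j) C
  | 0, _ => Commute.one_left C
  | j + 1, hj => (commute_Mprod h (by omega)).mul_left (h j hj)

theorem commute_rhoWord (hR : ∀ p, p + 2 ≤ n → Commute (cmap (lift2 p R)) C)
    (hR' : ∀ p, p + 2 ≤ n → Commute (cmap (lift2 p R⁻¹)) C) :
    ∀ {w : List (ℕ × Bool)}, WordOK n w → Commute (cmap (rhoWord R w)) C
  | [], _ => by rw [rhoWord, cmap_one]; exact Commute.one_left C
  | (i, b) :: w, hw => by
    have hi := hw (i, b) List.mem_cons_self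
    rw [rhoWord, cmap_mul]
    refine Commute.mul_left ?_ (commute_rhoWord hR hR' fun p hp => hw p (List.mem_cons_of_mem _ hp))
    split_ifs
    · exact hR i hi
    · exact hR' i hi

variable {q μ : ℂ}

theorem bmwK_eq_vecMulVec (hΨ : SkewPair R ΨR) (hD : IsUnit (Dof ΨR).det) (hμ : μ ≠ 0)
    (hR : IsBraid R) (hdet : IsUnit R.det) (h : IsBMW q μ R) (h₀ : bmwK q μ R ≠ 0) :
    ∃ u v a₀ b₀, u a₀ ≠ 0 ∧ v b₀ = 1 ∧ bmwK q μ R = Matrix.vecMulVec u v := by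
  obtain ⟨a₀, b₀, hab⟩ : ∃ a₀ b₀, bmwK q μ R a₀ b₀ ≠ 0 := by
    by_contra! hc
    exact h₀ (Matrix.ext hc)
  refine ⟨fun a => bmwK q μ R a b₀, fun b => (bmwK q μ R a₀ b₀)⁻¹ * bmwK q μ R a₀ b, a₀, b₀, hab,
    inv_mul_cancel₀ hab, ?_⟩
  ext a b
  rw [Matrix.vecMulVec_apply, mul_left_comm, ← bmwK_rank_one hΨ hD hμ hR hdet h hab,
    inv_mul_cancel_left₀ hab]

theorem gElt_eq_zero (hK : bmwK q μ R = 0) : gElt q μ R F ΨR M = 0 := by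
  have h : (cmap (lift2 (n := 2) 0 (0 : MatV N 2 ℂ)) : MatV N 2 A) = 0 := by
    ext a b
    simp [cmap, lift2]
  simp [gElt, hK, h, trAll, ptrace]

theorem gElt_eq_smul {γ : A} (h : Mcopy (n := 2) F M 0 * Mcopy F M 1 * cmap (bmwK q μ R) =
    lmulE γ (cmap (bmwK q μ R))) : ∃ s : ℂ, gElt q μ R F ΨR M = s • γ := by
  have h0 : (lift2 0 (bmwK q μ R) : MatV N 2 ℂ) = bmwK q μ R := by
    ext a b
    have e : ∀ a : Fin 2 → Fin N, ![idx a 0, idx a 1] = a := fun a => by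
      ext i; fin_cases i <;> simp [idx]
    have : ∀ m : Fin 2, (m : ℕ) = 0 ∨ (m : ℕ) = 0 + 1 ∨ a m = b m := fun m => by omega
    rw [lift2, if_pos this, zero_add, e, e]
  rw [gElt, h0, Mprod, Mprod, Mprod, one_mul, h, trAll_lmulE, ← Algebra.commutes,
    ← Algebra.smul_def, smul_smul]
  exact ⟨_, rfl⟩

theorem QMArel_zero (R F : MatV N 2 ℂ) : QMArel R F (0 : Matrix (Fin N) (Fin N) A) := by
  have h : (lift1 0 (0 : Matrix (Fin N) (Fin N) A) : MatV N 2 A) = 0 := by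
    ext a b
    simp [lift1]
  simp [QMArel, Mcopy, h]

/-- Every matrix in the spanning set of `P(R,F)` satisfies the permutation rule for `γ`, provided
the tensor powers of `γ X` commute with everything the set is built from. -/
theorem rmulE_eq_of_mem_Pset {X Y : Matrix (Fin N) (Fin N) ℂ} {γ : A} (hXY : X * Y = 1)
    (hD : Y * Dof ΨR * X = Dof ΨR)
    (hM : ∀ n, 0 < n → Commute (lift1 (n := n) 0 M) (lmulE γ (cmap (powT X n))))
    (hW : ∀ W ∈ ({F, F⁻¹, R, R⁻¹} : Set (MatV N 2 ℂ)), ∀ n p, p + 2 ≤ n →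
      Commute (cmap (lift2 (n := n) p W)) (lmulE γ (cmap (powT X n))))
    {Z : Matrix (Fin N) (Fin N) A} (hZ : Z ∈ Pset R F ΨR M) :
    rmulE Z γ = lmulE γ (cmap X * Z * cmap Y) := by
  have h : ∀ n w, WordOK n w →
      Commute (Mprod F M n * cmap (rhoWord R w)) (lmulE γ (cmap (powT X n))) := fun n w hw =>
    (commute_Mprod (fun j => commute_Mcopy (hM n) (hW _ (by simp) n) (hW _ (by simp) n))
      le_rfl).mul_left (commute_rhoWord (hW _ (by simp) n) (hW _ (by simp) n) hw)
  rcases hZ with ⟨n, w, hw, rfl⟩ | ⟨m, w, hw, rfl⟩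
  · have h1 : chA R F ΨR M n w * γ = γ * chA R F ΨR M n w := commute_trAll hXY hD (h n w hw)
    have h2 : cmap X * chA R F ΨR M n w • (1 : Matrix (Fin N) (Fin N) A) * cmap Y =
        chA R F ΨR M n w • (1 : Matrix (Fin N) (Fin N) A) := by
      have h3 : cmap X * chA R F ΨR M n w • (1 : Matrix (Fin N) (Fin N) A) =
          chA R F ΨR M n w • cmap X := by
        ext i j
        simp [Matrix.mul_apply, Matrix.one_apply, cmap, Algebra.commutes]
      rw [h3, smul_mul_assoc, ← cmap_mul, hXY, cmap_one]
    rw [h2]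
    ext i j
    simp [rmulE, lmulE, Matrix.one_apply, h1]
  · exact rmulE_eq_of_commute hXY (commute_trTail hXY hD (h _ w hw))

end QMA

end

noncomputable section

namespace QMA

variable {N : ℕ} [NeZero N] {A : Type*} [Ring A] [Algebra ℂ A]

/-- **Permutation rule for the 2-contraction** (eq. (3.19) of Ogievetsky–Pyatov).

For every matrix `X` in the space `P(R,F)` over the quantum matrix algebra `M(R,F)` one has
`X g = g (G⁻¹ X G)`, where `G₁ = Tr_(2,3)(K₂ F₁⁻¹ F₂⁻¹)`. -/
theorem two_contraction_permutation_rule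
    {N : ℕ} [NeZero N] (q μ : ℂ)
    (hq0 : q ≠ 0) (hq1 : q ≠ 1) (hqm1 : q ≠ -1)
    (hμ0 : μ ≠ 0) (hμq : μ ≠ q) (hμq' : μ ≠ -q⁻¹)
    (R F ΨR ΨF : MatV N 2 ℂ)
    (hRbraid : IsBraid R) (hRdet : IsUnit R.det)
    (hFbraid : IsBraid F) (hFdet : IsUnit F.det)
    (hcomp : Compatible R F)
    (hΨR : SkewPair R ΨR) (hΨF : SkewPair F ΨF)
    (hRstrict : IsUnit (Dof ΨR).det) (hFstrict : IsUnit (Dof ΨF).det)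
    (hbmw : IsBMW q μ R)
    (hGdet : IsUnit (Gmat q μ R F).det)
    (A : Type*) [Ring A] [Algebra ℂ A]
    (M : Matrix (Fin N) (Fin N) A)
    (hM : QMArel R F M) :
    ∀ X ∈ Submodule.span ℂ (Pset R F ΨR M),
      rmulE X (gElt q μ R F ΨR M) =
        lmulE (gElt q μ R F ΨR M)
          (cmap (Gmat q μ R F)⁻¹ * X * cmap (Gmat q μ R F)) := by
  by_cases hK : bmwK q μ R = 0
  · intro X _
    rw [gElt_eq_zero hK]
    ext i j
    simp [rmulE, lmulE]
  obtain ⟨u, v, a₀, b₀, hu, hv, huv⟩ :=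
    bmwK_eq_vecMulVec hΨR hRstrict hμ0 hRbraid hRdet hbmw hK
  have hXY : (Gmat q μ R F)⁻¹ * Gmat q μ R F = 1 := Matrix.nonsing_inv_mul _ hGdet
  have hD : Gmat q μ R F * Dof ΨR * (Gmat q μ R F)⁻¹ = Dof ΨR := by
    obtain ⟨-, -, -, -, h⟩ := (Leavitt.model N ℂ).exists_contraction hu hv huv hμ0 hRbraid hRdet
      hFbraid hFdet hcomp hbmw hGdet (QMArel_zero R F)
    refine conj_Dof hΨR hXY ?_
    have h1 := (Leavitt.model N ℂ).commute_rhoC_powT h (p := 0) (n := 2) le_rfl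
    rw [Leavitt.rhoC_lift2_zero (n := 0)] at h1
    exact (Leavitt.model N ℂ).rho_injective (Leavitt.model_ι_injective N ℂ)
      (((Leavitt.model N ℂ).rho_mul R _).trans (h1.eq.trans ((Leavitt.model N ℂ).rho_mul _ R).symm))
  set L := Leavitt.model N A
  have hι := Leavitt.model_ι_injective N A
  obtain ⟨γ, hγ, hMγ, hF, hR⟩ := L.exists_contraction hu hv huv hμ0 hRbraid hRdet
    hFbraid hFdet hcomp hbmw hGdet hM
  obtain ⟨s, hs⟩ : ∃ s : ℂ, gElt q μ R F ΨR M = s • γ := by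
    refine gElt_eq_smul (L.rho_injective hι ?_)
    rw [Leavitt.rho_mul, Leavitt.rho_lmulE, ← Leavitt.rhoC_apply, hγ]
  have hF' := conj_swap (L.rhoC_mul_inv hFdet) (L.rhoC_inv_mul hFdet) hF
  have hR' := conj_swap (L.rhoC_mul_inv hRdet) (L.rhoC_inv_mul hRdet) hR
  intro X hX
  have hγX : rmulE X γ = lmulE γ (cmap (Gmat q μ R F)⁻¹ * X * cmap (Gmat q μ R F)) := by
    induction hX using Submodule.span_induction with
    | mem X hX =>
      exact rmulE_eq_of_mem_Pset (F := F) hXY hD (fun _ => L.commute_lift1 hι hMγ)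
        (fun W hW n p => L.commute_lift2 hι (by
          rcases hW with rfl | rfl | rfl | rfl
          exacts [hF, hF', hR, hR']) γ) hX
    | zero => ext i j; simp [rmulE, lmulE]
    | add X Y _ _ hX hY =>
      ext i j
      simpa [mul_add, add_mul, rmulE, lmulE] using
        congrArg₂ (· + ·) (congrFun (congrFun hX i) j) (congrFun (congrFun hY i) j)
    | smul c X _ hX =>
      ext i j
      simpa [rmulE, lmulE] using congrArg (c • ·) (congrFun (congrFun hX i) j)
  rw [hs]
  ext i j
  simpa [rmulE, lmulE] using congrArg (s • ·) (congrFun (congrFun hγX i) j)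

end QMA

end
end

section
/- The Cayley–Hamilton coefficients become elementary symmetric functions of the spectral variables: Let A be a commutative ring, k ≥ 1, and ν_0, ν_1, …, ν_{2k} ∈ A with ν_{k+i}·ν_{k+1−i} = ν_0² for i = 1,…,k. Put a_m := e_m(ν_0, −ν_0, ν_1, …, ν_{2k}) (the m-th elementary symmetric polynomial in the 2k+2 listed arguments, with a_0 = 1), define ε_i := Σ_{j=0}^{⌊i/2⌋} a_{i−2j}·ν_0^{2j} for 0 ≤ i ≤ k, and ε_{k+i} := ε_{k−i}·ν_0^{2i} for 1 ≤ i ≤ k. Then ε_i = e_i(ν_1, …, ν_{2k}) for every 0 ≤ i ≤ 2k. -/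
noncomputable section

namespace QMA

/-- The elementary symmetric function `e_i` of a list of arguments, defined as the
coefficient of `t^i` in `∏_j (1 + a_j t)`. -/
def esymmList {R : Type*} [CommRing R] (l : List R) (i : ℕ) : R :=
  ((l.map fun a => Polynomial.C a * Polynomial.X + 1).prod).coeff i

/-- The list of spectral variables `ν_1, …, ν_{2k}`. -/
def nuList {A : Type*} (k : ℕ) (ν : ℕ → A) : List A :=
  (List.range (2 * k)).map fun j => ν (j + 1)

/-- `a_m = e_m(ν_0, -ν_0, ν_1, …, ν_{2k})`. -/
def aSym {A : Type*} [CommRing A] (k : ℕ) (ν : ℕ → A) (m : ℕ) : A :=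
  esymmList (ν 0 :: (-ν 0) :: nuList k ν) m

/-- The Cayley–Hamilton coefficients: `ε_i = ∑_{j=0}^{⌊i/2⌋} a_{i-2j} ν_0^{2j}` for
`0 ≤ i ≤ k`, and `ε_{k+i} = ε_{k-i} ν_0^{2i}` for `1 ≤ i ≤ k`. -/
def epsSym {A : Type*} [CommRing A] (k : ℕ) (ν : ℕ → A) (i : ℕ) : A :=
  if i ≤ k then
    ∑ j ∈ Finset.range (i / 2 + 1), aSym k ν (i - 2 * j) * ν 0 ^ (2 * j)
  else
    (∑ j ∈ Finset.range ((2 * k - i) / 2 + 1), aSym k ν (2 * k - i - 2 * j) * ν 0 ^ (2 * j)) *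
      ν 0 ^ (2 * (i - k))

open Polynomial in
/-- Coefficients of `∏ (1 + s_i t + g t²)` over `k` factors satisfy `c_{k+d} = c_{k-d} g^d`,
and vanish above degree `2k`. -/
theorem coeff_prod_quadratic_reflect {R : Type*} [CommRing R] (g : R) (s : ℕ → R) (k : ℕ) :
    (∀ a d : ℕ, a + d = k →
      (∏ i ∈ Finset.range k, (C g * X ^ 2 + C (s i) * X + 1)).coeff (k + d) =
        (∏ i ∈ Finset.range k, (C g * X ^ 2 + C (s i) * X + 1)).coeff a * g ^ d) ∧
    ∀ n : ℕ, 2 * k < n →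
      (∏ i ∈ Finset.range k, (C g * X ^ 2 + C (s i) * X + 1)).coeff n = 0 := by
  induction k with
  | zero =>
    refine ⟨fun a d h => ?_, fun n hn => ?_⟩
    · obtain ⟨rfl, rfl⟩ : a = 0 ∧ d = 0 := by omega
      simp
    · simp [coeff_one, show n ≠ 0 by omega]
  | succ k ih =>
    rw [Finset.prod_range_succ]
    set P := ∏ i ∈ Finset.range k, (C g * X ^ 2 + C (s i) * X + 1)
    obtain ⟨hsymm, hzero⟩ := ih
    have hP : P * (C g * X ^ 2 + C (s k) * X + 1) =
        C g * (P * X ^ 2) + C (s k) * (P * X) + P := by ring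
    have h0 : (P * (C g * X ^ 2 + C (s k) * X + 1)).coeff 0 = P.coeff 0 := by
      simp
    have h1 : (P * (C g * X ^ 2 + C (s k) * X + 1)).coeff 1 =
        s k * P.coeff 0 + P.coeff 1 := by
      rw [hP]; simp [coeff_mul_X_pow', coeff_mul_X]
    have h2 (n : ℕ) : (P * (C g * X ^ 2 + C (s k) * X + 1)).coeff (n + 2) =
        g * P.coeff n + s k * P.coeff (n + 1) + P.coeff (n + 2) := by
      rw [hP]
      simp only [coeff_add, coeff_C_mul, coeff_mul_X_pow, coeff_mul_X]
    refine ⟨fun a d h => ?_, fun n hn => ?_⟩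
    · obtain _ | d := d
      · simp [show a = k + 1 by omega]
      rw [show k + 1 + (d + 1) = k + d + 2 by omega, h2, hsymm a d (by omega)]
      match a, h with
      | 0, h =>
        rw [hzero (k + d + 1) (by omega), hzero (k + d + 2) (by omega), h0]
        ring
      | 1, h =>
        rw [hzero (k + d + 2) (by omega), add_assoc k d 1, hsymm 0 (d + 1) (by omega), h1]
        ring
      | a + 2, h =>
        rw [add_assoc k d 1, add_assoc k d 2, hsymm (a + 1) (d + 1) (by omega),
          hsymm a (d + 2) (by omega), h2]
        ring
    · obtain ⟨n, rfl⟩ := Nat.exists_eq_add_of_le' (show 2 ≤ n by omega)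
      rw [h2, hzero _ (by omega), hzero _ (by omega), hzero _ (by omega)]
      ring

open Polynomial in
theorem prod_nuList {A : Type*} [CommRing A] (k : ℕ) (ν : ℕ → A)
    (hrel : ∀ i : ℕ, 1 ≤ i → i ≤ k → ν (k + i) * ν (k + 1 - i) = ν 0 ^ 2) :
    ((nuList k ν).map fun a => C a * X + 1).prod =
      ∏ i ∈ Finset.range k,
        (C (ν 0 ^ 2) * X ^ 2 + C (ν (k + (i + 1)) + ν (k + 1 - (i + 1))) * X + 1) := by
  have hlist : ((nuList k ν).map fun a => C a * X + 1).prod =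
      ∏ j ∈ Finset.range (k + k), (C (ν (j + 1)) * X + 1) := by
    rw [nuList, List.map_map, ← two_mul]
    rfl
  rw [hlist, Finset.prod_range_add, ← Finset.prod_range_reflect, ← Finset.prod_mul_distrib]
  refine Finset.prod_congr rfl fun i hi => ?_
  have hi : i < k := Finset.mem_range.mp hi
  rw [← hrel (i + 1) (by omega) (by omega), show k - 1 - i + 1 = k + 1 - (i + 1) by omega,
    add_assoc k i 1]
  simp only [map_mul, map_add]
  ring

/-- Adjoining `x` and `-x` to the arguments multiplies the generating function by `1 - x² t²`. -/
theorem esymmList_cons_neg_cons {R : Type*} [CommRing R] (x : R) (l : List R) (n : ℕ) :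
    esymmList (x :: (-x) :: l) (n + 2) = esymmList l (n + 2) - x ^ 2 * esymmList l n := by
  simp only [esymmList, List.map_cons, List.prod_cons]
  rw [show ∀ p : Polynomial R, (Polynomial.C x * Polynomial.X + 1) *
      ((Polynomial.C (-x) * Polynomial.X + 1) * p) =
        p - Polynomial.C (x ^ 2) * (p * Polynomial.X ^ 2) from fun p => by
      simp only [map_neg, map_pow]; ring]
  simp only [Polynomial.coeff_sub, Polynomial.coeff_C_mul, Polynomial.coeff_mul_X_pow]

theorem esymmList_cons_neg_cons_of_lt {R : Type*} [CommRing R] (x : R) (l : List R) {n : ℕ}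
    (hn : n < 2) : esymmList (x :: (-x) :: l) n = esymmList l n := by
  simp only [esymmList, List.map_cons, List.prod_cons]
  rw [show ∀ p : Polynomial R, (Polynomial.C x * Polynomial.X + 1) *
      ((Polynomial.C (-x) * Polynomial.X + 1) * p) =
        p - Polynomial.C (x ^ 2) * (p * Polynomial.X ^ 2) from fun p => by
      simp only [map_neg, map_pow]; ring]
  simp [Polynomial.coeff_mul_X_pow', hn, -map_pow]

theorem sum_aSym_mul_pow {A : Type*} [CommRing A] (k : ℕ) (ν : ℕ → A) (i : ℕ) :
    ∑ j ∈ Finset.range (i / 2 + 1), aSym k ν (i - 2 * j) * ν 0 ^ (2 * j) =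
      esymmList (nuList k ν) i := by
  induction i using Nat.twoStepInduction with
  | zero => simp [aSym, esymmList_cons_neg_cons_of_lt]
  | one => simp [aSym, esymmList_cons_neg_cons_of_lt]
  | more n ih _ =>
    rw [show (n + 2) / 2 + 1 = n / 2 + 1 + 1 by omega, Finset.sum_range_succ']
    have hterm (j : ℕ) : aSym k ν (n + 2 - 2 * (j + 1)) * ν 0 ^ (2 * (j + 1)) =
        aSym k ν (n - 2 * j) * ν 0 ^ (2 * j) * ν 0 ^ 2 := by
      rw [show n + 2 - 2 * (j + 1) = n - 2 * j by omega]
      ring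
    simp only [hterm]
    rw [← Finset.sum_mul, ih, mul_zero, Nat.sub_zero, aSym, esymmList_cons_neg_cons]
    ring

/-- **The Cayley–Hamilton coefficients become elementary symmetric functions of the
spectral variables** (proof of Proposition 4.12 of Ogievetsky–Pyatov):

if `ν_{k+i} ν_{k+1-i} = ν_0²` for `i = 1, …, k`, then `ε_i = e_i(ν_1, …, ν_{2k})`
for every `0 ≤ i ≤ 2k`. -/
theorem eps_eq_esymm {A : Type*} [CommRing A] (k : ℕ) (hk : 1 ≤ k) (ν : ℕ → A)
    (hrel : ∀ i : ℕ, 1 ≤ i → i ≤ k → ν (k + i) * ν (k + 1 - i) = ν 0 ^ 2) :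
    ∀ i : ℕ, i ≤ 2 * k → epsSym k ν i = esymmList (nuList k ν) i := by
  intro i hi
  unfold epsSym
  split_ifs with h
  · exact sum_aSym_mul_pow k ν i
  · obtain ⟨d, rfl⟩ := Nat.exists_eq_add_of_le (show k ≤ i by omega)
    rw [sum_aSym_mul_pow, esymmList, esymmList, prod_nuList k ν hrel,
      (coeff_prod_quadratic_reflect (ν 0 ^ 2)
        (fun i => ν (k + (i + 1)) + ν (k + 1 - (i + 1))) k).1 (2 * k - (k + d)) d (by omega),
      Nat.add_sub_cancel_left, pow_mul]

end QMA

end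
end

section
/- Reciprocity of elementary symmetric functions under the symplectic relations: Let A be a commutative ring, k ≥ 1, and ν_0, ν_1, …, ν_{2k} ∈ A with ν_j·ν_{2k+1−j} = ν_0² for j = 1,…,k. Then for every 0 ≤ i ≤ k one has e_{k+i}(ν_1, …, ν_{2k}) = ν_0^{2i} · e_{k−i}(ν_1, …, ν_{2k}). -/
noncomputable section

namespace QMA

open Polynomial in
/-- A product of quadratics `c X² + s_j X + 1` is self-reciprocal up to powers of `c`. -/
theorem coeff_prod_quadratic_reciprocity {A : Type*} [CommRing A] (c : A) (s : ℕ → A) (n : ℕ) :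
    (∀ a d : ℕ, a + d = n →
      (∏ j ∈ Finset.range n, (C c * X ^ 2 + C (s j) * X + 1)).coeff (a + 2 * d) =
        c ^ d * (∏ j ∈ Finset.range n, (C c * X ^ 2 + C (s j) * X + 1)).coeff a) ∧
    ∀ m : ℕ, 2 * n < m →
      (∏ j ∈ Finset.range n, (C c * X ^ 2 + C (s j) * X + 1)).coeff m = 0 := by
  induction n with
  | zero =>
    refine ⟨fun a d h => ?_, fun m hm => ?_⟩
    · obtain ⟨rfl, rfl⟩ : a = 0 ∧ d = 0 := by omega
      simp
    · have hm0 : m ≠ 0 := by omega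
      simp [coeff_one, hm0]
  | succ n ih =>
    simp only [Finset.prod_range_succ]
    generalize ∏ j ∈ Finset.range n, (C c * X ^ 2 + C (s j) * X + 1) = p at ih ⊢
    obtain ⟨hsymm, hzero⟩ := ih
    have hmul : p * (C c * X ^ 2 + C (s n) * X + 1) =
        C c * (p * X ^ 2) + C (s n) * (p * X) + p := by ring
    have coeff_add_two (m : ℕ) : (p * (C c * X ^ 2 + C (s n) * X + 1)).coeff (m + 2) =
        c * p.coeff m + s n * p.coeff (m + 1) + p.coeff (m + 2) := by
      rw [hmul]
      simp only [coeff_add, coeff_C_mul, coeff_mul_X_pow, coeff_mul_X]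
    have coeff_at_one : (p * (C c * X ^ 2 + C (s n) * X + 1)).coeff 1 =
        s n * p.coeff 0 + p.coeff 1 := by
      rw [hmul]
      simp [coeff_mul_X_pow', coeff_mul_X]
    have coeff_at_zero : (p * (C c * X ^ 2 + C (s n) * X + 1)).coeff 0 = p.coeff 0 := by
      simp [mul_coeff_zero]
    refine ⟨fun a d h => ?_, fun m hm => ?_⟩
    · rcases d with _ | d
      · simp
      rcases a with _ | _ | a
      · obtain rfl : d = n := by omega
        rw [show 0 + 2 * (d + 1) = 2 * d + 2 by ring, coeff_add_two, coeff_at_zero,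
          hzero (2 * d + 1) (by omega), hzero (2 * d + 2) (by omega)]
        have h₀ := hsymm 0 d (by omega)
        rw [zero_add] at h₀
        rw [h₀]
        ring
      · obtain rfl : n = d + 1 := by omega
        rw [show 0 + 1 + 2 * (d + 1) = 2 * d + 1 + 2 by ring, coeff_add_two, zero_add,
          coeff_at_one, hzero (2 * d + 1 + 2) (by omega)]
        have h₀ := hsymm 0 (d + 1) (by omega)
        have h₁ := hsymm 1 d (by omega)
        rw [show 0 + 2 * (d + 1) = 2 * d + 1 + 1 by ring] at h₀
        rw [add_comm 1] at h₁
        rw [h₀, h₁]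
        ring
      · rw [show a + 1 + 1 + 2 * (d + 1) = a + 2 + 2 * d + 2 by ring, coeff_add_two,
          coeff_add_two]
        have h₀ := hsymm a (d + 2) (by omega)
        have h₁ := hsymm (a + 1) (d + 1) (by omega)
        have h₂ := hsymm (a + 2) d (by omega)
        rw [show a + 2 * (d + 2) = a + 2 + 2 * d + 2 by ring] at h₀
        rw [show a + 1 + 2 * (d + 1) = a + 2 + 2 * d + 1 by ring] at h₁
        rw [h₀, h₁, h₂]
        ring
    · obtain ⟨m, rfl⟩ : ∃ l, m = l + 2 := ⟨m - 2, by omega⟩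
      rw [coeff_add_two, hzero m (by omega), hzero (m + 1) (by omega),
        hzero (m + 2) (by omega)]
      ring

/-- A product over `2k` consecutive indices, grouped into pairs symmetric about the middle. -/
theorem prod_range_two_mul_eq_prod_pairs {M : Type*} [CommMonoid M] (f : ℕ → M) (k : ℕ) :
    ∏ j ∈ Finset.range (2 * k), f j = ∏ j ∈ Finset.range k, f j * f (2 * k - 1 - j) := by
  rw [two_mul, Finset.prod_range_add, Finset.prod_mul_distrib,
    ← Finset.prod_range_reflect (fun j => f (k + j))]
  congr 1
  refine Finset.prod_congr rfl fun j hj => ?_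
  have := Finset.mem_range.mp hj
  congr 1
  omega

/-- **Reciprocity of the elementary symmetric functions under the symplectic relations**:

if `ν_j ν_{2k+1-j} = ν_0²` for `j = 1, …, k`, then
`e_{k+i}(ν_1, …, ν_{2k}) = ν_0^{2i} e_{k-i}(ν_1, …, ν_{2k})` for every `0 ≤ i ≤ k`. -/
theorem esymm_reciprocity {A : Type*} [CommRing A] (k : ℕ) (hk : 1 ≤ k) (ν : ℕ → A)
    (hrel : ∀ j : ℕ, 1 ≤ j → j ≤ k → ν j * ν (2 * k + 1 - j) = ν 0 ^ 2) :
    ∀ i : ℕ, i ≤ k →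
      esymmList (nuList k ν) (k + i) = ν 0 ^ (2 * i) * esymmList (nuList k ν) (k - i) := by
  intro i hi
  have hprod : ((nuList k ν).map fun a => Polynomial.C a * Polynomial.X + 1).prod =
      ∏ j ∈ Finset.range k, (Polynomial.C (ν 0 ^ 2) * Polynomial.X ^ 2 +
        Polynomial.C (ν (j + 1) + ν (2 * k - j)) * Polynomial.X + 1) := by
    rw [nuList, List.map_map]
    change ∏ j ∈ Finset.range (2 * k), _ = _
    rw [prod_range_two_mul_eq_prod_pairs]
    refine Finset.prod_congr rfl fun j hj => ?_
    have hj' := Finset.mem_range.mp hj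
    have hr := hrel (j + 1) (by omega) (by omega)
    rw [show 2 * k + 1 - (j + 1) = 2 * k - j by omega] at hr
    simp only [Function.comp_apply]
    rw [show 2 * k - 1 - j + 1 = 2 * k - j by omega, ← hr, Polynomial.C_mul, Polynomial.C_add]
    ring
  have h := (coeff_prod_quadratic_reciprocity (ν 0 ^ 2)
    (fun j => ν (j + 1) + ν (2 * k - j)) k).1 (k - i) i (by omega)
  rw [show k - i + 2 * i = k + i by omega, ← pow_mul] at h
  simpa only [esymmList, hprod] using h

end QMA

end
end

section
/- Modified Newton and Wronski relations: Let A be a commutative unital ℂ-algebra, q ∈ ℂ with q ∉ {0,1,−1} and μ ∈ ℂ∖{0}, and let g, a_i, s_i, p_i ∈ A (i ≥ 0) with a_0 = s_0 = 1 and p_0 = (q−μ)(q^{−1}+μ)/(q−q^{−1}). Assume that for all n ≥ 1 the Newton relation Σ_{i=0}^{n−1} q^{−i} s_i p_{n−i} = n_q s_n + Σ_{i=1}^{⌊n/2⌋} (μ q^{2i−n} + q^{n−2i−1}) s_{n−2i} g^i holds, and that for all n ≥ 0 the Wronski relation Σ_{i=0}^{n} (−1)^i a_i s_{n−i} = δ_{n,0}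 − δ_{n,2}·g holds. Define modified sequences by s'_0 := s_0, s'_1 := s_1, s'_i := s_i + s'_{i−2} g for i ≥ 2, and p'_0 := (1 − μ² q²)/(q − q^{−1}), p'_1 := p_1, p'_i := p_i + (q^{−2} p'_{i−2} − p_{i−2}) g for i ≥ 2. Then for all n ≥ 1: Σ_{i=0}^{n−1} q^{−i} s_i p'_{n−i} = n_q s_n, and for all n ≥ 0: Σ_{i=0}^{n} (−1)^i a_i s'_{n−i} = δ_{n,0}. -/
noncomputable section

namespace QMA

theorem nq_zero (q : ℂ) : nq q 0 = 0 := by simp [nq]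

/-- The scalar identity behind the modified Newton relations. -/
theorem newton_coeff (q μ : ℂ) (hq0 : q ≠ 0) (hq : q - q⁻¹ ≠ 0) (n : ℕ) :
    (μ * q ^ (-(n : ℤ)) + q ^ ((n : ℤ) - 1)) - nq q n + q ^ (-2 : ℤ) * nq q n
      + q ^ (-(n : ℤ)) * (q ^ (-2 : ℤ) * ((1 - μ ^ 2 * q ^ 2) / (q - q⁻¹))
        - (q - μ) * (q⁻¹ + μ) / (q - q⁻¹)) = 0 := by
  have hx : q ^ n ≠ 0 := pow_ne_zero _ hq0
  have hq' : q ^ 2 - 1 ≠ 0 := by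
    intro h
    apply hq
    field_simp
    simpa using h
  have hd : q - q⁻¹ = (q ^ 2 - 1) / q := by field_simp
  rw [nq, hd, zpow_sub₀ hq0, zpow_neg, zpow_natCast]
  simp only [zpow_neg, zpow_ofNat]
  field_simp
  ring

/-- **Modified Newton and Wronski relations** (Lemma 4.16 of Ogievetsky–Pyatov).

Let `A` be a commutative unital `ℂ`-algebra and let `g, aᵢ, sᵢ, pᵢ ∈ A` with `a_0 = s_0 = 1`,
`p_0 = (q-μ)(q⁻¹+μ)/(q-q⁻¹)`, satisfying the Newton relation
`∑_{i=0}^{n-1} q^{-i} s_i p_{n-i} = n_q s_n + ∑_{i=1}^{⌊n/2⌋} (μ q^{2i-n} + q^{n-2i-1}) s_{n-2i} g^i`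
for `n ≥ 1` and the Wronski relation
`∑_{i=0}^{n} (-1)^i a_i s_{n-i} = δ_{n,0} - δ_{n,2} g` for `n ≥ 0`.
Define `s'_0 = s_0`, `s'_1 = s_1`, `s'_{i+2} = s_{i+2} + s'_i g`, and
`p'_0 = (1-μ²q²)/(q-q⁻¹)`, `p'_1 = p_1`, `p'_{i+2} = p_{i+2} + (q^{-2} p'_i - p_i) g`.
Then `∑_{i=0}^{n-1} q^{-i} s_i p'_{n-i} = n_q s_n` for all `n ≥ 1` and
`∑_{i=0}^{n} (-1)^i a_i s'_{n-i} = δ_{n,0}` for all `n ≥ 0`. -/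
theorem modified_newton_wronski
    {A : Type*} [CommRing A] [Algebra ℂ A]
    (q μ : ℂ) (hq0 : q ≠ 0) (hq1 : q ≠ 1) (hqm1 : q ≠ -1) (hμ0 : μ ≠ 0)
    (g : A) (a s p : ℕ → A)
    (ha0 : a 0 = 1) (hs0 : s 0 = 1)
    (hp0 : p 0 = algebraMap ℂ A ((q - μ) * (q⁻¹ + μ) / (q - q⁻¹)))
    (hNewton : ∀ n : ℕ, 1 ≤ n →
      ∑ i ∈ Finset.range n, q ^ (-(i : ℤ)) • (s i * p (n - i)) =
        nq q n • s n +
          ∑ i ∈ Finset.Icc 1 (n / 2),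
            (μ * q ^ (2 * (i : ℤ) - n) + q ^ ((n : ℤ) - 2 * i - 1)) • (s (n - 2 * i) * g ^ i))
    (hWronski : ∀ n : ℕ,
      ∑ i ∈ Finset.range (n + 1), (-1 : ℂ) ^ i • (a i * s (n - i)) =
        (if n = 0 then (1 : A) else 0) - (if n = 2 then g else 0))
    (s' p' : ℕ → A)
    (hs'0 : s' 0 = s 0) (hs'1 : s' 1 = s 1)
    (hs' : ∀ i : ℕ, s' (i + 2) = s (i + 2) + s' i * g)
    (hp'0 : p' 0 = algebraMap ℂ A ((1 - μ ^ 2 * q ^ 2) / (q - q⁻¹)))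
    (hp'1 : p' 1 = p 1)
    (hp' : ∀ i : ℕ, p' (i + 2) = p (i + 2) + (q ^ (-2 : ℤ) • p' i - p i) * g) :
    (∀ n : ℕ, 1 ≤ n →
      ∑ i ∈ Finset.range n, q ^ (-(i : ℤ)) • (s i * p' (n - i)) = nq q n • s n) ∧
    (∀ n : ℕ,
      ∑ i ∈ Finset.range (n + 1), (-1 : ℂ) ^ i • (a i * s' (n - i)) =
        if n = 0 then (1 : A) else 0) := by
  have hq : q - q⁻¹ ≠ 0 := by
    intro h
    have h2 : q * q = 1 := by
      rw [sub_eq_zero] at h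
      nth_rewrite 2 [h]
      exact mul_inv_cancel₀ hq0
    rcases mul_self_eq_one_iff.mp h2 with h | h
    exacts [hq1 h, hqm1 h]
  constructor
  · have key : ∀ n : ℕ,
        ∑ i ∈ Finset.range n, q ^ (-(i : ℤ)) • (s i * p' (n - i)) = nq q n • s n := by
      have hN : ∀ n : ℕ, ∑ i ∈ Finset.range n, q ^ (-(i : ℤ)) • (s i * p (n - i)) =
          nq q n • s n + ∑ i ∈ Finset.Icc 1 (n / 2),
            (μ * q ^ (2 * (i : ℤ) - n) + q ^ ((n : ℤ) - 2 * i - 1)) •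
              (s (n - 2 * i) * g ^ i) := by
        intro n
        rcases Nat.eq_zero_or_pos n with rfl | h
        · simp [nq_zero]
        · exact hNewton n h
      have hS : ∀ n : ℕ, ∑ i ∈ Finset.Icc 1 ((n + 2) / 2),
            (μ * q ^ (2 * (i : ℤ) - (n + 2 : ℕ)) + q ^ (((n + 2 : ℕ) : ℤ) - 2 * i - 1)) •
              (s (n + 2 - 2 * i) * g ^ i) =
          (μ * q ^ (-(n : ℤ)) + q ^ ((n : ℤ) - 1)) • (s n * g) +
          (∑ i ∈ Finset.Icc 1 (n / 2),
            (μ * q ^ (2 * (i : ℤ) - n) + q ^ ((n : ℤ) - 2 * i - 1)) •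
              (s (n - 2 * i) * g ^ i)) * g := by
        intro n
        have h2 : (n + 2) / 2 = n / 2 + 1 := by omega
        rw [h2, ← Finset.add_sum_Ioc_eq_sum_Icc (by omega), Finset.sum_mul]
        congr 1
        · congr 3 <;> simp
        · symm
          refine Finset.sum_bij (fun i _ => i + 1) ?_ ?_ ?_ ?_
          · intro i hi
            simp only [Finset.mem_Icc, Finset.mem_Ioc] at hi ⊢
            omega
          · intro i _ j _ h
            simpa using h
          · intro i hi
            simp only [Finset.mem_Ioc] at hi
            exact ⟨i - 1, by simp only [Finset.mem_Icc]; omega, by omega⟩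
          · intro i _
            have e1 : 2 * ((i + 1 : ℕ) : ℤ) - (n + 2 : ℕ) = 2 * (i : ℤ) - n := by
              push_cast; ring
            have e2 : ((n + 2 : ℕ) : ℤ) - 2 * (i + 1 : ℕ) - 1 = (n : ℤ) - 2 * i - 1 := by
              push_cast; ring
            have e3 : n + 2 - 2 * (i + 1) = n - 2 * i := by omega
            rw [e1, e2, e3, smul_mul_assoc, pow_succ, mul_assoc]
      have hR : ∀ n : ℕ,
          ∑ i ∈ Finset.range (n + 2), q ^ (-(i : ℤ)) • (s i * p' (n + 2 - i)) =
          ∑ i ∈ Finset.range (n + 2), q ^ (-(i : ℤ)) • (s i * p (n + 2 - i)) +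
          (q ^ (-2 : ℤ) • (∑ i ∈ Finset.range n, q ^ (-(i : ℤ)) • (s i * p' (n - i)) +
              q ^ (-(n : ℤ)) • (s n * p' 0)) -
            (∑ i ∈ Finset.range n, q ^ (-(i : ℤ)) • (s i * p (n - i)) +
              q ^ (-(n : ℤ)) • (s n * p 0))) * g := by
        intro n
        have h1 : n + 2 - (n + 1) = 1 := by omega
        have hT : ∀ f : ℕ → A, ∑ i ∈ Finset.range n, q ^ (-(i : ℤ)) • (s i * f (n - i)) +
            q ^ (-(n : ℤ)) • (s n * f 0) =
            ∑ i ∈ Finset.range (n + 1), q ^ (-(i : ℤ)) • (s i * f (n - i)) := by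
          intro f
          rw [Finset.sum_range_succ, Nat.sub_self]
        rw [hT, hT, Finset.sum_range_succ, Finset.sum_range_succ _ (n + 1), h1, hp'1,
          add_right_comm, Finset.smul_sum, ← Finset.sum_sub_distrib, Finset.sum_mul,
          ← Finset.sum_add_distrib]
        congr 1
        refine Finset.sum_congr rfl fun i hi => ?_
        have hi' : i < n + 1 := Finset.mem_range.mp hi
        have h3 : n + 2 - i = n - i + 2 := by omega
        rw [h3, hp']
        simp only [Algebra.smul_def]
        ring
      intro n
      induction n using Nat.twoStepInduction with
      | zero => simp [nq_zero]
      | one => simpa [hp'1] using hNewton 1 le_rfl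
      | more n ih _ =>
        have hc := congrArg (algebraMap ℂ A) (newton_coeff q μ hq0 hq n)
        rw [hR, ih, hN (n + 2), hN n, hS, hp'0, hp0]
        simp only [Algebra.smul_def, map_add, map_sub, map_mul, map_zero] at hc ⊢
        linear_combination (s n * g) * hc
    exact fun n _ => key n
  · intro n
    induction n using Nat.twoStepInduction with
    | zero => simpa [hs'0] using hWronski 0
    | one => simpa [hs'0, hs'1, Finset.sum_range_succ] using hWronski 1
    | more n ih _ =>
      have hR : ∑ i ∈ Finset.range (n + 2 + 1), (-1 : ℂ) ^ i • (a i * s' (n + 2 - i)) =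
          ∑ i ∈ Finset.range (n + 2 + 1), (-1 : ℂ) ^ i • (a i * s (n + 2 - i)) +
          (∑ i ∈ Finset.range (n + 1), (-1 : ℂ) ^ i • (a i * s' (n - i))) * g := by
        have h1 : n + 2 - (n + 1) = 1 := by omega
        simp only [Finset.sum_range_succ _ (n + 2), Finset.sum_range_succ _ (n + 1),
          Nat.sub_self, h1, hs'0, hs'1]
        rw [add_right_comm _ _ (Finset.sum _ _ * g), add_right_comm _ _ (Finset.sum _ _ * g),
          Finset.sum_mul, ← Finset.sum_add_distrib]
        congr 2
        refine Finset.sum_congr rfl fun i hi => ?_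
        have hi' : i < n + 1 := Finset.mem_range.mp hi
        have h3 : n + 2 - i = n - i + 2 := by omega
        rw [h3, hs']
        simp only [Algebra.smul_def]
        ring
      rw [hR, ih, hWronski]
      by_cases h : n = 0 <;> simp [h]

end QMA

end
end

section
/- A Lagrange-interpolation type summation identity: Let F be a field, q ∈ F with q ≠ 0 and q² ≠ 1, p ≥ 1, and let ν_1, …, ν_p be pairwise distinct elements of F. Then Σ_{i=1}^{p} ∏_{j=1, j≠i}^{p} (ν_i − q^{−2} ν_j)/(ν_i − ν_j) = (1 − q^{−2p})/(1 − q^{−2}). -/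
open Polynomial in
/-- For `f = ∏ (X - t νⱼ) - t ^ #s ∏ (X - νⱼ)`, which vanishes at `0`, the quotient `f / X` takes
the value `(1 - t) ∏_{j ≠ i} (νᵢ - t νⱼ)` at each node `νᵢ`, including a node equal to `0`. -/
lemma eval_divX_prod_sub_mul_nodal {F ι : Type*} [Field F] [DecidableEq ι] (s : Finset ι)
    (t : F) (ν : ι → F) {i : ι} (hi : i ∈ s) :
    (divX (Lagrange.nodal s (fun j => t * ν j) - C (t ^ s.card) * Lagrange.nodal s ν)).eval (ν i) =
      (1 - t) * ∏ j ∈ s.erase i, (ν i - t * ν j) := by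
  set f := Lagrange.nodal s (fun j => t * ν j) - C (t ^ s.card) * Lagrange.nodal s ν with hf
  have hf0 : f.coeff 0 = 0 := by
    rw [coeff_zero_eq_eval_zero, hf]
    simp only [eval_sub, eval_mul, eval_C, Lagrange.eval_nodal, zero_sub, ← mul_neg,
      Finset.prod_mul_distrib, Finset.prod_const, sub_self]
  have hX : X * divX f = f := by
    simpa [hf0] using X_mul_divX_add f
  by_cases h0 : ν i = 0
  · have hdiv : divX f = Lagrange.nodal (s.erase i) (fun j => t * ν j) -
        C (t ^ s.card) * Lagrange.nodal (s.erase i) ν := by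
      apply mul_left_cancel₀ (X_ne_zero (R := F))
      rw [hX, hf, Lagrange.nodal_eq_mul_nodal_erase hi, Lagrange.nodal_eq_mul_nodal_erase hi, h0]
      simp only [mul_zero, C_0, sub_zero]
      ring
    rw [hdiv, h0]
    simp only [eval_sub, eval_mul, eval_C, Lagrange.eval_nodal, zero_sub, ← mul_neg,
      Finset.prod_mul_distrib, Finset.prod_const]
    rw [← Finset.card_erase_add_one hi, pow_succ]
    ring
  · apply mul_left_cancel₀ h0
    have h := congrArg (eval (ν i)) hX
    rw [eval_mul, eval_X] at h
    rw [h, hf, Lagrange.nodal_eq_mul_nodal_erase hi, eval_sub, eval_mul, eval_mul,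
      Lagrange.eval_nodal_at_node hi, Lagrange.eval_nodal, eval_sub, eval_X, eval_C]
    ring

open Polynomial in
theorem one_sub_mul_sum_prod_div {F ι : Type*} [Field F] [DecidableEq ι] (s : Finset ι)
    (t : F) (ν : ι → F) (hν : Set.InjOn ν s) :
    (1 - t) * ∑ i ∈ s, ∏ j ∈ s.erase i, (ν i - t * ν j) / (ν i - ν j) = 1 - t ^ s.card := by
  rcases s.eq_empty_or_nonempty with rfl | hs
  · simp
  have hcard : s.card - 1 + 1 = s.card := Nat.sub_add_cancel hs.card_pos
  set f := Lagrange.nodal s (fun j => t * ν j) - C (t ^ s.card) * Lagrange.nodal s ν with hf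
  have hcoeff (w : ι → F) : (Lagrange.nodal s w).coeff s.card = 1 := by
    simpa [Monic, leadingCoeff, Lagrange.natDegree_nodal] using
      Lagrange.nodal_monic (s := s) (v := w)
  have hfdeg : f.natDegree ≤ s.card :=
    (natDegree_sub_le_iff_left (((natDegree_C_mul_le _ _).trans
      Lagrange.natDegree_nodal.le))).2 Lagrange.natDegree_nodal.le
  have hdeg : (divX f).degree < s.card := by
    refine (degree_le_natDegree).trans_lt ?_
    rw [natDegree_divX_eq_natDegree_tsub_one]
    exact_mod_cast (by have := hs.card_pos; omega : f.natDegree - 1 < s.card)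
  have h := Lagrange.coeff_eq_sum hν hdeg
  rw [coeff_divX, hcard, hf, coeff_sub, coeff_C_mul, hcoeff, hcoeff, mul_one] at h
  rw [h, Finset.mul_sum]
  refine Finset.sum_congr rfl fun i hi => ?_
  rw [eval_divX_prod_sub_mul_nodal s t ν hi, Finset.prod_div_distrib, mul_div_assoc]


/-- **A Lagrange-interpolation type summation identity** (used in the proof of
Proposition 4.15 of Ogievetsky–Pyatov, after Gurevich–Saponov):

for pairwise distinct `ν_1, …, ν_p` in a field `F` and `q ≠ 0`, `q² ≠ 1`,
`∑_{i=1}^{p} ∏_{j≠i} (ν_i - q^{-2} ν_j)/(ν_i - ν_j) = (1 - q^{-2p})/(1 - q^{-2})`. -/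
theorem lagrange_interpolation_sum
    {F : Type*} [Field F] (q : F) (hq : q ≠ 0) (hq2 : q ^ 2 ≠ 1)
    (p : ℕ) (hp : 1 ≤ p) (ν : Fin p → F) (hν : Function.Injective ν) :
    ∑ i : Fin p, ∏ j ∈ Finset.univ.filter (fun j => j ≠ i),
        (ν i - q ^ (-2 : ℤ) * ν j) / (ν i - ν j) =
      (1 - q ^ (-(2 * (p : ℤ)))) / (1 - q ^ (-2 : ℤ)) := by
  have ht : 1 - q ^ (-2 : ℤ) ≠ 0 := by
    rw [sub_ne_zero, ne_comm, zpow_neg, Ne, inv_eq_one]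
    exact_mod_cast hq2
  have hpow : q ^ (-(2 * (p : ℤ))) = (q ^ (-2 : ℤ)) ^ p := by
    rw [← neg_mul, zpow_mul, zpow_natCast]
  rw [eq_div_iff ht, hpow, mul_comm]
  simpa [Finset.filter_ne'] using
    one_sub_mul_sum_prod_div Finset.univ (q ^ (-2 : ℤ)) ν hν.injOn
end

section
/- Classical parent Cayley–Hamilton identity for conformal-symplectic matrices: Let k ≥ 1, let w be the k×k antidiagonal unit matrix (w_{ij} = δ_{i,k+1−j}) and Ω the 2k×2k block matrix with blocks Ω = [[0, w], [−w, 0]]. Let M be a 2k×2k complex matrix and g ∈ ℂ with Mᵀ Ω M = g Ω = M Ω Mᵀ. Define π(M) := −Ω Mᵀ Ω and let ε_i := tr(Λ^i M) be the trace of the i-th exterior power of M (equivalently, det(tI − M) = Σ_{i=0}^{2k} (−1)^i ε_i t^{2k−i}, with ε_0 = 1). Then Σ_{i=0}^{k} (−1)^i M^{k−i} ε_i + Σ_{i=0}^{k−1} (−1)^i π(M)^{k−i} ε_i = 0. -/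
open Matrix

noncomputable section

namespace QMA

/-- The `2k × 2k` matrix `Ω = [[0, w], [-w, 0]]` of the symplectic form, where `w` is the
`k × k` antidiagonal unit matrix. -/
def Omega (k : ℕ) : Matrix (Fin (2 * k)) (Fin (2 * k)) ℂ :=
  fun a b =>
    if (a : ℕ) + (b : ℕ) = 2 * k - 1 then (if (a : ℕ) < k then 1 else -1) else 0

/-- The coefficient `ε_i = tr(Λ^i M)`, the `i`-th elementary symmetric function of the
eigenvalues of `M`, characterized by `det(tI - M) = ∑_{i=0}^{2k} (-1)^i ε_i t^{2k-i}`. -/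
def epsClassical (k : ℕ) (M : Matrix (Fin (2 * k)) (Fin (2 * k)) ℂ) (i : ℕ) : ℂ :=
  (-1 : ℂ) ^ i * M.charpoly.coeff (2 * k - i)

open Polynomial Module

section SelfAdjoint

variable {K V : Type*} [Field K] [AddCommGroup V] [Module K V]
  {B : LinearMap.BilinForm K V}

theorem pow_apply_left_eq_right {T : End K V} (hT : ∀ x y, B (T x) y = B x (T y)) (n : ℕ)
    (x y : V) : B ((T ^ n) x) y = B x ((T ^ n) y) := by
  induction n generalizing x y with
  | zero => simp
  | succ n ih =>
    rw [pow_succ, Module.End.mul_apply, ih, hT, ← Module.End.mul_apply, ← pow_succ', pow_succ]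

theorem sub_smul_self_adjoint {S : End K V} (hS : ∀ x y, B (S x) y = B x (S y)) (μ : K)
    (x y : V) : B ((S - μ • 1) x) y = B x ((S - μ • 1) y) := by
  simp [hS]

variable [FiniteDimensional K V]

theorem even_finrank_of_isAlt_of_nondegenerate [CharZero K] (hB : B.IsAlt)
    (hnd : B.Nondegenerate) : Even (finrank K V) := by
  let b := finBasis K V
  have hdet := (LinearMap.BilinForm.nondegenerate_iff_det_ne_zero b).1 hnd
  set A := LinearMap.BilinForm.toMatrix b B with hA
  have hT : Aᵀ = -A := by
    ext i j
    simp only [hA, transpose_apply, Matrix.neg_apply, LinearMap.BilinForm.toMatrix_apply,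
      LinearMap.IsAlt.neg hB]
  by_contra hodd
  have h : A.det = -A.det := by
    conv_lhs => rw [← det_transpose, hT, det_neg, Fintype.card_fin,
      (Nat.not_even_iff_odd.1 hodd).neg_one_pow, neg_one_mul]
  exact hdet (self_eq_neg.1 h)

/-- A nilpotent endomorphism that is self-adjoint for a symplectic form has nilpotency index at
most half the dimension. -/
theorem pow_half_finrank_eq_zero [CharZero K] (hB : B.IsAlt) (hnd : B.Nondegenerate)
    {T : End K V} (hT : ∀ x y, B (T x) y = B x (T y)) (hnil : IsNilpotent T) :
    T ^ (finrank K V / 2) = 0 := by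
  ext v
  let L : Submodule K V := Submodule.span K (Set.range fun i : ℕ => (T ^ i) v)
  have horth : L ≤ B.orthogonal L := by
    refine Submodule.span_le.2 ?_
    rintro _ ⟨i, rfl⟩ y hy
    induction hy using Submodule.span_induction with
    | mem y hy =>
      obtain ⟨j, rfl⟩ := hy
      have h1 : B ((T ^ j) v) ((T ^ i) v) = B v ((T ^ (j + i)) v) := by
        rw [pow_apply_left_eq_right hT, ← Module.End.mul_apply, pow_add]
      have h2 : B v ((T ^ (j + i)) v) = -B v ((T ^ (j + i)) v) := by
        conv_lhs => rw [← pow_apply_left_eq_right hT, ← LinearMap.IsAlt.neg hB v]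
      exact h1.trans (self_eq_neg.1 h2)
    | zero => simp
    | add x y _ _ hx hy =>
      simp [hx, hy]
    | smul a x _ hx =>
      simp [hx]
  have hdim : finrank K L ≤ finrank K V / 2 := by
    have h := Submodule.finrank_mono horth
    rw [LinearMap.BilinForm.finrank_orthogonal hnd] at h
    have := L.finrank_le
    omega
  have hmaps : ∀ x ∈ L, T x ∈ L := by
    intro x hx
    have : L ≤ L.comap T := by
      refine Submodule.span_le.2 ?_
      rintro _ ⟨i, rfl⟩
      refine Submodule.subset_span ⟨i + 1, ?_⟩
      simp [pow_succ']
    exact this hx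
  have hv : v ∈ L := Submodule.subset_span ⟨0, by simp⟩
  have hres : IsNilpotent (T.restrict hmaps) := by
    obtain ⟨n, hn⟩ := hnil
    refine ⟨n, ?_⟩
    ext x
    rw [Module.End.pow_restrict]
    simp [hn]
  have hzero : (T.restrict hmaps) ^ (finrank K L) = 0 := by
    have h := LinearMap.aeval_self_charpoly (T.restrict hmaps)
    rwa [hres.charpoly_eq_X_pow_finrank, map_pow, aeval_X] at h
  have hTv : (T ^ finrank K L) v = 0 := by
    have h := congrArg Subtype.val (LinearMap.congr_fun hzero ⟨v, hv⟩)
    rw [Module.End.pow_restrict] at h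
    simpa using h
  rw [← Nat.sub_add_cancel hdim, pow_add, Module.End.mul_apply, hTv]
  simp

theorem restrict_maxGenEigenspace_nondegenerate (hB : B.IsAlt) (hnd : B.Nondegenerate)
    {S : End K V} (hS : ∀ x y, B (S x) y = B x (S y)) (μ : K) :
    (B.restrict (S.maxGenEigenspace μ)).Nondegenerate := by
  have halt : (B.restrict (S.maxGenEigenspace μ)).IsAlt := fun x => hB x
  refine (LinearMap.IsRefl.nondegenerate_iff_separatingLeft halt.isRefl).2 ?_
  intro x hx
  obtain ⟨n, hn⟩ := (LinearMap.eventually_isCompl_ker_pow_range_pow (S - μ • 1)).and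
    (Filter.eventually_ge_atTop (finrank K V)) |>.exists
  obtain ⟨hcompl, hn⟩ := hn
  have hker : LinearMap.ker ((S - μ • 1) ^ n) = S.maxGenEigenspace μ := by
    rw [Module.End.maxGenEigenspace_eq_genEigenspace_finrank]
    refine le_antisymm ?_ ?_
    · rw [← Module.End.maxGenEigenspace_eq_genEigenspace_finrank]
      exact fun y hy => (Module.End.mem_maxGenEigenspace _ _ _).2 ⟨n, hy⟩
    · rw [← Module.End.genEigenspace_nat]
      exact (S.genEigenspace μ).monotone (by exact_mod_cast hn)
  have hx0 : ∀ y, B x y = 0 := by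
    intro y
    have hy : y ∈ LinearMap.ker ((S - μ • 1) ^ n) ⊔ LinearMap.range ((S - μ • 1) ^ n) := by
      rw [hcompl.sup_eq_top]; trivial
    obtain ⟨u, hu, _, ⟨z, rfl⟩, rfl⟩ := Submodule.mem_sup.1 hy
    have hxk : ((S - μ • 1) ^ n) (x : V) = 0 := LinearMap.mem_ker.1 (hker.ge x.2)
    rw [map_add, ← pow_apply_left_eq_right (sub_smul_self_adjoint hS μ), hxk, map_zero,
      LinearMap.zero_apply, add_zero]
    exact hx ⟨u, hker ▸ hu⟩
  exact Subtype.ext (hnd.1 _ hx0)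

/-- An endomorphism that is self-adjoint for a symplectic form is annihilated by a square root of
its characteristic polynomial. -/
theorem exists_sq_eq_charpoly_and_aeval_eq_zero [CharZero K] [IsAlgClosed K] (hB : B.IsAlt)
    (hnd : B.Nondegenerate) {S : End K V} (hS : ∀ x y, B (S x) y = B x (S y)) :
    ∃ P : K[X], P ^ 2 = S.charpoly ∧ aeval S P = 0 := by
  classical
  set s := S.charpoly.roots
  have hcount : ∀ μ, s.count μ = finrank K (S.maxGenEigenspace μ) := fun μ => by
    rw [LinearMap.finrank_maxGenEigenspace_eq, count_roots]
  have halt : ∀ μ, (B.restrict (S.maxGenEigenspace μ)).IsAlt := fun μ x => hB x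
  have hndE := restrict_maxGenEigenspace_nondegenerate hB hnd hS
  refine ⟨∏ μ ∈ s.toFinset, (X - C μ) ^ (s.count μ / 2), ?_, ?_⟩
  · rw [(IsAlgClosed.splits S.charpoly).eq_prod_roots_of_monic S.charpoly_monic,
      Finset.prod_multiset_map_count, ← Finset.prod_pow]
    refine Finset.prod_congr rfl fun μ _ => ?_
    rw [← pow_mul, Nat.div_mul_cancel]
    rw [hcount]
    exact (even_finrank_of_isAlt_of_nondegenerate (halt μ) (hndE μ)).two_dvd
  · rw [← LinearMap.ker_eq_top, eq_top_iff, ← S.iSup_maxGenEigenspace_eq_top]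
    refine iSup_le fun μ x hx => ?_
    have hpow : ((S - μ • 1) ^ (s.count μ / 2)) x = 0 := by
      have hmaps : ∀ x ∈ S.maxGenEigenspace μ,
          (S - algebraMap K (End K V) μ) x ∈ S.maxGenEigenspace μ :=
        Module.End.mapsTo_maxGenEigenspace_of_comm
        (Algebra.mul_sub_algebraMap_commutes S μ) μ
      have hnil := S.isNilpotent_restrict_maxGenEigenspace_sub_algebraMap μ hmaps
      have h := pow_half_finrank_eq_zero (halt μ) (hndE μ)
        (fun x y => sub_smul_self_adjoint hS μ x y) hnil
      rw [← hcount, Module.End.pow_restrict] at h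
      simpa [Algebra.algebraMap_eq_smul_one] using
        congrArg Subtype.val (LinearMap.congr_fun h ⟨x, hx⟩)
    have hdvd : (X - C μ) ^ (s.count μ / 2) ∣ ∏ μ ∈ s.toFinset, (X - C μ) ^ (s.count μ / 2) := by
      by_cases hμ : μ ∈ s.toFinset
      · exact Finset.dvd_prod_of_mem (fun μ => (X - C μ) ^ (s.count μ / 2)) hμ
      · simp [Multiset.count_eq_zero.2 (by simpa using hμ)]
    obtain ⟨q, hq⟩ := hdvd
    rw [LinearMap.mem_ker, hq, mul_comm, map_mul, Module.End.mul_apply, map_pow, map_sub, aeval_X,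
      aeval_C, Algebra.algebraMap_eq_smul_one, hpow, map_zero]

end SelfAdjoint

theorem aeval_add_dickson {R A : Type*} [CommRing R] [Ring A] [Algebra R A] {x y : A} {g : R}
    (hxy : x * y = algebraMap R A g) (hyx : y * x = algebraMap R A g) (n : ℕ) :
    aeval (x + y) (dickson 1 g n) = x ^ n + y ^ n := by
  induction n using Nat.twoStepInduction with
  | zero =>
    rw [dickson_zero, map_sub, map_ofNat, Nat.cast_one, map_one]
    norm_num
  | one => simp
  | more n ih0 ih1 =>
    have h1 : x * y ^ (n + 1) = algebraMap R A g * y ^ n := by rw [pow_succ', ← mul_assoc, hxy]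
    have h2 : y * x ^ (n + 1) = algebraMap R A g * x ^ n := by rw [pow_succ', ← mul_assoc, hyx]
    rw [dickson_add_two, map_sub, map_mul, map_mul, aeval_X, aeval_C, ih0, ih1, add_mul, mul_add,
      mul_add, mul_add, h1, h2, ← pow_succ', ← pow_succ']
    abel

theorem natDegree_dickson_succ_sub_X_pow_le {R : Type*} [CommRing R] (g : R) (n : ℕ) :
    (dickson 1 g (n + 1) - X ^ (n + 1)).natDegree ≤ n := by
  induction n using Nat.twoStepInduction with
  | zero => simp
  | one =>
    have h : dickson 1 g (1 + 1) - X ^ (1 + 1) = C (-(2 * g)) := by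
      rw [dickson_two, Nat.cast_one, C_neg, C_mul, C_ofNat]
      ring
    rw [h, natDegree_C]
    exact zero_le_one
  | more n ih0 ih1 =>
    have h : dickson 1 g (n + 2 + 1) - X ^ (n + 2 + 1) =
        X * (dickson 1 g (n + 1 + 1) - X ^ (n + 1 + 1)) - C g * (dickson 1 g (n + 1) - X ^ (n + 1))
          - C g * X ^ (n + 1) := by
      rw [dickson_add_two 1 g (n + 1)]
      ring
    rw [h]
    refine (natDegree_sub_le _ _).trans (max_le ((natDegree_sub_le _ _).trans (max_le ?_ ?_)) ?_)
    · exact natDegree_mul_le.trans (by grw [natDegree_X_le, ih1]; omega)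
    · exact (natDegree_C_mul_le _ _).trans (by omega)
    · exact (natDegree_C_mul_X_pow_le _ _).trans (by omega)

theorem exists_eq_sum_dickson {K : Type*} [Field K] [CharZero K] (g : K) (k : ℕ) (P : K[X])
    (hP : P.natDegree ≤ k) :
    ∃ a : ℕ → K, P = ∑ n ∈ Finset.range (k + 1), C (a n) * dickson 1 g n := by
  induction k generalizing P with
  | zero =>
    refine ⟨fun _ => P.coeff 0 / 2, ?_⟩
    have h2 : dickson 1 g 0 = C (2 : K) := by
      rw [dickson_zero, Nat.cast_one, C_ofNat]; norm_num
    rw [Finset.sum_range_one, h2, ← C_mul, div_mul_cancel₀ _ two_ne_zero]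
    exact eq_C_of_natDegree_le_zero hP
  | succ k ih =>
    have hD := natDegree_dickson_succ_sub_X_pow_le g k
    obtain ⟨a, ha⟩ := ih (P - C (P.coeff (k + 1)) * dickson 1 g (k + 1)) (by
      have h : P - C (P.coeff (k + 1)) * dickson 1 g (k + 1) =
          (P - C (P.coeff (k + 1)) * X ^ (k + 1)) -
            C (P.coeff (k + 1)) * (dickson 1 g (k + 1) - X ^ (k + 1)) := by ring
      rw [h]
      refine (natDegree_sub_le _ _).trans (max_le ?_ ((natDegree_C_mul_le _ _).trans hD))
      refine natDegree_le_iff_coeff_eq_zero.2 fun m hm => ?_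
      rcases (Nat.succ_le_of_lt hm).eq_or_lt with rfl | hm'
      · simp
      · rw [coeff_sub, coeff_C_mul_X_pow, if_neg (by omega),
          coeff_eq_zero_of_natDegree_lt (by omega), sub_zero])
    refine ⟨Function.update a (k + 1) (P.coeff (k + 1)), ?_⟩
    rw [Finset.sum_range_succ, Function.update_self, ← sub_eq_iff_eq_add, ha]
    refine Finset.sum_congr rfl fun n hn => ?_
    rw [Function.update_of_ne (by have := Finset.mem_range.1 hn; omega)]

theorem eval_sum_dickson_lift {K : Type*} [Field K] (a : ℕ → K) (g : K) (k : ℕ) {t : K}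
    (ht : t ≠ 0) :
    (∑ n ∈ Finset.range (k + 1), C (a n) * (X ^ (k + n) + C (g ^ n) * X ^ (k - n))).eval t =
      t ^ k * (∑ n ∈ Finset.range (k + 1), C (a n) * dickson 1 g n).eval (t + g / t) := by
  have hD : ∀ n, (dickson 1 g n).eval (t + g / t) = t ^ n + (g / t) ^ n := fun n => by
    rw [← coe_aeval_eq_eval]
    exact aeval_add_dickson (mul_div_cancel₀ g ht) (div_mul_cancel₀ g ht) n
  rw [eval_finsetSum, eval_finsetSum, Finset.mul_sum]
  refine Finset.sum_congr rfl fun n hn => ?_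
  have hnk : n ≤ k := Nat.lt_succ_iff.1 (Finset.mem_range.1 hn)
  simp only [eval_mul, eval_C, eval_add, eval_pow, eval_X, hD]
  obtain ⟨m, rfl⟩ := Nat.exists_eq_add_of_le hnk
  rw [Nat.add_sub_cancel_left, div_pow]
  field_simp
  ring

theorem coeff_sum_dickson_lift {K : Type*} [Field K] (a : ℕ → K) (g : K) {k m : ℕ} (hm : m < k) :
    (∑ n ∈ Finset.range (k + 1), C (a n) * (X ^ (k + n) + C (g ^ n) * X ^ (k - n))).coeff
      (k + (m + 1)) = a (m + 1) := by
  rw [finsetSum_coeff, Finset.sum_eq_single (m + 1)]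
  · rw [coeff_C_mul, coeff_add, coeff_X_pow_self, coeff_C_mul_X_pow, if_neg (by omega)]
    simp
  · intro n _ hn
    rw [coeff_C_mul, coeff_add, coeff_X_pow, coeff_C_mul_X_pow, if_neg (by omega),
      if_neg (by omega)]
    simp
  · intro h
    exact absurd (Finset.mem_range.2 (by omega)) h

theorem coeff_sum_dickson_lift_zero {K : Type*} [Field K] (a : ℕ → K) (g : K) (k : ℕ) :
    (∑ n ∈ Finset.range (k + 1), C (a n) * (X ^ (k + n) + C (g ^ n) * X ^ (k - n))).coeff k =
      2 * a 0 := by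
  rw [finsetSum_coeff, Finset.sum_eq_single 0]
  · simp; ring
  · intro n hn hn0
    have := Finset.mem_range.1 hn
    rw [coeff_C_mul, coeff_add, coeff_X_pow, coeff_C_mul_X_pow, if_neg (by omega),
      if_neg (by omega)]
    simp
  · simp

theorem charpoly_mul_eval_eq {n : Type*} [Fintype n] [DecidableEq n] {M N : Matrix n n ℂ} {g : ℂ}
    (hMN : M * N = g • 1) {t : ℂ} (ht : t ≠ 0) :
    M.charpoly.eval t * N.charpoly.eval t =
      t ^ Fintype.card n * (M + N).charpoly.eval (t + g / t) := by
  simp only [eval_charpoly]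
  rw [← det_mul, ← det_smul]
  congr 1
  simp only [scalar_apply, ← smul_one_eq_diagonal]
  rw [sub_mul, mul_sub, mul_sub, hMN, smul_sub, smul_smul, mul_add, mul_div_cancel₀ g ht, smul_add,
    add_smul]
  simp only [smul_mul_assoc, mul_smul_comm, one_mul, mul_one, smul_smul]
  abel

theorem eq_or_eq_neg_charpoly {n : Type*} [Fintype n] [DecidableEq n] {M N : Matrix n n ℂ} {g : ℂ}
    {k : ℕ} (hn : Fintype.card n = 2 * k) (hMN : M * N = g • 1) (hchar : N.charpoly = M.charpoly)
    {P Q : ℂ[X]} (hP : P ^ 2 = (M + N).charpoly)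
    (hQ : ∀ t : ℂ, t ≠ 0 → Q.eval t = t ^ k * P.eval (t + g / t)) :
    M.charpoly = Q ∨ M.charpoly = -Q := by
  refine sq_eq_sq_iff_eq_or_eq_neg.1 (eq_of_infinite_eval_eq _ _ ?_)
  refine (Set.finite_singleton (0 : ℂ)).infinite_compl.mono fun t ht => ?_
  have h := charpoly_mul_eval_eq hMN ht
  rw [hchar, ← hP, hn] at h
  simp only [Set.mem_ofPred_eq, eval_pow] at h ⊢
  rw [hQ t ht, sq, h]
  ring

/-- The parent Cayley–Hamilton identity for a matrix `M` and its adjoint `N` for a symplectic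
form `J`, where `M * N = N * M` is scalar. -/
theorem parent_cayley_hamilton_of_skew {n : Type*} [Fintype n] [DecidableEq n]
    {J M N : Matrix n n ℂ} {g : ℂ} {k : ℕ} (hn : Fintype.card n = 2 * k) (hJ : Jᵀ = -J)
    (hJdet : IsUnit J.det) (hJN : J * N = Mᵀ * J) (hMN : M * N = g • 1) (hNM : N * M = g • 1) :
    ∑ m ∈ Finset.range (k + 1), M.charpoly.coeff (k + m) • M ^ m +
      ∑ m ∈ Finset.range k, M.charpoly.coeff (k + (m + 1)) • N ^ (m + 1) = 0 := by
  have hJM : J * M = Nᵀ * J := by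
    have h := congrArg transpose hJN
    simp only [transpose_mul, transpose_transpose, hJ, mul_neg, neg_mul, neg_inj] at h
    exact h.symm
  have hchar : N.charpoly = M.charpoly := by
    have hN : N = J⁻¹ * (Mᵀ * J) := by rw [← hJN, nonsing_inv_mul_cancel_left _ _ hJdet]
    rw [hN, charpoly_mul_comm, mul_nonsing_inv_cancel_right _ _ hJdet, charpoly_transpose]
  have hdot : ∀ x y : n → ℂ, toBilin' J x y = x ⬝ᵥ J *ᵥ y := fun x y => by
    rw [toBilin'_apply']
  obtain ⟨P, hP, hPS⟩ := exists_sq_eq_charpoly_and_aeval_eq_zero (B := toBilin' J)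
    (S := toLin' (M + N))
    (by
      intro x
      refine self_eq_neg.1 ?_
      rw [hdot]
      conv_lhs => rw [dotProduct_mulVec, ← mulVec_transpose, hJ, neg_mulVec, neg_dotProduct,
        dotProduct_comm])
    (nondegenerate_toBilin'_iff.2 (nondegenerate_of_det_ne_zero hJdet.ne_zero))
    (by
      intro x y
      rw [hdot, hdot, toLin'_apply, toLin'_apply, mulVec_mulVec, mul_add, hJM, hJN, ← add_mul,
        ← mulVec_mulVec, dotProduct_mulVec x, ← mulVec_transpose, transpose_add,
        transpose_transpose, transpose_transpose, add_comm M])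
  rw [charpoly_toLin'] at hP
  have hPS' : aeval (M + N) P = 0 := by
    have h := aeval_algHom_apply (toLinAlgEquiv' : Matrix n n ℂ ≃ₐ[ℂ] _) (M + N) P
    exact (toLinAlgEquiv' : Matrix n n ℂ ≃ₐ[ℂ] _).injective
      ((h.symm.trans hPS).trans (map_zero _).symm)
  have hdeg : P.natDegree ≤ k := by
    have h := congrArg natDegree hP
    rw [natDegree_pow, charpoly_natDegree_eq_dim, hn] at h
    omega
  obtain ⟨a, rfl⟩ := exists_eq_sum_dickson g k P hdeg
  have hsum : ∑ m ∈ Finset.range (k + 1), a m • (M ^ m + N ^ m) = 0 := by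
    rw [← hPS', map_sum]
    refine Finset.sum_congr rfl fun m _ => ?_
    rw [map_mul, aeval_C, aeval_add_dickson (by rw [hMN, Algebra.algebraMap_eq_smul_one])
      (by rw [hNM, Algebra.algebraMap_eq_smul_one]), Algebra.smul_def]
  set Q : ℂ[X] :=
    ∑ n ∈ Finset.range (k + 1), C (a n) * (X ^ (k + n) + C (g ^ n) * X ^ (k - n)) with hQdef
  have hQ : ∑ m ∈ Finset.range (k + 1), Q.coeff (k + m) • M ^ m +
      ∑ m ∈ Finset.range k, Q.coeff (k + (m + 1)) • N ^ (m + 1) = 0 := by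
    have hcoeff : ∀ m ∈ Finset.range k, Q.coeff (k + (m + 1)) = a (m + 1) := fun m hm =>
      coeff_sum_dickson_lift a g (Finset.mem_range.1 hm)
    rw [← hsum, Finset.sum_range_succ', Finset.sum_range_succ' (fun m => a m • (M ^ m + N ^ m)),
      Finset.sum_congr rfl fun m hm => congrArg (· • M ^ (m + 1)) (hcoeff m hm),
      Finset.sum_congr rfl fun m hm => congrArg (· • N ^ (m + 1)) (hcoeff m hm),
      add_zero, coeff_sum_dickson_lift_zero]
    simp only [smul_add, Finset.sum_add_distrib, pow_zero, two_mul, add_smul]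
    abel
  rcases eq_or_eq_neg_charpoly hn hMN hchar hP
    (fun t ht => eval_sum_dickson_lift a g k ht) with h | h
  · rw [h]
    exact hQ
  · rw [h]
    simp only [coeff_neg, neg_smul, Finset.sum_neg_distrib]
    rw [← neg_add, hQ, neg_zero]

theorem Omega_mul_Omega (k : ℕ) : Omega k * Omega k = -1 := by
  ext a b
  rw [mul_apply, Finset.sum_eq_single a.rev]
  · have ha := a.2
    have hb := b.2
    simp only [Omega, Fin.val_rev, Matrix.neg_apply, Matrix.one_apply, Fin.ext_iff]
    split_ifs <;> first | omega | norm_num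
  · intro c _ hc
    have hc' : (c : ℕ) ≠ 2 * k - (a + 1) := fun h => hc (Fin.ext (by simpa using h))
    simp only [Omega]
    rw [if_neg (by omega), zero_mul]
  · simp

theorem transpose_Omega (k : ℕ) : (Omega k)ᵀ = -Omega k := by
  ext a b
  have ha := a.2
  have hb := b.2
  simp only [Omega, transpose_apply, Matrix.neg_apply]
  split_ifs <;> first | omega | norm_num

/-- **Classical parent Cayley–Hamilton identity for conformal-symplectic matrices**
(eq. (4.30) of Ogievetsky–Pyatov).

If `Mᵀ Ω M = g Ω = M Ω Mᵀ` and `π(M) = -Ω Mᵀ Ω`, then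
`∑_{i=0}^{k} (-1)^i M^{k-i} ε_i + ∑_{i=0}^{k-1} (-1)^i π(M)^{k-i} ε_i = 0`. -/
theorem classical_parent_cayley_hamilton
    (k : ℕ) (hk : 1 ≤ k) (M : Matrix (Fin (2 * k)) (Fin (2 * k)) ℂ) (g : ℂ)
    (h1 : Mᵀ * Omega k * M = g • Omega k)
    (h2 : M * Omega k * Mᵀ = g • Omega k) :
    ∑ i ∈ Finset.range (k + 1), ((-1 : ℂ) ^ i * epsClassical k M i) • M ^ (k - i) +
      ∑ i ∈ Finset.range k,
        ((-1 : ℂ) ^ i * epsClassical k M i) • (-(Omega k * Mᵀ * Omega k)) ^ (k - i) = 0 := by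
  have hΩ := Omega_mul_Omega k
  have hdet : IsUnit (Omega k).det :=
    (isUnit_iff_isUnit_det _).1 (IsUnit.of_mul_eq_one (-Omega k) (by rw [mul_neg, hΩ, neg_neg]))
  have hcoeff : ∀ i, (-1 : ℂ) ^ i * epsClassical k M i = M.charpoly.coeff (2 * k - i) := fun i => by
    rw [epsClassical, ← mul_assoc, ← mul_pow, neg_one_mul, neg_neg, one_pow, one_mul]
  have h := parent_cayley_hamilton_of_skew (J := Omega k) (M := M)
    (N := -(Omega k * Mᵀ * Omega k)) (g := g) (Fintype.card_fin _) (transpose_Omega k) hdet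
    (by rw [mul_neg, mul_assoc, ← mul_assoc, hΩ, neg_one_mul, neg_neg])
    (by rw [mul_neg, ← mul_assoc, ← mul_assoc, h2, smul_mul_assoc, hΩ, smul_neg, neg_neg])
    (by rw [neg_mul, mul_assoc, mul_assoc, ← mul_assoc Mᵀ, h1, mul_smul_comm, hΩ, smul_neg,
      neg_neg])
  rw [← h, ← Finset.sum_range_reflect, ← Finset.sum_range_reflect _ k]
  refine congrArg₂ (· + ·) (Finset.sum_congr rfl fun m hm => ?_)
    (Finset.sum_congr rfl fun m hm => ?_)
  · have hm := Finset.mem_range.1 hm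
    rw [hcoeff]
    congr 2 <;> omega
  · have hm := Finset.mem_range.1 hm
    rw [hcoeff]
    congr 2 <;> omega

end QMA

end
end
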